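/- Let 1 < ρ ≤ 3/2 and set l = 2(ρ−1). Suppose v : ℝ² → ℝ is a C² solution of Δv(y) + (1+|y|²)^l e^{v(y)} = 0 on ℝ², the function y ↦ (1+|y|²)^l e^{v(y)} is integrable with ∫_{ℝ²} (1+|y|²)^l e^{v(y)} dy = 8πρ, and ∇v(0) = 0. Then v is radially symmetric about the origin: v(y) = v(z) whenever |y| = |z|. -/

import Mathlib

open MeasureTheory Real

/-- The Euclidean Laplacian on `ℝ²`: the sum of the two pure second partial
derivatives in the standard coordinate directions. -/
noncomputable def planeLaplacian (v : EuclideanSpace ℝ (Fin 2) → ℝ)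
    (y : EuclideanSpace ℝ (Fin 2)) : ℝ :=
  ∑ i : Fin 2,
    fderiv ℝ (fun z => fderiv ℝ v z (EuclideanSpace.single i 1)) y
      (EuclideanSpace.single i 1)

namespace RS
open Complex (I)
open scoped ComplexConjugate

/-- The real-linear map `h ↦ a h + b conj h`. -/
noncomputable def WL (a b : ℂ) : ℂ →L[ℝ] ℂ :=
  a • (ContinuousLinearMap.id ℝ ℂ) + b • (Complex.conjCLE : ℂ →L[ℝ] ℂ)

lemma WL_apply (a b h : ℂ) : WL a b h = a * h + b * conj h := by
  simp [WL]

/-- Wirtinger derivatives. -/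
def HasW (g : ℂ → ℂ) (a b : ℂ) (z : ℂ) : Prop := HasFDerivAt g (WL a b) z

noncomputable def dz (g : ℂ → ℂ) (z : ℂ) : ℂ := (fderiv ℝ g z 1 - I * fderiv ℝ g z I) / 2
noncomputable def dzb (g : ℂ → ℂ) (z : ℂ) : ℂ := (fderiv ℝ g z 1 + I * fderiv ℝ g z I) / 2

lemma HasW.dz {g : ℂ → ℂ} {a b z : ℂ} (h : HasW g a b z) : dz g z = a := by
  unfold RS.dz; rw [HasFDerivAt.fderiv h]; simp only [WL_apply]
  simp only [map_one, Complex.conj_I, mul_one]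
  linear_combination (b / 2 - a / 2) * Complex.I_mul_I

lemma HasW.dzb {g : ℂ → ℂ} {a b z : ℂ} (h : HasW g a b z) : dzb g z = b := by
  unfold RS.dzb; rw [HasFDerivAt.fderiv h]; simp only [WL_apply]
  simp only [map_one, Complex.conj_I, mul_one]
  linear_combination (a / 2 - b / 2) * Complex.I_mul_I

lemma clm_eq_WL (L : ℂ →L[ℝ] ℂ) : L = WL ((L 1 - I * L I) / 2) ((L 1 + I * L I) / 2) := by
  ext h
  rw [WL_apply]
  have h1 : L h = h.re * L 1 + h.im * L I := by
    conv_lhs => rw [← Complex.re_add_im h]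
    rw [map_add]
    have e1 : ((h.re : ℂ)) = h.re • (1 : ℂ) := by simp
    have e2 : ((h.im : ℂ) * I) = h.im • I := by simp
    rw [e2]; nth_rewrite 1 [e1]
    rw [map_smul, map_smul]; simp
  have e3 : h = h.re + h.im * I := (Complex.re_add_im h).symm
  have e4 : conj h = h.re - h.im * I := by
    apply Complex.ext <;> simp
  rw [h1, e4]
  conv_rhs => rw [e3]
  simp only [Complex.add_re, Complex.ofReal_re, Complex.mul_re, Complex.I_re, Complex.I_im,
    Complex.add_im, Complex.mul_im, Complex.ofReal_im]
  ring_nf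
  simp only [Complex.I_sq]; ring_nf

lemma hasW_of_diff {g : ℂ → ℂ} {z : ℂ} (h : DifferentiableAt ℝ g z) :
    HasW g (RS.dz g z) (RS.dzb g z) z := by
  have := h.hasFDerivAt
  rw [clm_eq_WL (fderiv ℝ g z)] at this
  exact this

lemma HasW.diff {g : ℂ → ℂ} {a b z : ℂ} (h : HasW g a b z) : DifferentiableAt ℝ g z :=
  HasFDerivAt.differentiableAt h

lemma HasW.congr {g : ℂ → ℂ} {a b a' b' z : ℂ} (h : HasW g a b z) (ha : a = a') (hb : b = b') :
    HasW g a' b' z := by subst ha; subst hb; exact h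

lemma HasW.of_eq {g g' : ℂ → ℂ} {a b z : ℂ} (h : HasW g a b z) (hg : ∀ x, g' x = g x) :
    HasW g' a b z := by
  have : g' = g := funext hg
  rw [this]; exact h

lemma hasW_const (c z : ℂ) : HasW (fun _ => c) 0 0 z := by
  have : WL 0 0 = 0 := by ext; simp [WL]
  unfold HasW; rw [this]; exact hasFDerivAt_const c z

lemma hasW_id (z : ℂ) : HasW (fun x => x) 1 0 z := by
  have : WL 1 0 = ContinuousLinearMap.id ℝ ℂ := by ext; simp [WL]
  unfold HasW; rw [this]; exact hasFDerivAt_id z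

lemma hasW_conj (z : ℂ) : HasW (fun x => conj x) 0 1 z := by
  have : WL 0 1 = (Complex.conjCLE : ℂ →L[ℝ] ℂ) := by ext; simp [WL]
  unfold HasW; rw [this]; exact Complex.conjCLE.hasFDerivAt

lemma HasW.add {g h : ℂ → ℂ} {a b c d z : ℂ} (h1 : HasW g a b z) (h2 : HasW h c d z) :
    HasW (fun x => g x + h x) (a + c) (b + d) z := by
  have : WL (a + c) (b + d) = WL a b + WL c d := by ext; simp [WL_apply]; ring
  unfold HasW; rw [this]; exact HasFDerivAt.add h1 h2

lemma HasW.neg {g : ℂ → ℂ} {a b z : ℂ} (h1 : HasW g a b z) :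
    HasW (fun x => - g x) (-a) (-b) z := by
  have : WL (-a) (-b) = - WL a b := by ext; simp [WL_apply]; ring
  unfold HasW; rw [this]; exact HasFDerivAt.neg h1

lemma HasW.sub {g h : ℂ → ℂ} {a b c d z : ℂ} (h1 : HasW g a b z) (h2 : HasW h c d z) :
    HasW (fun x => g x - h x) (a - c) (b - d) z := by
  have := h1.add h2.neg
  simpa [sub_eq_add_neg] using this

lemma HasW.mul {g h : ℂ → ℂ} {a b c d z : ℂ} (h1 : HasW g a b z) (h2 : HasW h c d z) :
    HasW (fun x => g x * h x) (a * h z + g z * c) (b * h z + g z * d) z := by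
  have := HasFDerivAt.mul h1 h2
  unfold HasW
  convert! this using 1
  ext x; simp [WL_apply]; ring

lemma HasW.const_mul {g : ℂ → ℂ} {a b z : ℂ} (c : ℂ) (h1 : HasW g a b z) :
    HasW (fun x => c * g x) (c * a) (c * b) z := by
  refine ((hasW_const c z).mul h1).congr ?_ ?_ <;> simp

lemma HasW.conj {g : ℂ → ℂ} {a b z : ℂ} (h1 : HasW g a b z) :
    HasW (fun x => conj (g x)) (conj b) (conj a) z := by
  have := (Complex.conjCLE : ℂ →L[ℝ] ℂ).hasFDerivAt.comp z h1
  unfold HasW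
  convert! this using 1
  ext x; simp [WL_apply]; ring

/-- composition with a holomorphic function -/
lemma HasW.comp_hol {g : ℂ → ℂ} {a b z : ℂ} {F : ℂ → ℂ} {F' : ℂ} (hF : HasDerivAt F F' (g z))
    (h1 : HasW g a b z) : HasW (fun x => F (g x)) (F' * a) (F' * b) z := by
  have := (hF.hasFDerivAt.restrictScalars ℝ).comp z h1
  unfold HasW
  convert! this using 1
  ext x; simp [WL_apply]; ring

lemma HasW.cexp {g : ℂ → ℂ} {a b z : ℂ} (h1 : HasW g a b z) :
    HasW (fun x => Complex.exp (g x)) (Complex.exp (g z) * a) (Complex.exp (g z) * b) z :=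
  h1.comp_hol (Complex.hasDerivAt_exp _)

lemma HasW.inv {g : ℂ → ℂ} {a b z : ℂ} (h1 : HasW g a b z) (h0 : g z ≠ 0) :
    HasW (fun x => (g x)⁻¹) (-(a / (g z) ^ 2)) (-(b / (g z) ^ 2)) z := by
  refine (h1.comp_hol (hasDerivAt_inv h0)).congr ?_ ?_ <;> ring

/-- precomposition with a real affine map `y ↦ z₀ + t y` -/
lemma HasW.comp_affine {g : ℂ → ℂ} {a b z₀ y : ℂ} {t : ℝ} (h1 : HasW g a b (z₀ + t * y)) :
    HasW (fun y => g (z₀ + t * y)) (t * a) (t * b) y := by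
  have h2 : HasW (fun y : ℂ => z₀ + t * y) t 0 y := by
    refine ((hasW_const z₀ y).add ((hasW_id y).const_mul t)).congr ?_ ?_ <;> simp
  have := HasFDerivAt.comp (f := fun y : ℂ => z₀ + t * y) y h1 h2
  unfold HasW
  convert! this using 1
  ext x; simp [WL_apply]; ring

/-- composition of a real function with a real-valued function -/
lemma HasW.comp_real {g : ℂ → ℝ} {a b z : ℂ} {F : ℝ → ℝ} {F' : ℝ} (hF : HasDerivAt F F' (g z))
    (h1 : HasW (fun x => (g x : ℂ)) a b z) :
    HasW (fun x => ((F (g x) : ℝ) : ℂ)) (F' * a) (F' * b) z := by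
  have h2 : HasFDerivAt g (Complex.reCLM.comp (WL a b)) z := by
    have := Complex.reCLM.hasFDerivAt.comp z h1
    exact this
  have him : Complex.imCLM.comp (WL a b) = 0 := by
    have h3 := Complex.imCLM.hasFDerivAt.comp z h1
    have h4 : (Complex.imCLM ∘ fun x => (g x : ℂ)) = fun _ => 0 := by ext; simp
    rw [h4] at h3
    exact h3.unique (hasFDerivAt_const _ _)
  have h5 := Complex.ofRealCLM.hasFDerivAt.comp z (hF.hasFDerivAt.comp z h2)
  unfold HasW
  convert! h5 using 1
  ext x
  have := congrArg (fun L => L x) him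
  simp only [ContinuousLinearMap.comp_apply, Complex.imCLM_apply, zero_apply] at this
  have e : WL a b x = (((WL a b x).re : ℝ) : ℂ) := by
    apply Complex.ext <;> simp [this]
  have e2 : WL (F' * a) (F' * b) x = F' * WL a b x := by simp [WL_apply]; ring
  rw [e2, e]; simp; ring

lemma contDiff_dz {n : ℕ∞} {g : ℂ → ℂ} (hg : ContDiff ℝ (n + 1) g) : ContDiff ℝ n (dz g) := by
  have h1 : ContDiff ℝ n (fderiv ℝ g) := hg.fderiv_right le_rfl
  unfold RS.dz
  fun_prop

lemma contDiff_dzb {n : ℕ∞} {g : ℂ → ℂ} (hg : ContDiff ℝ (n + 1) g) : ContDiff ℝ n (dzb g) := by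
  have h1 : ContDiff ℝ n (fderiv ℝ g) := hg.fderiv_right le_rfl
  unfold RS.dzb
  fun_prop

lemma cd_hasW {g : ℂ → ℂ} (hg : ContDiff ℝ 1 g) (z : ℂ) : HasW g (dz g z) (dzb g z) z :=
  hasW_of_diff ((hg.differentiable (by norm_num)) z)

lemma continuous_dz {g : ℂ → ℂ} (hg : ContDiff ℝ 1 g) : Continuous (dz g) :=
  (contDiff_dz (n := 0) (by simpa using hg)).continuous

lemma continuous_dzb {g : ℂ → ℂ} (hg : ContDiff ℝ 1 g) : Continuous (dzb g) :=
  (contDiff_dzb (n := 0) (by simpa using hg)).continuous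

lemma hcs_dz {g : ℂ → ℂ} (hg : HasCompactSupport g) : HasCompactSupport (dz g) := by
  have h := hg.fderiv (𝕜 := ℝ)
  refine h.mono ?_
  intro z hz
  contrapose! hz
  simp only [Function.notMem_support] at hz ⊢
  simp [RS.dz, hz]

lemma hcs_dzb {g : ℂ → ℂ} (hg : HasCompactSupport g) : HasCompactSupport (dzb g) := by
  have h := hg.fderiv (𝕜 := ℝ)
  refine h.mono ?_
  intro z hz
  contrapose! hz
  simp only [Function.notMem_support] at hz ⊢
  simp [RS.dzb, hz]

lemma integral_fderiv_zero {g : ℂ → ℂ} (hg : ContDiff ℝ 1 g) (hc : HasCompactSupport g) (e : ℂ) :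
    Integrable (fun z => fderiv ℝ g z e) ∧ ∫ z, fderiv ℝ g z e = 0 := by
  have hi : Integrable (fun z => fderiv ℝ g z e) := by
    apply Continuous.integrable_of_hasCompactSupport
    · exact (hg.continuous_fderiv (by norm_num)).clm_apply continuous_const
    · exact hc.fderiv_apply (𝕜 := ℝ) e
  refine ⟨hi, ?_⟩
  have := integral_mul_fderiv_eq_neg_fderiv_mul_of_integrable (μ := volume) (𝕜 := ℂ) (f := fun _ : ℂ => (1 : ℂ))
    (g := g) (v := e) (by simp) (by simpa using hi)
    (by simpa using hg.continuous.integrable_of_hasCompactSupport hc) (by intros; fun_prop)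
    (by intro x _; exact (hg.differentiable (by norm_num)) x)
  simpa using this

lemma integral_dz {g : ℂ → ℂ} (hg : ContDiff ℝ 1 g) (hc : HasCompactSupport g) :
    ∫ z, dz g z = 0 := by
  obtain ⟨i1, h1⟩ := integral_fderiv_zero hg hc 1
  obtain ⟨i2, h2⟩ := integral_fderiv_zero hg hc I
  unfold RS.dz
  rw [integral_div, integral_sub i1 (i2.const_mul _), integral_const_mul, h1, h2]; simp

lemma integral_dzb {g : ℂ → ℂ} (hg : ContDiff ℝ 1 g) (hc : HasCompactSupport g) :
    ∫ z, dzb g z = 0 := by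
  obtain ⟨i1, h1⟩ := integral_fderiv_zero hg hc 1
  obtain ⟨i2, h2⟩ := integral_fderiv_zero hg hc I
  unfold RS.dzb
  rw [integral_div, integral_add i1 (i2.const_mul _), integral_const_mul, h1, h2]; simp

end RS

namespace RS
open Complex (I)
open scoped ComplexConjugate

lemma integrableOn_inv_norm (r : ℝ) : IntegrableOn (fun x : ℂ => ‖x‖⁻¹) (Metric.ball (0 : ℂ) r) := by
  rw [integrableOn_fun_norm_addHaar volume (f := fun y => y⁻¹)]
  have h : IntegrableOn (fun _ : ℝ => (1 : ℝ)) (Set.Ioo 0 r) := by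
    simp [integrableOn_const_iff]
  refine h.congr_fun ?_ measurableSet_Ioo
  intro y hy
  have := hy.1.ne'
  simp [this]

lemma integral_inv_norm {r : ℝ} (hr : 0 ≤ r) :
    ∫ x in Metric.ball (0 : ℂ) r, ‖x‖⁻¹ = 2 * π * r := by
  have h1 : ∫ x in Metric.ball (0 : ℂ) r, ‖x‖⁻¹ =
      ∫ x : ℂ, (Set.Iio r).indicator (fun y : ℝ => y⁻¹) ‖x‖ := by
    rw [← integral_indicator measurableSet_ball]
    congr 1; ext x; simp [Set.indicator]
  rw [h1, integral_fun_norm_addHaar]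
  have h2 : ∫ y in Set.Ioi (0 : ℝ), y ^ (Module.finrank ℝ ℂ - 1) •
      (Set.Iio r).indicator (fun y : ℝ => y⁻¹) y = ∫ y in Set.Ioi (0:ℝ), (Set.Iio r).indicator (fun _ => (1:ℝ)) y := by
    apply setIntegral_congr_fun measurableSet_Ioi
    intro y hy
    have : y ≠ 0 := ne_of_gt hy
    by_cases h : y < r <;> simp [h, this]
  rw [h2, setIntegral_indicator measurableSet_Iio]
  have : Set.Ioi 0 ∩ Set.Iio r = Set.Ioo 0 r := rfl
  rw [this]
  simp [Measure.real, hr]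
  ring

lemma integral_japanese : Integrable (fun x : ℂ => ((1 + ‖x‖ ^ 2) ^ 2)⁻¹) ∧
    ∫ x : ℂ, ((1 + ‖x‖ ^ 2) ^ 2)⁻¹ = π := by
  have hd : ∀ x ∈ Set.Ici (0 : ℝ), HasDerivAt (fun y : ℝ => -(2 * (1 + y ^ 2))⁻¹)
      (x * ((1 + x ^ 2) ^ 2)⁻¹) x := by
    intro x _
    have h0 : (2 * (1 + x ^ 2)) ≠ 0 := by positivity
    have h1 : HasDerivAt (fun y : ℝ => 2 * (1 + y ^ 2)) (2 * (2 * x)) x := by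
      have := ((hasDerivAt_pow 2 x).const_add 1).const_mul 2
      simpa using this
    have := (h1.inv h0).neg
    refine this.congr_deriv ?_
    field_simp
  have hlim : Filter.Tendsto (fun y : ℝ => -(2 * (1 + y ^ 2))⁻¹) Filter.atTop (nhds 0) := by
    have : Filter.Tendsto (fun y : ℝ => 2 * (1 + y ^ 2)) Filter.atTop Filter.atTop := by
      apply Filter.Tendsto.const_mul_atTop (by norm_num)
      apply Filter.tendsto_atTop_add_const_left
      exact Filter.tendsto_pow_atTop (by norm_num)
    simpa using this.inv_tendsto_atTop.neg
  have hpos : ∀ x ∈ Set.Ioi (0 : ℝ), 0 ≤ x * ((1 + x ^ 2) ^ 2)⁻¹ := by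
    intro x hx; have : 0 < x := hx; positivity
  have hi : IntegrableOn (fun x : ℝ => x * ((1 + x ^ 2) ^ 2)⁻¹) (Set.Ioi 0) :=
    integrableOn_Ioi_deriv_of_nonneg' hd hpos hlim
  have hv := integral_Ioi_of_hasDerivAt_of_nonneg' hd hpos hlim
  constructor
  · rw [integrable_fun_norm_addHaar volume (f := fun y => ((1 + y ^ 2) ^ 2)⁻¹)]
    simpa using hi
  · rw [integral_fun_norm_addHaar volume (fun y => ((1 + y ^ 2) ^ 2)⁻¹)]
    simp only [Complex.finrank_real_complex, Nat.add_one_sub_one, pow_one, smul_eq_mul]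
    rw [hv]
    simp [Measure.real]
    ring

/-- bounded compactly supported measurable over `ζ` is integrable -/
lemma integrable_div_self {h : ℂ → ℂ} (hc : Continuous h) (hs : HasCompactSupport h) :
    Integrable (fun x => h x / x) := by
  obtain ⟨R, hR⟩ := hs.isCompact.isBounded.subset_ball 0
  obtain ⟨C, hC⟩ := hc.bounded_above_of_compact_support hs
  have hC0 : 0 ≤ C := (norm_nonneg _).trans (hC 0)
  have h1 : Integrable ((Metric.ball (0:ℂ) R).indicator (fun x : ℂ => C * ‖x‖⁻¹)) :=
    (integrable_indicator_iff measurableSet_ball).2 ((integrableOn_inv_norm R).const_mul C)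
  refine h1.mono' ?_ ?_
  · exact (hc.measurable.div measurable_id).aestronglyMeasurable
  · filter_upwards with x
    by_cases hx : x ∈ Metric.ball (0 : ℂ) R
    · rw [Set.indicator_of_mem hx, norm_div, div_eq_mul_inv]
      gcongr; exact hC x
    · rw [Set.indicator_of_notMem hx]
      have : h x = 0 := by
        by_contra h0
        exact hx (hR (subset_tsupport _ h0))
      simp [this]

lemma normsq_eq (z : ℂ) : z * conj z = ((‖z‖ ^ 2 : ℝ) : ℂ) := by
  rw [Complex.mul_conj, Complex.normSq_eq_norm_sq]

/-- Cauchy–Pompeiu at the origin for compactly supported functions. -/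
lemma cp0 {G : ℂ → ℂ} (hG : ContDiff ℝ 1 G) (hs : HasCompactSupport G) :
    ∫ x, dzb G x / x = - (π * G 0) := by
  have key : ∀ δ : ℝ, 0 < δ → ∫ x, dzb G x * (conj x / (‖x‖ ^ 2 + δ ^ 2 : ℝ)) =
      - ∫ y : ℂ, G (δ * y) * ((((1 + ‖y‖ ^ 2) ^ 2)⁻¹ : ℝ) : ℂ) := by
    intro δ hδ
    have hne : ∀ x : ℂ, (x * conj x + (δ : ℂ) ^ 2) ≠ 0 := by
      intro x
      rw [normsq_eq]
      have : (0:ℝ) < ‖x‖ ^ 2 + δ ^ 2 := by positivity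
      exact_mod_cast this.ne'
    have hk : ∀ x : ℂ, HasW (fun x => conj x * (x * conj x + (δ : ℂ) ^ 2)⁻¹)
        (conj x * -((conj x) / (x * conj x + (δ : ℂ) ^ 2) ^ 2))
        (δ ^ 2 / (x * conj x + (δ : ℂ) ^ 2) ^ 2) x := by
      intro x
      have h1 : HasW (fun x => x * conj x + (δ : ℂ) ^ 2) (conj x) x x := by
        refine (((hasW_id x).mul (hasW_conj x)).add (hasW_const _ x)).congr ?_ ?_ <;> simp
      refine ((hasW_conj x).mul (h1.inv (hne x))).congr ?_ ?_
      · ring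
      · have := hne x
        field_simp
        ring
    have hkc : ContDiff ℝ 1 (fun x : ℂ => conj x * (x * conj x + (δ : ℂ) ^ 2)⁻¹) := by
      have hcj : ContDiff ℝ 1 (fun x : ℂ => conj x) := Complex.conjCLE.contDiff
      exact hcj.mul (((contDiff_id.mul hcj).add contDiff_const).inv hne)
    have hz := integral_dzb (hG.mul hkc) hs.mul_right
    have hprod : ∀ x, dzb (fun x => G x * (conj x * (x * conj x + (δ : ℂ) ^ 2)⁻¹)) x =
        dzb G x * (conj x / (‖x‖ ^ 2 + δ ^ 2 : ℝ)) + G x * (δ ^ 2 / (x * conj x + (δ : ℂ) ^ 2) ^ 2) := by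
      intro x
      rw [((cd_hasW hG x).mul (hk x)).dzb, normsq_eq, div_eq_mul_inv]
      push_cast; ring
    have hz' : ∫ x, (dzb G x * (conj x / (‖x‖ ^ 2 + δ ^ 2 : ℝ)) + G x * (δ ^ 2 / (x * conj x + (δ : ℂ) ^ 2) ^ 2)) = 0 := by
      rw [← hz]; congr 1; ext x; exact (hprod x).symm
    have hcj : Continuous (fun x : ℂ => conj x) := Complex.continuous_conj
    rw [integral_add] at hz'
    · rw [eq_neg_of_add_eq_zero_left hz']
      congr 1
      have := Measure.integral_comp_smul (volume : Measure ℂ)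
        (fun x => G x * (δ ^ 2 / (x * conj x + (δ : ℂ) ^ 2) ^ 2)) δ
      simp only [Complex.finrank_real_complex, Complex.real_smul] at this
      have hδc : (δ : ℂ) ≠ 0 := by exact_mod_cast hδ.ne'
      have h2 : ∫ x, G x * (δ ^ 2 / (x * conj x + (δ : ℂ) ^ 2) ^ 2) =
          (δ : ℂ) ^ 2 * ∫ x : ℂ, G (δ * x) * (δ ^ 2 / ((δ * x) * conj ((δ : ℂ) * x) + (δ : ℂ) ^ 2) ^ 2) := by
        rw [this]
        rw [abs_of_pos (by positivity)]
        push_cast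
        rw [← mul_assoc, mul_inv_cancel₀ (pow_ne_zero 2 hδc), one_mul]
      rw [h2, ← integral_const_mul]
      congr 1; ext x
      have h3 := hne x
      have h4 : (δ : ℂ) * x * conj ((δ : ℂ) * x) + (δ : ℂ) ^ 2 = δ ^ 2 * (1 + (‖x‖ ^ 2 : ℝ)) := by
        rw [map_mul, Complex.conj_ofReal, ← normsq_eq]; ring
      have h5 : (1 + ((‖x‖ ^ 2 : ℝ) : ℂ)) ≠ 0 := by
        have : (0:ℝ) < 1 + ‖x‖ ^ 2 := by positivity
        exact_mod_cast this.ne'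
      rw [h4]
      push_cast at h5 ⊢
      field_simp
    · apply Continuous.integrable_of_hasCompactSupport
      · refine (continuous_dzb hG).mul (hcj.div (by fun_prop) ?_)
        intro x; have : (0:ℝ) < ‖x‖ ^ 2 + δ ^ 2 := by positivity
        exact_mod_cast this.ne'
      · exact (hcs_dzb hs).mul_right
    · apply Continuous.integrable_of_hasCompactSupport
      · refine hG.continuous.mul (continuous_const.div (by fun_prop) ?_)
        intro x; exact pow_ne_zero _ (hne x)
      · exact hs.mul_right
  have hpos : ∀ n : ℕ, (0:ℝ) < 1 / ((n : ℝ) + 1) := fun n => by positivity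
  have hd0 := tendsto_one_div_add_atTop_nhds_zero_nat (𝕜 := ℝ)
  have L1 : Filter.Tendsto (fun n : ℕ => ∫ x, dzb G x * (conj x / (‖x‖ ^ 2 + (1 / ((n : ℝ) + 1)) ^ 2 : ℝ)))
      Filter.atTop (nhds (∫ x, dzb G x / x)) := by
    apply tendsto_integral_of_dominated_convergence (fun x => ‖dzb G x / x‖)
    · intro n
      have hcj : Continuous (fun x : ℂ => conj x) := Complex.continuous_conj
      refine (((continuous_dzb hG)).mul (hcj.div (by fun_prop) ?_)).aestronglyMeasurable
      intro x; have : (0:ℝ) < ‖x‖ ^ 2 + (1 / ((n : ℝ) + 1)) ^ 2 := by have := hpos n; positivity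
      exact_mod_cast this.ne'
    · exact (integrable_div_self (continuous_dzb hG) (hcs_dzb hs)).norm
    · intro n
      filter_upwards with x
      rw [norm_mul, norm_div, norm_div, div_eq_mul_inv ‖dzb G x‖]
      refine mul_le_mul_of_nonneg_left ?_ (norm_nonneg _)
      rw [RCLike.norm_conj, Complex.norm_real, Real.norm_of_nonneg (by positivity)]
      by_cases hx : x = 0
      · simp [hx]
      have hx' : 0 < ‖x‖ := norm_pos_iff.mpr hx
      rw [div_le_iff₀ (by positivity), inv_mul_eq_div, le_div_iff₀ hx']
      nlinarith [sq_nonneg (1 / ((n : ℝ) + 1))]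
    · have h0 : ∀ᵐ x : ℂ, x ≠ 0 := by simp [ae_iff]
      filter_upwards [h0] with x hx
      have hx' : (0:ℝ) < ‖x‖ := norm_pos_iff.mpr hx
      have : Filter.Tendsto (fun n : ℕ => ((‖x‖ ^ 2 + (1 / ((n : ℝ) + 1)) ^ 2 : ℝ) : ℂ)) Filter.atTop
          (nhds ((‖x‖ ^ 2 + 0 ^ 2 : ℝ) : ℂ)) := by
        apply (Complex.continuous_ofReal.tendsto _).comp
        exact (hd0.pow 2).const_add _
      have hne : ((‖x‖ ^ 2 + 0 ^ 2 : ℝ) : ℂ) ≠ 0 := by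
        have : (0:ℝ) < ‖x‖ ^ 2 + 0 ^ 2 := by positivity
        exact_mod_cast this.ne'
      have h2 := ((tendsto_const_nhds (x := conj x)).div this hne).const_mul (dzb G x)
      have e : dzb G x / x = dzb G x * (conj x / ((‖x‖ ^ 2 + 0 ^ 2 : ℝ) : ℂ)) := by
        have : ((‖x‖ ^ 2 + 0 ^ 2 : ℝ) : ℂ) = x * conj x := by rw [normsq_eq]; norm_num
        rw [this]
        have : conj x ≠ 0 := by simpa using hx
        field_simp
      rw [e]; exact h2
  have L2 : Filter.Tendsto (fun n : ℕ => - ∫ y : ℂ, G ((1 / ((n : ℝ) + 1) : ℝ) * y) * ((((1 + ‖y‖ ^ 2) ^ 2)⁻¹ : ℝ) : ℂ))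
      Filter.atTop (nhds (- ∫ y : ℂ, G 0 * ((((1 + ‖y‖ ^ 2) ^ 2)⁻¹ : ℝ) : ℂ))) := by
    apply Filter.Tendsto.neg
    obtain ⟨C, hC⟩ := hG.continuous.bounded_above_of_compact_support hs
    apply tendsto_integral_of_dominated_convergence (fun y => C * ((1 + ‖y‖ ^ 2) ^ 2)⁻¹)
    · intro n
      refine Continuous.aestronglyMeasurable ?_
      refine (hG.continuous.comp (by fun_prop)).mul (Complex.continuous_ofReal.comp ?_)
      refine Continuous.inv₀ (by fun_prop) ?_
      intro x; positivity
    · exact integral_japanese.1.const_mul C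
    · intro n
      filter_upwards with y
      rw [norm_mul, Complex.norm_real, Real.norm_of_nonneg (by positivity)]
      gcongr; exact hC _
    · filter_upwards with y
      apply Filter.Tendsto.mul_const
      have : Filter.Tendsto (fun n : ℕ => ((1 / ((n : ℝ) + 1) : ℝ) : ℂ) * y) Filter.atTop (nhds (((0:ℝ):ℂ) * y)) :=
        ((Complex.continuous_ofReal.tendsto _).comp hd0).mul_const y
      rw [Complex.ofReal_zero, zero_mul] at this
      exact (hG.continuous.tendsto 0).comp this
  have := tendsto_nhds_unique (L1.congr (fun n => key _ (hpos n))) L2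
  rw [this, integral_const_mul, integral_complex_ofReal, integral_japanese.2]; ring

end RS

namespace RS
open Complex (I)
open scoped ComplexConjugate ContDiff Convolution

noncomputable def bmp : ContDiffBump (0 : ℂ) := ⟨1/2, 1, by norm_num, by norm_num⟩

/-- cutoff, complex valued -/
noncomputable def bet (y : ℂ) : ℂ := ((bmp y : ℝ) : ℂ)

lemma bet_cd : ContDiff ℝ ∞ bet :=
  Complex.ofRealCLM.contDiff.comp bmp.contDiff

lemma bet_zero_of {y : ℂ} (h : 1 ≤ ‖y‖) : bet y = 0 := by
  unfold bet
  rw [bmp.zero_of_le_dist (by simpa [bmp] using h)]; simp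

lemma bet_zero : bet 0 = 1 := by
  unfold bet
  rw [bmp.one_of_mem_closedBall (by simp [bmp])]; simp

lemma bet_norm_le (y : ℂ) : ‖bet y‖ ≤ 1 := by
  unfold bet
  rw [Complex.norm_real, Real.norm_of_nonneg bmp.nonneg]; exact bmp.le_one

lemma bet_hcs : HasCompactSupport bet := by
  have := bmp.hasCompactSupport
  exact this.comp_left (g := fun x : ℝ => (x : ℂ)) (by simp)

lemma bet_one_of {y : ℂ} (h : ‖y‖ ≤ 1/2) : bet y = 1 := by
  unfold bet
  rw [bmp.one_of_mem_closedBall (by simpa [bmp] using h)]; simp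

noncomputable def kap (y : ℂ) : ℂ := dzb bet y / y

lemma dzb_bet_near {y : ℂ} (h : ‖y‖ < 1/2) : dzb bet y = 0 := by
  have : HasW bet 0 0 y := by
    have h2 := hasW_const 1 y
    unfold HasW at *
    refine h2.congr_of_eventuallyEq ?_
    have : Metric.ball (0:ℂ) (1/2) ∈ nhds y := Metric.isOpen_ball.mem_nhds (by simpa using h)
    filter_upwards [this] with x hx
    exact bet_one_of (by simpa using (Metric.mem_ball.1 hx).le)
  exact this.dzb

lemma dzb_bet_cd : ContDiff ℝ ∞ (dzb bet) := contDiff_dzb (n := ⊤) (by simpa using bet_cd)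

lemma kap_cd : ContDiff ℝ ∞ kap := by
  rw [contDiff_iff_contDiffAt]
  intro y
  by_cases hy : ‖y‖ < 1/2
  · have : kap =ᶠ[nhds y] fun _ => 0 := by
      have : Metric.ball (0:ℂ) (1/2) ∈ nhds y := Metric.isOpen_ball.mem_nhds (by simpa using hy)
      filter_upwards [this] with x hx
      simp [kap, dzb_bet_near (by simpa using hx)]
    exact contDiffAt_const.congr_of_eventuallyEq this
  · have h0 : y ≠ 0 := by rintro rfl; simp at hy
    have e : kap = fun y => dzb bet y * y⁻¹ := by ext; simp [kap, div_eq_mul_inv]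
    rw [e]
    exact dzb_bet_cd.contDiffAt.mul (contDiffAt_id.inv h0)

lemma kap_hcs : HasCompactSupport kap := by
  have : kap = fun y => dzb bet y * y⁻¹ := by ext; simp [kap, div_eq_mul_inv]
  rw [this]; exact (hcs_dzb bet_hcs).mul_right

lemma tsupport_bet : tsupport bet ⊆ Metric.closedBall 0 1 := by
  apply closure_minimal _ Metric.isClosed_closedBall
  intro y hy
  by_contra h
  simp at h
  exact hy (bet_zero_of h.le)

lemma kap_zero_of {y : ℂ} (h : 1 < ‖y‖) : kap y = 0 := by
  have : fderiv ℝ bet y = 0 := by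
    apply image_eq_zero_of_notMem_tsupport
    intro h2
    have := tsupport_bet (tsupport_fderiv_subset ℝ h2)
    simp at this; linarith
  simp [kap, dzb, this]

/-- The parametrix identity. -/
lemma px {g : ℂ → ℂ} (hg : ContDiff ℝ 1 g) (z : ℂ) (R : ℝ) :
    π * g z = R * (∫ y, bet y / y * dzb g (z - R * y)) - ∫ y, kap y * g (z - R * y) := by
  have hb1 : ContDiff ℝ 1 bet := bet_cd.of_le (by norm_num)
  have hG : ContDiff ℝ 1 (fun y => bet y * g (z - R * y)) :=
    hb1.mul (hg.comp (contDiff_const.sub (contDiff_const.mul contDiff_id)))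
  have hs : HasCompactSupport (fun y => bet y * g (z - R * y)) := bet_hcs.mul_right
  have h := cp0 hG hs
  have hd : ∀ y, dzb (fun y => bet y * g (z - R * y)) y =
      dzb bet y * g (z - R * y) - R * (bet y * dzb g (z - R * y)) := by
    intro y
    have h1 : HasW (fun y => g (z + (-R : ℝ) * y)) _ _ y :=
      (cd_hasW hg (z + (-R : ℝ) * y)).comp_affine
    have h2 := (cd_hasW hb1 y).mul h1
    have e : ∀ y : ℂ, z + ((-R : ℝ) : ℂ) * y = z - R * y := by intro y; push_cast; ring
    simp only [e] at h2
    rw [h2.dzb]; push_cast; ring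
  have e2 : ∀ y, dzb (fun y => bet y * g (z - R * y)) y / y =
      kap y * g (z - R * y) - R * (bet y / y * dzb g (z - R * y)) := by
    intro y; rw [hd, kap]; ring
  simp only [e2, mul_zero, sub_zero, bet_zero, one_mul] at h
  have cg : Continuous (fun y : ℂ => g (z - R * y)) := hg.continuous.comp (by fun_prop)
  have cd : Continuous (fun y : ℂ => dzb g (z - R * y)) := (continuous_dzb hg).comp (by fun_prop)
  have i1 : Integrable (fun y => kap y * g (z - R * y)) :=
    (kap_cd.continuous.mul cg).integrable_of_hasCompactSupport kap_hcs.mul_right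
  have i2 : Integrable (fun y => bet y / y * dzb g (z - R * y)) := by
    have := integrable_div_self (h := fun y => bet y * dzb g (z - R * y))
      (bet_cd.continuous.mul cd) bet_hcs.mul_right
    refine this.congr (Filter.Eventually.of_forall ?_)
    intro y; simp only; ring
  rw [integral_sub i1 (i2.const_mul _), integral_const_mul] at h
  linear_combination h

/-- interior regularity for `∂̄` -/
lemma regularity {n : ℕ∞} {g : ℂ → ℂ} (hg : ContDiff ℝ 1 g) (hk : ContDiff ℝ n (dzb g)) :
    ContDiff ℝ n g := by
  set L := ContinuousLinearMap.mul ℝ ℂ with hL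
  have hli : LocallyIntegrable (fun y => bet y / y) volume :=
    (integrable_div_self bet_cd.continuous bet_hcs).locallyIntegrable
  rw [contDiff_iff_contDiffAt]
  intro z0
  obtain ⟨chi, hchi⟩ : ∃ b : ContDiffBump z0, b.rIn = 3 :=
    ⟨⟨3, 4, by norm_num, by norm_num⟩, rfl⟩
  have hc : ContDiff ℝ n (fun x => ((chi x : ℝ) : ℂ) * dzb g x) :=
    ((Complex.ofRealCLM.contDiff.comp (chi.contDiff (n := n)))).mul hk
  have hcs : HasCompactSupport (fun x => ((chi x : ℝ) : ℂ) * dzb g x) :=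
    (chi.hasCompactSupport.comp_left (g := fun x : ℝ => (x : ℂ)) (by simp)).mul_right
  have c1 := hcs.contDiff_convolution_right L hli hc
  have c2 := kap_hcs.contDiff_convolution_left (n := n) (μ := volume) L (kap_cd.of_le (by exact_mod_cast le_top))
    (hg.continuous.locallyIntegrable)
  have c3 := (contDiff_const (c := (π : ℂ)⁻¹)).mul (c1.sub c2)
  refine c3.contDiffAt.congr_of_eventuallyEq ?_
  filter_upwards [Metric.ball_mem_nhds z0 one_pos] with z hz
  have hp := px hg z 1
  have hpi : (π : ℂ) ≠ 0 := by exact_mod_cast pi_ne_zero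
  have : g z = (π : ℂ)⁻¹ * (π * g z) := by field_simp
  rw [this, hp]
  simp only [Complex.ofReal_one, one_mul, convolution_def, hL, ContinuousLinearMap.mul_apply']
  congr 2
  congr 1; ext y
  by_cases hy : 1 ≤ ‖y‖
  · simp [bet_zero_of hy]
  · rw [chi.one_of_mem_closedBall]; · simp
    rw [hchi, Metric.mem_closedBall, dist_eq_norm]
    rw [Metric.mem_ball, dist_eq_norm] at hz
    have : z - y - z0 = (z - z0) - y := by ring
    rw [this]
    linarith [norm_sub_le (z - z0) y]

end RS

namespace RS
open Complex (I)
open scoped ComplexConjugate ContDiff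

/-- complexification of a real function -/
def cx (v : ℂ → ℝ) : ℂ → ℂ := fun z => (v z : ℂ)

lemma cx_cd {n : WithTop ℕ∞} {v : ℂ → ℝ} (h : ContDiff ℝ n v) : ContDiff ℝ n (cx v) :=
  Complex.ofRealCLM.contDiff.comp h

lemma HasW.real_unique {v : ℂ → ℝ} {a b z : ℂ} (h : HasW (cx v) a b z) : b = conj a := by
  have h2 := h.conj
  have : (fun x => conj (cx v x)) = cx v := by ext x; simp [cx]
  rw [this] at h2
  rw [← h.dzb, ← h2.dzb]

lemma dzb_cx {v : ℂ → ℝ} (hv : ContDiff ℝ 1 v) (z : ℂ) : dzb (cx v) z = conj (dz (cx v) z) :=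
  (cd_hasW (cx_cd hv) z).real_unique

lemma fderiv_real_eq {v : ℂ → ℝ} (hv : ContDiff ℝ 1 v) (z h : ℂ) :
    fderiv ℝ v z h = 2 * (dz (cx v) z * h).re := by
  have h1 : HasFDerivAt (cx v) (WL (dz (cx v) z) (dzb (cx v) z)) z := cd_hasW (cx_cd hv) z
  have h2 := Complex.reCLM.hasFDerivAt.comp z h1
  have h3 : (Complex.reCLM ∘ cx v) = v := by ext; simp [cx]
  rw [h3] at h2
  rw [h2.fderiv]
  simp only [ContinuousLinearMap.comp_apply, WL_apply, dzb_cx hv]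
  simp [Complex.mul_re]
  ring

/-! ### the mean value weights -/

lemma cub_hasDeriv (x : ℝ) : HasDerivAt (fun x : ℝ => (max 0 x) ^ 3) (3 * (max 0 x) ^ 2) x := by
  have h1 : HasDerivAt (fun x : ℝ => |x| ^ 3) (3 * |x| * x) x := by
    have := hasDerivAt_abs_rpow x (p := 3) (by norm_num)
    norm_num at this
    exact_mod_cast this
  have h2 := ((hasDerivAt_pow 3 x).add h1).div_const 2
  have e : (fun x : ℝ => (max 0 x) ^ 3) = fun x => (x ^ 3 + |x| ^ 3) / 2 := by
    ext y
    rcases le_total 0 y with h | h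
    · rw [max_eq_right h, abs_of_nonneg h]; ring
    · rw [max_eq_left h, abs_of_nonpos h]; ring
  rw [e]
  refine h2.congr_deriv ?_
  rcases le_total 0 x with h | h
  · rw [max_eq_right h, abs_of_nonneg h]; norm_num; ring
  · rw [max_eq_left h, abs_of_nonpos h]; norm_num; ring

noncomputable def Psi (y : ℂ) : ℝ := (max 0 (1 - ‖y‖ ^ 2)) ^ 3
noncomputable def phi (y : ℂ) : ℝ := (max 0 (1 - ‖y‖ ^ 2)) ^ 2

lemma Psi_cd : ContDiff ℝ 1 Psi := by
  have h : ContDiff ℝ 1 (fun x : ℝ => (max 0 x) ^ 3) := by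
    rw [contDiff_one_iff_deriv]
    refine ⟨fun x => (cub_hasDeriv x).differentiableAt, ?_⟩
    have : deriv (fun x : ℝ => (max 0 x) ^ 3) = fun x => 3 * (max 0 x) ^ 2 := by
      ext x; exact (cub_hasDeriv x).deriv
    rw [this]; fun_prop
  exact h.comp (contDiff_const.sub (contDiff_norm_sq ℝ))

lemma phi_cont : Continuous phi := by unfold phi; fun_prop
lemma Psi_cont : Continuous Psi := by unfold Psi; fun_prop
lemma phi_nonneg (y : ℂ) : 0 ≤ phi y := by unfold phi; positivity
lemma Psi_nonneg (y : ℂ) : 0 ≤ Psi y := by unfold Psi; positivity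

lemma mx_le (y : ℂ) : max 0 (1 - ‖y‖ ^ 2) ≤ 1 := by
  apply max_le; · norm_num
  · nlinarith [sq_nonneg ‖y‖]
lemma phi_le_one (y : ℂ) : phi y ≤ 1 := pow_le_one₀ (by positivity) (mx_le y)
lemma Psi_le_phi (y : ℂ) : Psi y ≤ phi y :=
  pow_le_pow_of_le_one (by positivity) (mx_le y) (by norm_num)
lemma phi_zero_of {y : ℂ} (h : 1 ≤ ‖y‖) : phi y = 0 := by
  unfold phi; rw [max_eq_left (by nlinarith)]; norm_num
lemma Psi_zero_of {y : ℂ} (h : 1 ≤ ‖y‖) : Psi y = 0 := by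
  unfold Psi; rw [max_eq_left (by nlinarith)]; norm_num
lemma phi_hcs : HasCompactSupport phi := by
  apply HasCompactSupport.of_support_subset_isCompact (isCompact_closedBall 0 1)
  intro y hy; by_contra h; simp at h; exact hy (phi_zero_of h.le)
lemma Psi_hcs : HasCompactSupport Psi := by
  apply HasCompactSupport.of_support_subset_isCompact (isCompact_closedBall 0 1)
  intro y hy; by_contra h; simp at h; exact hy (Psi_zero_of h.le)
lemma phi_lower {y : ℂ} (h : ‖y‖ ≤ 1/2) : 1/2 ≤ phi y := by
  unfold phi
  have : 3/4 ≤ max 0 (1 - ‖y‖ ^ 2) := by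
    apply le_max_of_le_right; nlinarith [norm_nonneg y]
  nlinarith

lemma Psi_hasW (y : ℂ) : HasW (cx Psi) (-(3 * conj y * phi y)) (-(3 * y * phi y)) y := by
  have h1 : HasW (fun x : ℂ => ((1 - ‖x‖ ^ 2 : ℝ) : ℂ)) (-conj y) (-y) y := by
    have := (hasW_const 1 y).sub ((hasW_id y).mul (hasW_conj y))
    refine (this.congr (a' := -conj y) (b' := -y) (by simp) (by simp)).of_eq ?_
    intro x; rw [normsq_eq]; push_cast; ring
  have := h1.comp_real (F := fun x : ℝ => (max 0 x) ^ 3) (cub_hasDeriv _)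
  refine this.congr ?_ ?_ <;> (unfold phi; push_cast; ring)

/-- key integration by parts -/
lemma mean_ibp {g : ℂ → ℂ} (hg : ContDiff ℝ 1 g) (y0 : ℂ) (t : ℝ) :
    ∫ y, phi y * (g (y0 + t * y) * y) = t / 3 * ∫ y, Psi y * dzb g (y0 + t * y) := by
  have hG : ContDiff ℝ 1 (fun y => cx Psi y * g (y0 + t * y)) :=
    (cx_cd Psi_cd).mul (hg.comp (contDiff_const.add (contDiff_const.mul contDiff_id)))
  have hs : HasCompactSupport (cx Psi) := Psi_hcs.comp_left (g := fun x : ℝ => (x : ℂ)) (by simp)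
  have hp : HasCompactSupport (cx phi) := phi_hcs.comp_left (g := fun x : ℝ => (x : ℂ)) (by simp)
  have h := integral_dzb hG hs.mul_right
  have hd : ∀ y, dzb (fun y => cx Psi y * g (y0 + t * y)) y =
      t * (Psi y * dzb g (y0 + t * y)) - 3 * (phi y * (g (y0 + t * y) * y)) := by
    intro y
    rw [((Psi_hasW y).mul (cd_hasW hg (y0 + t * y)).comp_affine).dzb]; unfold cx; ring
  simp only [hd] at h
  have cg : Continuous (fun y : ℂ => g (y0 + t * y)) := hg.continuous.comp (by fun_prop)
  have cd : Continuous (fun y : ℂ => dzb g (y0 + t * y)) := (continuous_dzb hg).comp (by fun_prop)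
  have i1 : Integrable (fun y => (Psi y : ℂ) * dzb g (y0 + t * y)) :=
    Continuous.integrable_of_hasCompactSupport
      ((Complex.continuous_ofReal.comp Psi_cont).mul cd) hs.mul_right
  have i2 : Integrable (fun y => (phi y : ℂ) * (g (y0 + t * y) * y)) :=
    Continuous.integrable_of_hasCompactSupport
      ((Complex.continuous_ofReal.comp phi_cont).mul (cg.mul continuous_id)) hp.mul_right
  rw [integral_sub (i1.const_mul _) (i2.const_mul _), integral_const_mul, integral_const_mul] at h
  linear_combination -h / 3

noncomputable def Mean (G : ℂ → ℝ) (y0 : ℂ) (t : ℝ) : ℝ := ∫ y, phi y * G (y0 + t * y)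

lemma mean_hasDeriv {G D : ℂ → ℝ} (hG : ContDiff ℝ 2 G)
    (hD : ∀ z, dzb (dz (cx G)) z = D z) (y0 : ℂ) (t : ℝ) :
    HasDerivAt (Mean G y0) (2 * t / 3 * ∫ y, Psi y * D (y0 + t * y)) t := by
  have hG1 : ContDiff ℝ 1 G := hG.of_le (by norm_num)
  have hfc : Continuous (fderiv ℝ G) := hG1.continuous_fderiv (by norm_num)
  have hdc : Continuous (fun p : ℝ × ℂ => fderiv ℝ G (y0 + p.1 * p.2) p.2) :=
    (hfc.comp (by fun_prop)).clm_apply continuous_snd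
  obtain ⟨K, hK⟩ := ((isCompact_closedBall t 1).prod (isCompact_closedBall (0:ℂ) 1)).exists_bound_of_continuousOn
    hdc.continuousOn
  have hK0 : 0 ≤ K := (norm_nonneg _).trans (hK (t, 0) ⟨by simp, by simp⟩)
  have key := hasDerivAt_integral_of_dominated_loc_of_deriv_le (μ := volume) (x₀ := t)
    (F := fun (t : ℝ) (y : ℂ) => phi y * G (y0 + t * y))
    (F' := fun (t : ℝ) (y : ℂ) => phi y * fderiv ℝ G (y0 + t * y) y)
    (bound := fun y => phi y * K) (s := Metric.ball t 1) (Metric.ball_mem_nhds t one_pos)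
    (Filter.Eventually.of_forall fun s =>
      (phi_cont.mul (hG.continuous.comp (by fun_prop))).aestronglyMeasurable)
    (Continuous.integrable_of_hasCompactSupport (phi_cont.mul (hG.continuous.comp (by fun_prop)))
      phi_hcs.mul_right)
    (phi_cont.mul (hdc.comp (by fun_prop : Continuous fun y : ℂ => (t, y)))).aestronglyMeasurable
    (Filter.Eventually.of_forall ?_)
    ((phi_cont.integrable_of_hasCompactSupport phi_hcs).mul_const K)
    (Filter.Eventually.of_forall ?_)
  · have h2 := key.2
    unfold Mean
    refine h2.congr_deriv ?_
    have hg : ContDiff ℝ 1 (dz (cx G)) := contDiff_dz (n := 1) (by simpa [one_add_one_eq_two] using cx_cd hG)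
    have hm := mean_ibp hg y0 t
    have e1 : ∀ y, phi y * fderiv ℝ G (y0 + t * y) y =
        2 * ((phi y * (dz (cx G) (y0 + t * y) * y) : ℂ)).re := by
      intro y; rw [fderiv_real_eq hG1, Complex.re_ofReal_mul]; ring
    simp only [e1]
    rw [integral_const_mul]
    have i2 : Integrable (fun y => (phi y : ℂ) * (dz (cx G) (y0 + t * y) * y)) :=
      Continuous.integrable_of_hasCompactSupport
        ((Complex.continuous_ofReal.comp phi_cont).mul ((hg.continuous.comp (by fun_prop)).mul continuous_id))
        (HasCompactSupport.mul_right (phi_hcs.comp_left (g := fun x : ℝ => (x : ℂ)) (by simp)))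
    have := Complex.reCLM.integral_comp_comm i2
    simp only [Complex.reCLM_apply] at this
    rw [this, hm]
    simp only [hD]
    have : ∫ y, (Psi y : ℂ) * (D (y0 + t * y) : ℂ) = ((∫ y, Psi y * D (y0 + t * y) : ℝ) : ℂ) := by
      rw [← integral_complex_ofReal]; congr 1; ext y; push_cast; ring
    rw [this]
    have e3 : (t : ℂ) / 3 * ((∫ y, Psi y * D (y0 + t * y) : ℝ) : ℂ) = ((t / 3 * ∫ y, Psi y * D (y0 + t * y) : ℝ) : ℂ) := by
      push_cast; ring
    rw [e3, Complex.ofReal_re]; ring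
  · intro y s hs
    rw [norm_mul, Real.norm_of_nonneg (phi_nonneg y)]
    by_cases hy : 1 ≤ ‖y‖
    · simp [phi_zero_of hy]
    · refine mul_le_mul_of_nonneg_left ?_ (phi_nonneg y)
      exact hK (s, y) ⟨Metric.ball_subset_closedBall hs, by simpa using (not_le.1 hy).le⟩
  · intro y s hs
    apply HasDerivAt.const_mul
    have h1 : HasDerivAt (fun t : ℝ => y0 + (t : ℂ) * y) y s := by
      have := ((Complex.ofRealCLM.hasDerivAt (x := s)).mul_const y).const_add y0
      simpa using this
    exact ((hG1.differentiable (by norm_num) _).hasFDerivAt).comp_hasDerivAt s h1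

end RS

namespace RS
open Complex (I)
open scoped ComplexConjugate ContDiff

noncomputable def mu (ρ : ℝ) (v : ℂ → ℝ) (z : ℂ) : ℝ :=
  (1 + ‖z‖ ^ 2) ^ (2 * (ρ - 1)) * Real.exp (v z)

structure Sol (ρ : ℝ) (v : ℂ → ℝ) : Prop where
  h1 : 1 < ρ
  h2 : ρ ≤ 3 / 2
  cd : ContDiff ℝ 2 v
  pde : ∀ z, dzb (dz (cx v)) z = ((-(1/4) * mu ρ v z : ℝ) : ℂ)
  int : Integrable (mu ρ v)
  mass : ∫ z, mu ρ v z = 8 * π * ρ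

lemma N_pos (z : ℂ) : 0 < 1 + ‖z‖ ^ 2 := by positivity

lemma mu_pos (ρ : ℝ) (v : ℂ → ℝ) (z : ℂ) : 0 < mu ρ v z :=
  mul_pos (Real.rpow_pos_of_pos (N_pos z) _) (Real.exp_pos _)

lemma mu_cd {n : WithTop ℕ∞} (ρ : ℝ) {v : ℂ → ℝ} (hv : ContDiff ℝ n v) : ContDiff ℝ n (mu ρ v) := by
  unfold mu
  refine ContDiff.mul ?_ (Real.contDiff_exp.comp hv)
  exact (contDiff_const.add (contDiff_norm_sq ℝ)).rpow_const_of_ne (fun z => (N_pos z).ne')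

lemma Sol.mu_cont {ρ : ℝ} {v : ℂ → ℝ} (h : Sol ρ v) : Continuous (mu ρ v) := (mu_cd ρ h.cd).continuous

lemma Sol.exp_le {ρ : ℝ} {v : ℂ → ℝ} (h : Sol ρ v) (z : ℂ) : Real.exp (v z) ≤ mu ρ v z := by
  unfold mu
  have : (1:ℝ) ≤ (1 + ‖z‖ ^ 2) ^ (2 * (ρ - 1)) :=
    Real.one_le_rpow (by nlinarith [sq_nonneg ‖z‖]) (by linarith [h.h1])
  nlinarith [Real.exp_pos (v z)]

/-- change of variables -/
lemma int_affine {E : Type*} [NormedAddCommGroup E] [NormedSpace ℝ E] (f : ℂ → E) (y0 : ℂ) {t : ℝ} (ht : 0 < t) :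
    ∫ y, f (y0 + t * y) = (t ^ 2)⁻¹ • ∫ y, f y := by
  have := Measure.integral_comp_smul (volume : Measure ℂ) (fun x => f (y0 + x)) t
  simp only [Complex.finrank_real_complex, Complex.real_smul] at this
  rw [this, abs_of_pos (by positivity), integral_add_left_eq_self]

lemma weight_le {f : ℂ → ℝ} (_hf : Continuous f) (h0 : ∀ z, 0 ≤ f z) (hi : Integrable f)
    {w : ℂ → ℝ} (w0 : ∀ y, 0 ≤ w y) (w1 : ∀ y, w y ≤ 1) (ws : ∀ y, 1 ≤ ‖y‖ → w y = 0)
    (y0 : ℂ) {t : ℝ} (ht : 0 < t) :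
    ∫ y, w y * f (y0 + t * y) ≤ (t ^ 2)⁻¹ * ∫ y in Metric.ball y0 t, f y := by
  rw [← integral_indicator measurableSet_ball, ← smul_eq_mul, ← int_affine _ y0 ht]
  apply integral_mono_of_nonneg
  · filter_upwards with y using mul_nonneg (w0 y) (h0 _)
  · have h1 : Integrable ((Metric.ball y0 t).indicator f) := hi.indicator measurableSet_ball
    have h2 := (h1.comp_add_left y0).comp_smul (R := t) (by exact ht.ne')
    simpa [Complex.real_smul] using h2
  · filter_upwards with y
    by_cases hy : 1 ≤ ‖y‖
    · simp only [ws y hy, zero_mul]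
      exact Set.indicator_nonneg (fun _ _ => h0 _) _
    · have : y0 + t * y ∈ Metric.ball y0 t := by
        rw [Metric.mem_ball, dist_eq_norm]
        simp only [add_sub_cancel_left, norm_mul, Complex.norm_real, Real.norm_of_nonneg ht.le]
        push Not at hy
        nlinarith
      rw [Set.indicator_of_mem this]
      nlinarith [w1 y, h0 (y0 + t * y)]

lemma weight_le' {f : ℂ → ℝ} (hf : Continuous f) (h0 : ∀ z, 0 ≤ f z) (hi : Integrable f)
    {w : ℂ → ℝ} (w0 : ∀ y, 0 ≤ w y) (w1 : ∀ y, w y ≤ 1) (ws : ∀ y, 1 ≤ ‖y‖ → w y = 0)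
    (y0 : ℂ) {t : ℝ} (ht : 0 < t) :
    ∫ y, w y * f (y0 + t * y) ≤ (t ^ 2)⁻¹ * ∫ y, f y := by
  refine (weight_le hf h0 hi w0 w1 ws y0 ht).trans ?_
  refine mul_le_mul_of_nonneg_left ?_ (by positivity)
  exact setIntegral_le_integral hi (Filter.Eventually.of_forall h0)

lemma integrable_div_sub {k : ℂ → ℂ} (hk : Continuous k) (hi : Integrable k) (z : ℂ) :
    Integrable (fun x => k x / (z - x)) := by
  obtain ⟨C, hC⟩ := (isCompact_closedBall z 1).exists_bound_of_continuousOn hk.continuousOn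
  have hb : Integrable (fun x => (Metric.ball (0:ℂ) 1).indicator (fun x : ℂ => C * ‖x‖⁻¹) (z - x)) := by
    have : Integrable ((Metric.ball (0:ℂ) 1).indicator (fun x : ℂ => C * ‖x‖⁻¹)) :=
      (integrable_indicator_iff measurableSet_ball).2 ((integrableOn_inv_norm 1).const_mul C)
    exact this.comp_sub_left z
  refine (hb.add hi.norm).mono' ?_ ?_
  · exact (hk.measurable.div (by fun_prop)).aestronglyMeasurable
  · filter_upwards with x
    rw [norm_div, div_eq_mul_inv, Pi.add_apply]
    by_cases hx : z - x ∈ Metric.ball (0:ℂ) 1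
    · rw [Set.indicator_of_mem hx]
      have : ‖k x‖ ≤ C := hC x (by
        rw [Metric.mem_closedBall, dist_eq_norm, norm_sub_rev]; simpa using (Metric.mem_ball.1 hx).le)
      have : ‖k x‖ * ‖z - x‖⁻¹ ≤ C * ‖z - x‖⁻¹ := by gcongr
      linarith [norm_nonneg (k x)]
    · rw [Set.indicator_of_notMem hx, zero_add]
      have : 1 ≤ ‖z - x‖ := by simpa using hx
      exact mul_le_of_le_one_right (norm_nonneg _) (inv_le_one_of_one_le₀ this)

/-- limit form of the parametrix identity -/
lemma px_lim {g : ℂ → ℂ} (hg : ContDiff ℝ 1 g) (z : ℂ)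
    (hint : Integrable (fun x => dzb g x / (z - x)))
    (herr : Filter.Tendsto (fun t : ℝ => ∫ y, kap y * g (z + t * y)) Filter.atTop (nhds 0)) :
    π * g z = ∫ x, dzb g x / (z - x) := by
  have h1 : ∀ t : ℝ, 0 < t → π * g z =
      (∫ x, bet ((x - z) / t) * (dzb g x / (z - x))) - ∫ y, kap y * g (z + t * y) := by
    intro t ht
    have := px hg z (-t)
    have e : ∀ y : ℂ, z - ((-t : ℝ) : ℂ) * y = z + t * y := by intro y; push_cast; ring
    simp only [e] at this
    rw [this]
    congr 1
    have h2 := int_affine (fun x => bet ((x - z) / t) * (dzb g x / (z - x))) z ht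
    have h3 : ∫ x, bet ((x - z) / t) * (dzb g x / (z - x)) = (t ^ 2 : ℝ) •
        ∫ y : ℂ, bet ((z + t * y - z) / t) * (dzb g (z + t * y) / (z - (z + t * y))) := by
      rw [h2, smul_smul, mul_inv_cancel₀ (by positivity), one_smul]
    rw [h3, Complex.real_smul, ← integral_const_mul, ← integral_const_mul]
    congr 1; ext y
    have ht' : (t : ℂ) ≠ 0 := by exact_mod_cast ht.ne'
    have e1 : (z + t * y - z) / t = y := by field_simp; ring
    have e2 : z - (z + t * y) = - (t * y) := by ring
    rw [e1, e2]
    by_cases hy : y = 0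
    · simp [hy]
    push_cast
    field_simp
  have L1 : Filter.Tendsto (fun t : ℝ => ∫ x, bet ((x - z) / t) * (dzb g x / (z - x))) Filter.atTop
      (nhds (∫ x, dzb g x / (z - x))) := by
    apply tendsto_integral_filter_of_dominated_convergence (fun x => ‖dzb g x / (z - x)‖)
    · refine Filter.Eventually.of_forall fun t => ?_
      refine AEStronglyMeasurable.mul ?_ hint.aestronglyMeasurable
      exact (bet_cd.continuous.comp (by fun_prop)).aestronglyMeasurable
    · refine Filter.Eventually.of_forall fun t => Filter.Eventually.of_forall fun x => ?_
      rw [norm_mul]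
      exact mul_le_of_le_one_left (norm_nonneg _) (bet_norm_le _)
    · exact hint.norm
    · refine Filter.Eventually.of_forall fun x => ?_
      refine Filter.Tendsto.congr' ?_ tendsto_const_nhds
      filter_upwards [Filter.eventually_ge_atTop (2 * ‖x - z‖ + 1)] with t ht
      have ht0 : 0 < t := by linarith [norm_nonneg (x - z)]
      rw [bet_one_of, one_mul]
      rw [norm_div, Complex.norm_real, Real.norm_of_nonneg ht0.le, div_le_iff₀ ht0]
      linarith
  have L2 := L1.sub herr
  rw [sub_zero] at L2
  refine tendsto_nhds_unique ?_ L2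
  refine Filter.Tendsto.congr' ?_ tendsto_const_nhds
  filter_upwards [Filter.eventually_gt_atTop 0] with t ht using h1 t ht

/-- integrate by parts in the error term -/
lemma err_ibp {h : ℂ → ℂ} (hh : ContDiff ℝ 1 h) (z : ℂ) (t : ℝ) :
    t * ∫ y, kap y * dz h (z + t * y) = - ∫ y, dz kap y * h (z + t * y) := by
  have hk1 : ContDiff ℝ 1 kap := kap_cd.of_le (by norm_num)
  have hG : ContDiff ℝ 1 (fun y => kap y * h (z + t * y)) :=
    hk1.mul (hh.comp (contDiff_const.add (contDiff_const.mul contDiff_id)))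
  have h0 := integral_dz hG kap_hcs.mul_right
  have hd : ∀ y, dz (fun y => kap y * h (z + t * y)) y =
      dz kap y * h (z + t * y) + t * (kap y * dz h (z + t * y)) := by
    intro y
    rw [((cd_hasW hk1 y).mul (cd_hasW hh (z + t * y)).comp_affine).dz]; ring
  simp only [hd] at h0
  have i1 : Integrable (fun y => dz kap y * h (z + t * y)) :=
    Continuous.integrable_of_hasCompactSupport
      ((continuous_dz hk1).mul (hh.continuous.comp (by fun_prop))) (hcs_dz kap_hcs).mul_right
  have i2 : Integrable (fun y => kap y * dz h (z + t * y)) :=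
    Continuous.integrable_of_hasCompactSupport
      (hk1.continuous.mul ((continuous_dz hh).comp (by fun_prop))) kap_hcs.mul_right
  rw [integral_add i1 (i2.const_mul _), integral_const_mul] at h0
  linear_combination h0

lemma dz_kap_zero_of {y : ℂ} (h : 1 < ‖y‖) : dz kap y = 0 := by
  have : HasW kap 0 0 y := by
    have h2 := hasW_const 0 y
    unfold HasW at *
    refine h2.congr_of_eventuallyEq ?_
    have : {x : ℂ | 1 < ‖x‖} ∈ nhds y := (isOpen_lt continuous_const continuous_norm).mem_nhds h
    filter_upwards [this] with x hx
    exact kap_zero_of hx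
  exact this.dz

lemma dz_kap_bound : ∃ K : ℝ, 0 ≤ K ∧ ∀ y, ‖dz kap y‖ ≤ K := by
  have hk1 : ContDiff ℝ 1 kap := kap_cd.of_le (by norm_num)
  obtain ⟨K, hK⟩ := (continuous_dz hk1).bounded_above_of_compact_support (hcs_dz kap_hcs)
  exact ⟨K, (norm_nonneg _).trans (hK 0), hK⟩

lemma Sol.mean_lower {ρ : ℝ} {v : ℂ → ℝ} (h : Sol ρ v) (z : ℂ) {R : ℝ} (hR : 1 ≤ R) :
    Mean v z 1 - (8 * π * ρ) / 6 * Real.log R ≤ Mean v z R := by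
  have hd := fun t => mean_hasDeriv h.cd (D := fun z => -(1/4) * mu ρ v z) h.pde z t
  have hmono : MonotoneOn (fun t => Mean v z t + (8 * π * ρ) / 6 * Real.log t) (Set.Ici 1) := by
    have hd2 : ∀ t : ℝ, 1 ≤ t → HasDerivAt (fun t => Mean v z t + (8 * π * ρ) / 6 * Real.log t)
        (2 * t / 3 * (∫ y, Psi y * (-(1/4) * mu ρ v (z + t * y))) + (8 * π * ρ) / 6 * t⁻¹) t := by
      intro t ht
      exact (hd t).add ((Real.hasDerivAt_log (by linarith)).const_mul _)
    apply monotoneOn_of_deriv_nonneg (convex_Ici 1)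
    · intro t ht; exact (hd2 t ht).continuousAt.continuousWithinAt
    · intro t ht; rw [interior_Ici] at ht
      exact (hd2 t (le_of_lt ht)).differentiableAt.differentiableWithinAt
    · intro t ht; rw [interior_Ici] at ht
      have ht1 : 1 < t := ht
      have ht0 : 0 < t := by linarith
      rw [(hd2 t ht1.le).deriv]
      have hw := weight_le' h.mu_cont (fun z => (mu_pos ρ v z).le) h.int Psi_nonneg
        (fun y => (Psi_le_phi y).trans (phi_le_one y)) (fun y hy => Psi_zero_of hy) z ht0
      rw [h.mass] at hw
      have e : ∫ y, Psi y * (-(1/4) * mu ρ v (z + t * y)) = -(1/4) * ∫ y, Psi y * mu ρ v (z + t * y) := by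
        rw [← integral_const_mul]; congr 1; ext y; ring
      rw [e]
      have e2 : 2 * t / 3 * (-(1/4) * ((t ^ 2)⁻¹ * (8 * π * ρ))) + 8 * π * ρ / 6 * t⁻¹ = 0 := by
        field_simp; ring
      have : t * ∫ y, Psi y * mu ρ v (z + t * y) ≤ t * ((t ^ 2)⁻¹ * (8 * π * ρ)) := by gcongr
      linarith
  have := hmono (Set.mem_Ici.2 le_rfl) (Set.mem_Ici.2 hR) hR
  simp at this
  linarith

lemma Sol.abs_mean {ρ : ℝ} {v : ℂ → ℝ} (h : Sol ρ v) (z : ℂ) {R : ℝ} (hR : 1 ≤ R) :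
    ∫ y, phi y * |v (z + R * y)| ≤ 16 * π * ρ - Mean v z 1 + (8 * π * ρ) / 6 * Real.log R := by
  have h1 := h.mean_lower z hR
  have h2 := weight_le' h.mu_cont (fun z => (mu_pos ρ v z).le) h.int phi_nonneg
        phi_le_one (fun y hy => phi_zero_of hy) z (t := R) (by linarith)
  rw [h.mass] at h2
  have c : Continuous (fun y : ℂ => v (z + R * y)) := h.cd.continuous.comp (by fun_prop)
  have cm : Continuous (fun y : ℂ => mu ρ v (z + R * y)) := h.mu_cont.comp (by fun_prop)
  have i1 : Integrable (fun y => phi y * |v (z + R * y)|) :=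
    Continuous.integrable_of_hasCompactSupport (phi_cont.mul c.abs) phi_hcs.mul_right
  have i2 : Integrable (fun y => phi y * mu ρ v (z + R * y)) :=
    Continuous.integrable_of_hasCompactSupport (phi_cont.mul cm) phi_hcs.mul_right
  have i3 : Integrable (fun y => phi y * v (z + R * y)) :=
    Continuous.integrable_of_hasCompactSupport (phi_cont.mul c) phi_hcs.mul_right
  have h3 : ∫ y, phi y * |v (z + R * y)| ≤ ∫ y, (2 * (phi y * mu ρ v (z + R * y)) - phi y * v (z + R * y)) := by
    refine integral_mono i1 ((i2.const_mul 2).sub i3) ?_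
    intro y
    have e1 := h.exp_le (z + R * y)
    have e2 := Real.add_one_le_exp (v (z + R * y))
    have e3 := Real.exp_pos (v (z + R * y))
    have : |v (z + R * y)| ≤ 2 * mu ρ v (z + R * y) - v (z + R * y) := by
      rw [abs_le]; constructor <;> linarith
    have := mul_le_mul_of_nonneg_left this (phi_nonneg y)
    simp only; linarith
  rw [integral_sub (i2.const_mul 2) i3, integral_const_mul] at h3
  have h4 : (R ^ 2)⁻¹ * (8 * π * ρ) ≤ 8 * π * ρ := by
    have : (R ^ 2)⁻¹ ≤ 1 := inv_le_one_of_one_le₀ (by nlinarith)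
    have h0 : 0 ≤ 8 * π * ρ := by have := h.h1; have := pi_pos; positivity
    nlinarith
  unfold Mean at h1 ⊢
  linarith

lemma Sol.dzv_cd {ρ : ℝ} {v : ℂ → ℝ} (h : Sol ρ v) : ContDiff ℝ 1 (dz (cx v)) :=
  contDiff_dz (n := 1) (by simpa [one_add_one_eq_two] using cx_cd h.cd)

lemma Sol.repr {ρ : ℝ} {v : ℂ → ℝ} (h : Sol ρ v) (z : ℂ) :
    dz (cx v) z = - (1 / (4 * π)) * ∫ x, (mu ρ v x : ℂ) / (z - x) := by
  have hmc : Continuous (fun x => (mu ρ v x : ℂ)) := Complex.continuous_ofReal.comp h.mu_cont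
  have hmi := integrable_div_sub hmc h.int.ofReal z
  have e : ∀ x, dzb (dz (cx v)) x / (z - x) = (-(1/4)) * ((mu ρ v x : ℂ) / (z - x)) := by
    intro x; rw [h.pde]; push_cast; ring
  have key := px_lim h.dzv_cd z (by simp only [e]; exact hmi.const_mul _) ?_
  · simp only [e] at key
    rw [integral_const_mul] at key
    have hpi : (π : ℂ) ≠ 0 := by exact_mod_cast pi_ne_zero
    field_simp
    linear_combination 4 * key
  · obtain ⟨K, hK0, hK⟩ := dz_kap_bound
    have hb : ∀ t : ℝ, 1 ≤ t → ‖∫ y, kap y * dz (cx v) (z + t * y)‖ ≤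
        (8 * K) * ((16 * π * ρ - Mean v z 1 + (8 * π * ρ) / 6 * Real.log (2 * t)) / t) := by
      intro t ht
      have ht0 : 0 < t := by linarith
      have h1 := err_ibp (cx_cd (h.cd.of_le (by norm_num) : ContDiff ℝ 1 v)) z t
      have h2 : ‖∫ y, dz kap y * cx v (z + t * y)‖ ≤ ∫ y, (2 * K) * (phi (0 + (1/2 : ℝ) * y) * |v (z + t * y)|) := by
        refine norm_integral_le_of_norm_le ?_ ?_
        · apply Integrable.const_mul
          have := h.cd.continuous
          have hc := phi_cont
          refine Continuous.integrable_of_hasCompactSupport (by fun_prop) ?_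
          apply HasCompactSupport.of_support_subset_isCompact (isCompact_closedBall 0 2)
          intro y hy; by_contra h; simp at h
          apply hy
          have : phi (0 + (1/2 : ℝ) * y) = 0 := by
            apply phi_zero_of; rw [zero_add, norm_mul, Complex.norm_real]; norm_num; linarith
          simp only [this, zero_mul]
        · filter_upwards with y
          rw [norm_mul]
          by_cases hy : 1 < ‖y‖
          · rw [dz_kap_zero_of hy]; simp
            have := phi_nonneg (2⁻¹ * y); positivity
          · have h3 : 1/2 ≤ phi (0 + (1/2 : ℝ) * y) := by
              apply phi_lower; rw [zero_add, norm_mul, Complex.norm_real]; norm_num; linarith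
            have h4 : ‖cx v (z + t * y)‖ = |v (z + t * y)| := by simp [cx]
            rw [h4]
            have := hK y
            calc ‖dz kap y‖ * |v (z + t * y)| ≤ K * |v (z + t * y)| := by gcongr
              _ = 2 * K * (1/2 * |v (z + t * y)|) := by ring
              _ ≤ _ := by gcongr
      have h5 : ∫ y, phi (0 + (1/2 : ℝ) * y) * |v (z + t * y)| = 4 * ∫ y, phi y * |v (z + (2 * t : ℝ) * y)| := by
        have := int_affine (fun y => phi y * |v (z + (2 * t : ℝ) * y)|) 0 (t := 1/2) (by norm_num)
        rw [smul_eq_mul, show (((1/2:ℝ))^2)⁻¹ = 4 by norm_num] at this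
        rw [← this]
        congr 1; ext y; congr 3; push_cast; ring
      rw [integral_const_mul, h5] at h2
      have h6 := h.abs_mean z (R := 2 * t) (by linarith)
      have h7 : t * ‖∫ y, kap y * dz (cx v) (z + t * y)‖ = ‖∫ y, dz kap y * cx v (z + t * y)‖ := by
        rw [← norm_neg (∫ y, dz kap y * cx v (z + t * y)), ← h1, norm_mul, Complex.norm_real, Real.norm_of_nonneg ht0.le]
      rw [← mul_div_assoc, le_div_iff₀ ht0, mul_comm, h7]
      refine h2.trans ?_
      have := mul_le_mul_of_nonneg_left h6 hK0
      linarith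
    have hlog : Filter.Tendsto (fun t : ℝ => Real.log (2 * t) / t) Filter.atTop (nhds 0) := by
      have h0 := Real.isLittleO_log_id_atTop.tendsto_div_nhds_zero
      have h1 := h0.comp (Filter.tendsto_id.const_mul_atTop (show (0:ℝ) < 2 by norm_num))
      have h2 := h1.const_mul 2
      rw [mul_zero] at h2
      refine h2.congr fun t => ?_
      simp only [Function.comp, id]
      by_cases ht : t = 0
      · simp [ht]
      field_simp
    have hinv : Filter.Tendsto (fun t : ℝ => t⁻¹) Filter.atTop (nhds 0) := tendsto_inv_atTop_zero
    have hl : Filter.Tendsto (fun t : ℝ => (8 * K) * ((16 * π * ρ - Mean v z 1 + (8 * π * ρ) / 6 * Real.log (2 * t)) / t)) Filter.atTop (nhds 0) := by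
      have := ((hinv.const_mul (16 * π * ρ - Mean v z 1)).add (hlog.const_mul ((8 * π * ρ) / 6))).const_mul (8 * K)
      simp only [mul_zero, add_zero] at this
      refine this.congr fun t => ?_
      ring
    refine squeeze_zero_norm' ?_ hl
    filter_upwards [Filter.eventually_ge_atTop 1] with t ht using hb t ht

end RS

namespace RS
open Complex (I)
open scoped ComplexConjugate ContDiff

noncomputable def Nc (z : ℂ) : ℂ := 1 + z * conj z
noncomputable def sf (z : ℂ) : ℂ := conj z * (Nc z)⁻¹
noncomputable def lg (z : ℂ) : ℝ := Real.log (1 + ‖z‖ ^ 2)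

lemma Nc_eq (z : ℂ) : Nc z = ((1 + ‖z‖ ^ 2 : ℝ) : ℂ) := by
  unfold Nc; rw [normsq_eq]; push_cast; rfl

lemma Nc_ne (z : ℂ) : Nc z ≠ 0 := by
  rw [Nc_eq]; exact_mod_cast (N_pos z).ne'

lemma hasW_Nc (z : ℂ) : HasW Nc (conj z) z z := by
  refine ((hasW_const 1 z).add ((hasW_id z).mul (hasW_conj z))).congr ?_ ?_ <;> simp

lemma hasW_sf (z : ℂ) : HasW sf (-(sf z) ^ 2) ((Nc z)⁻¹ ^ 2) z := by
  refine ((hasW_conj z).mul ((hasW_Nc z).inv (Nc_ne z))).congr ?_ ?_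
  · unfold sf; field_simp; ring
  · have := Nc_ne z
    field_simp
    unfold Nc; ring

lemma conj_Nc (z : ℂ) : conj (Nc z) = Nc z := by rw [Nc_eq, Complex.conj_ofReal]

lemma hasW_lg (z : ℂ) : HasW (cx lg) (sf z) (conj (sf z)) z := by
  have h1 : HasW (fun x : ℂ => ((1 + ‖x‖ ^ 2 : ℝ) : ℂ)) (conj z) z z :=
    (hasW_Nc z).of_eq (fun x => (Nc_eq x).symm)
  have := h1.comp_real (Real.hasDerivAt_log (N_pos z).ne')
  have e : (((1 + ‖z‖ ^ 2 : ℝ)⁻¹ : ℝ) : ℂ) = (Nc z)⁻¹ := by rw [Nc_eq]; push_cast; rfl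
  rw [e] at this
  refine HasW.congr this ?_ ?_
  · unfold sf; ring
  · unfold sf; rw [map_mul, map_inv₀, conj_Nc, Complex.conj_conj]; ring

lemma lg_cd {n : WithTop ℕ∞} : ContDiff ℝ n lg :=
  (contDiff_const.add (contDiff_norm_sq ℝ)).log (fun z => (N_pos z).ne')

lemma mu_eq_exp (ρ : ℝ) (v : ℂ → ℝ) (z : ℂ) : mu ρ v z = Real.exp (v z + 2 * (ρ - 1) * lg z) := by
  unfold mu lg
  rw [Real.rpow_def_of_pos (N_pos z), ← Real.exp_add]; ring_nf

lemma cx_mu_hasW (ρ : ℝ) {v : ℂ → ℝ} (hv : ContDiff ℝ 1 v) (z : ℂ) :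
    HasW (cx (mu ρ v)) (mu ρ v z * (dz (cx v) z + 2 * (ρ - 1) * sf z))
      (mu ρ v z * conj (dz (cx v) z + 2 * (ρ - 1) * sf z)) z := by
  have h1 : HasW (fun z => ((v z + 2 * (ρ - 1) * lg z : ℝ) : ℂ)) (dz (cx v) z + 2 * (ρ - 1) * sf z)
      (conj (dz (cx v) z + 2 * (ρ - 1) * sf z)) z := by
    have := (cd_hasW (cx_cd hv) z).add ((hasW_lg z).const_mul (2 * (ρ - 1)))
    rw [dzb_cx hv] at this
    refine (this.congr rfl ?_).of_eq ?_
    · simp [Complex.conj_ofNat]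
    · intro x; simp [cx]
  have := h1.comp_real (Real.hasDerivAt_exp _)
  refine (this.of_eq (fun x => by simp [cx, mu_eq_exp])).congr ?_ ?_ <;> rw [mu_eq_exp]

noncomputable def Dmu (ρ : ℝ) (v : ℂ → ℝ) (z : ℂ) : ℝ :=
  mu ρ v z * (Complex.normSq (dz (cx v) z + 2 * (ρ - 1) * sf z) - 1/4 * mu ρ v z
    + 2 * (ρ - 1) * ((1 + ‖z‖ ^ 2)⁻¹) ^ 2)

lemma Sol.dmu {ρ : ℝ} {v : ℂ → ℝ} (h : Sol ρ v) (z : ℂ) :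
    dzb (dz (cx (mu ρ v))) z = Dmu ρ v z := by
  have hv : ContDiff ℝ 1 v := h.cd.of_le (by norm_num)
  have e : dz (cx (mu ρ v)) = fun z => cx (mu ρ v) z * (dz (cx v) z + 2 * (ρ - 1) * sf z) := by
    ext z; exact (cx_mu_hasW ρ hv z).dz
  rw [e]
  have h1 := cd_hasW h.dzv_cd z
  rw [h.pde] at h1
  rw [((cx_mu_hasW ρ hv z).mul (h1.add ((hasW_sf z).const_mul (2 * (ρ - 1))))).dzb]
  unfold Dmu cx
  push_cast
  rw [← Complex.mul_conj, Nc_eq]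
  push_cast
  ring

lemma Sol.dmu_lower {ρ : ℝ} {v : ℂ → ℝ} (h : Sol ρ v) (z : ℂ) :
    -(1/4) * mu ρ v z ^ 2 ≤ Dmu ρ v z := by
  unfold Dmu
  have h1 := mu_pos ρ v z
  have h2 := Complex.normSq_nonneg (dz (cx v) z + 2 * (ρ - 1) * sf z)
  have h3 : 0 ≤ 2 * (ρ - 1) * ((1 + ‖z‖ ^ 2)⁻¹) ^ 2 := by
    have : 0 < ρ - 1 := by linarith [h.h1]
    positivity
  nlinarith [mul_nonneg h1.le h2, mul_nonneg h1.le h3]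

lemma sf_cd {n : WithTop ℕ∞} : ContDiff ℝ n sf := by
  have hcj : ContDiff ℝ n (fun x : ℂ => conj x) := Complex.conjCLE.contDiff
  exact hcj.mul ((contDiff_const.add (contDiff_id.mul hcj)).inv Nc_ne)

noncomputable def cphi : ℝ := ∫ y, phi y

lemma cphi_pos : 0 < cphi := by
  unfold cphi
  refine phi_cont.integral_pos_of_hasCompactSupport_nonneg_nonzero phi_hcs phi_nonneg (x := 0) ?_
  simp [phi]

lemma Sol.pick {ρ : ℝ} {v : ℂ → ℝ} (h : Sol ρ v) {z : ℂ} {d : ℝ} (hd : 0 < d)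
    (hm : ∫ y in Metric.ball z d, mu ρ v y ≤ cphi / 8) : d ^ 2 * mu ρ v z ≤ 1 := by
  by_contra hcon
  push Not at hcon
  have hmc := h.mu_cont
  have hfc : Continuous (fun y => (d - ‖y - z‖) ^ 2 * mu ρ v y) := by fun_prop
  obtain ⟨y0, hy0, hmax⟩ := (isCompact_closedBall z d).exists_isMaxOn ⟨z, by simp [hd.le]⟩ hfc.continuousOn
  have hmax' : ∀ y, ‖y - z‖ ≤ d → (d - ‖y - z‖) ^ 2 * mu ρ v y ≤ (d - ‖y0 - z‖) ^ 2 * mu ρ v y0 := by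
    intro y hy
    exact hmax (by rw [Metric.mem_closedBall, dist_eq_norm]; exact hy)
  have hz := hmax' z (by simp [hd.le])
  simp only [sub_self, norm_zero, sub_zero] at hz
  have hd0 : 0 ≤ d - ‖y0 - z‖ := by
    rw [Metric.mem_closedBall, dist_eq_norm] at hy0; linarith
  set d0 := d - ‖y0 - z‖ with hd0def
  set m := mu ρ v y0 with hmdef
  have hm0 : 0 < m := mu_pos ρ v y0
  have hbig : 1 < d0 ^ 2 * m := lt_of_lt_of_le hcon hz
  set s := 1 / (2 * Real.sqrt m) with hs
  have hsq : 0 < Real.sqrt m := Real.sqrt_pos.2 hm0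
  have hs0 : 0 < s := by positivity
  have hs2 : s ^ 2 * m = 1 / 4 := by
    rw [hs, div_pow, mul_pow, Real.sq_sqrt hm0.le]; field_simp; norm_num
  have hsd : s < d0 / 2 := by
    have : (2 * s) ^ 2 < d0 ^ 2 := by
      have : (2 * s) ^ 2 * m < d0 ^ 2 * m := by nlinarith
      exact lt_of_mul_lt_mul_right this hm0.le
    have := lt_of_pow_lt_pow_left₀ 2 hd0 this
    linarith
  have hnear : ∀ y, ‖y - y0‖ ≤ s → mu ρ v y ≤ 4 * m := by
    intro y hy
    have h1 : ‖y - z‖ ≤ ‖y - y0‖ + ‖y0 - z‖ := by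
      have : y - z = (y - y0) + (y0 - z) := by ring
      rw [this]; exact norm_add_le _ _
    have h2 : d0 / 2 ≤ d - ‖y - z‖ := by linarith
    have h3 := hmax' y (by linarith)
    have h4 : (d0 / 2) ^ 2 * mu ρ v y ≤ d0 ^ 2 * m := by
      refine le_trans ?_ h3
      have := mu_pos ρ v y
      gcongr
    have h5 : 0 < d0 := by linarith
    have h6 : d0 ^ 2 * mu ρ v y ≤ d0 ^ 2 * (4 * m) := by nlinarith
    exact le_of_mul_le_mul_left h6 (by positivity)
  have hG : ContDiff ℝ 2 (mu ρ v) := mu_cd ρ h.cd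
  have hder := fun t => mean_hasDeriv hG h.dmu y0 t
  have hDc : Continuous (Dmu ρ v) := by
    have h1 := h.dzv_cd.continuous
    have h2 := (sf_cd (n := 0)).continuous
    have h3 : Continuous (fun z : ℂ => (1 + ‖z‖ ^ 2)⁻¹) :=
      Continuous.inv₀ (by fun_prop) (fun z => (N_pos z).ne')
    unfold Dmu
    refine hmc.mul (((Complex.continuous_normSq.comp ?_).sub ?_).add ?_) <;> fun_prop
  have iphi : Integrable phi := phi_cont.integrable_of_hasCompactSupport phi_hcs
  have hlow : ∀ t, 0 < t → t < s → -(4 * m ^ 2 * cphi) ≤ ∫ y, Psi y * Dmu ρ v (y0 + t * y) := by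
    intro t ht hts
    have e : -(4 * m ^ 2 * cphi) = ∫ y, -(4 * m ^ 2) * phi y := by
      rw [integral_const_mul]; unfold cphi; ring
    rw [e]
    refine integral_mono (iphi.const_mul _) (Continuous.integrable_of_hasCompactSupport
      (Psi_cont.mul (hDc.comp (by fun_prop))) Psi_hcs.mul_right) ?_
    intro y
    simp only
    by_cases hy : 1 ≤ ‖y‖
    · rw [Psi_zero_of hy, phi_zero_of hy]; simp
    · push Not at hy
      have h1 := hnear (y0 + t * y) (by
        simp only [add_sub_cancel_left, norm_mul, Complex.norm_real, Real.norm_of_nonneg ht.le]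
        nlinarith [norm_nonneg y])
      have h2 := h.dmu_lower (y0 + t * y)
      have h3 := mu_pos ρ v (y0 + t * y)
      have h4 : -(4 * m ^ 2) ≤ Dmu ρ v (y0 + t * y) := by nlinarith
      have h5 := Psi_nonneg y
      have h6 := Psi_le_phi y
      nlinarith [mul_le_mul_of_nonneg_left h4 h5, mul_nonneg (sub_nonneg.2 h6) (sq_nonneg m)]
  have hmono : MonotoneOn (fun t => Mean (mu ρ v) y0 t + 4/3 * m ^ 2 * cphi * t ^ 2) (Set.Icc 0 s) := by
    have hd2 : ∀ t : ℝ, HasDerivAt (fun t => Mean (mu ρ v) y0 t + 4/3 * m ^ 2 * cphi * t ^ 2)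
        (2 * t / 3 * (∫ y, Psi y * Dmu ρ v (y0 + t * y)) + 4/3 * m ^ 2 * cphi * (2 * t)) t := by
      intro t
      have := (hder t).add ((hasDerivAt_pow 2 t).const_mul (4/3 * m ^ 2 * cphi))
      refine HasDerivAt.congr_deriv this ?_
      norm_num
    apply monotoneOn_of_deriv_nonneg (convex_Icc 0 s)
    · intro t ht; exact (hd2 t).continuousAt.continuousWithinAt
    · intro t ht; exact (hd2 t).differentiableAt.differentiableWithinAt
    · intro t ht; rw [interior_Icc] at ht
      rw [(hd2 t).deriv]
      have := mul_le_mul_of_nonneg_left (hlow t ht.1 ht.2) (show 0 ≤ 2 * t / 3 by linarith [ht.1])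
      linarith
  have hM := hmono (Set.left_mem_Icc.2 hs0.le) (Set.right_mem_Icc.2 hs0.le) hs0.le
  have hM0 : Mean (mu ρ v) y0 0 = cphi * m := by
    unfold Mean cphi; rw [← integral_mul_const]; simp [hmdef]
  have hMs := weight_le hmc (fun z => (mu_pos ρ v z).le) h.int phi_nonneg phi_le_one
    (fun y hy => phi_zero_of hy) y0 hs0
  have hsub : ∫ y in Metric.ball y0 s, mu ρ v y ≤ ∫ y in Metric.ball z d, mu ρ v y := by
    apply setIntegral_mono_set h.int.integrableOn
      (Filter.Eventually.of_forall fun z => (mu_pos ρ v z).le)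
    apply Filter.Eventually.of_forall
    apply Metric.ball_subset_ball'
    rw [dist_eq_norm]; linarith
  have h7 : (s ^ 2)⁻¹ = 4 * m := by
    have : s ^ 2 ≠ 0 := by positivity
    field_simp; linarith
  rw [h7] at hMs
  have h8 : Mean (mu ρ v) y0 s ≤ 4 * m * (cphi / 8) :=
    hMs.trans (mul_le_mul_of_nonneg_left (hsub.trans hm) (by positivity))
  simp only [hM0] at hM
  have h9 : 4 / 3 * m ^ 2 * cphi * s ^ 2 = cphi * m / 3 := by
    calc 4 / 3 * m ^ 2 * cphi * s ^ 2 = 4/3 * m * cphi * (s ^ 2 * m) := by ring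
      _ = _ := by rw [hs2]; ring
  rw [h9] at hM
  have := mul_pos cphi_pos hm0
  norm_num at hM
  linarith

/-- `mu` decays at least quadratically -/
lemma Sol.mu_decay2 {ρ : ℝ} {v : ℂ → ℝ} (h : Sol ρ v) :
    ∃ R0 : ℝ, 0 < R0 ∧ ∀ z : ℂ, R0 ≤ ‖z‖ → ‖z‖ ^ 2 * mu ρ v z ≤ 4 := by
  have h1 : Filter.Tendsto (fun n : ℕ => ∫ y in (Metric.closedBall (0:ℂ) n)ᶜ, mu ρ v y) Filter.atTop
      (nhds 0) := by
    have e : ∀ n : ℕ, ∫ y in (Metric.closedBall (0:ℂ) n)ᶜ, mu ρ v y =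
        (∫ y, mu ρ v y) - ∫ y in Metric.closedBall (0:ℂ) n, mu ρ v y := by
      intro n
      rw [← integral_add_compl Metric.isClosed_closedBall.measurableSet h.int]; ring
    simp only [e]
    have h2 := tendsto_setIntegral_of_monotone (μ := volume) (f := mu ρ v) (s := fun n : ℕ => Metric.closedBall (0:ℂ) n)
      (fun n => Metric.isClosed_closedBall.measurableSet)
      (fun a b hab => Metric.closedBall_subset_closedBall (by exact_mod_cast hab))
      (by rw [Metric.iUnion_closedBall_nat]; exact h.int.integrableOn)
    rw [Metric.iUnion_closedBall_nat, setIntegral_univ] at h2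
    have := (tendsto_const_nhds (x := ∫ y, mu ρ v y)).sub h2
    rwa [sub_self] at this
  have h2 := h1.eventually (ge_mem_nhds (show (0:ℝ) < cphi / 8 by linarith [cphi_pos]))
  obtain ⟨n, hn⟩ := h2.exists
  refine ⟨2 * n + 1, by positivity, fun z hz => ?_⟩
  have hz0 : 0 < ‖z‖ := by have : (0:ℝ) ≤ n := by positivity
                           linarith
  have := h.pick (z := z) (d := ‖z‖ / 2) (by positivity) (le_trans ?_ hn)
  · linarith [this]
  · apply setIntegral_mono_set h.int.integrableOn
      (Filter.Eventually.of_forall fun z => (mu_pos ρ v z).le)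
    apply Filter.Eventually.of_forall
    intro y hy
    have hy' : ‖y - z‖ < ‖z‖ / 2 := by rw [← dist_eq_norm]; exact hy
    show y ∉ Metric.closedBall (0:ℂ) n
    simp only [Metric.mem_closedBall, dist_zero_right, not_le]
    have := norm_sub_norm_le z y
    rw [norm_sub_rev] at this
    linarith

end RS

namespace RS
open Complex (I)
open scoped ComplexConjugate ContDiff

lemma kern_pt {θ x y X : ℝ} (h0 : 0 ≤ θ) (h1 : θ ≤ 1) (hx : 1 ≤ x) (hy : 0 < y) (hX : 0 ≤ X) (hXxy : X ≤ x + y) :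
    X ^ θ * (x ^ (-(3/2 + θ)) * y⁻¹) ≤
      2 * ((if y < 1 then y⁻¹ else 0) + x ^ (-(5/2:ℝ)) + 6 * (1 + y) ^ (-(5/2:ℝ))) := by
  have hx0 : 0 < x := by linarith
  have h2 : (2:ℝ) ^ θ ≤ 2 := by
    calc (2:ℝ) ^ θ ≤ 2 ^ (1:ℝ) := Real.rpow_le_rpow_of_exponent_le (by norm_num) h1
      _ = 2 := by norm_num
  have p1 : 0 ≤ (if y < 1 then y⁻¹ else 0) := by split_ifs <;> positivity
  have p2 : 0 ≤ x ^ (-(5/2:ℝ)) := by positivity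
  have p3 : 0 ≤ (1 + y) ^ (-(5/2:ℝ)) := by positivity
  rcases le_total x y with hxy | hxy
  · have e1 : X ^ θ ≤ 2 ^ θ * y ^ θ := by
      rw [← Real.mul_rpow (by norm_num) hy.le]
      exact Real.rpow_le_rpow hX (by linarith) h0
    have e2 : y ^ θ * y⁻¹ ≤ x ^ (θ - 1) := by
      rw [← Real.rpow_neg_one y, ← Real.rpow_add hy]
      exact Real.rpow_le_rpow_of_nonpos hx0 hxy (by linarith)
    have e3 : x ^ (-(3/2 + θ)) * x ^ (θ - 1) = x ^ (-(5/2:ℝ)) := by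
      rw [← Real.rpow_add hx0]; ring_nf
    calc X ^ θ * (x ^ (-(3/2 + θ)) * y⁻¹) ≤ (2 ^ θ * y ^ θ) * (x ^ (-(3/2 + θ)) * y⁻¹) := by gcongr
      _ = 2 ^ θ * (x ^ (-(3/2 + θ)) * (y ^ θ * y⁻¹)) := by ring
      _ ≤ 2 * (x ^ (-(3/2 + θ)) * x ^ (θ - 1)) := by gcongr
      _ = 2 * x ^ (-(5/2:ℝ)) := by rw [e3]
      _ ≤ _ := by linarith
  · have e1 : X ^ θ ≤ 2 ^ θ * x ^ θ := by
      rw [← Real.mul_rpow (by norm_num) hx0.le]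
      exact Real.rpow_le_rpow hX (by linarith) h0
    have e2 : x ^ θ * x ^ (-(3/2 + θ)) = x ^ (-(3/2:ℝ)) := by
      rw [← Real.rpow_add hx0]; ring_nf
    have e4 : X ^ θ * (x ^ (-(3/2 + θ)) * y⁻¹) ≤ 2 * (x ^ (-(3/2:ℝ)) * y⁻¹) := by
      calc X ^ θ * (x ^ (-(3/2 + θ)) * y⁻¹) ≤ (2 ^ θ * x ^ θ) * (x ^ (-(3/2 + θ)) * y⁻¹) := by gcongr
      _ = 2 ^ θ * ((x ^ θ * x ^ (-(3/2 + θ))) * y⁻¹) := by ring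
      _ ≤ 2 * ((x ^ θ * x ^ (-(3/2 + θ))) * y⁻¹) := by gcongr
      _ = _ := by rw [e2]
    refine e4.trans ?_
    by_cases hy1 : y < 1
    · rw [if_pos hy1]
      have : x ^ (-(3/2:ℝ)) ≤ 1 := Real.rpow_le_one_of_one_le_of_nonpos hx (by norm_num)
      have : x ^ (-(3/2:ℝ)) * y⁻¹ ≤ 1 * y⁻¹ := by gcongr
      linarith
    · push Not at hy1
      rw [if_neg (not_lt.2 hy1)]
      have f1 : x ^ (-(3/2:ℝ)) ≤ y ^ (-(3/2:ℝ)) := Real.rpow_le_rpow_of_nonpos hy hxy (by norm_num)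
      have f2 : y ^ (-(3/2:ℝ)) * y⁻¹ = y ^ (-(5/2:ℝ)) := by
        rw [← Real.rpow_neg_one y, ← Real.rpow_add hy]; norm_num
      have f3 : y ^ (-(5/2:ℝ)) ≤ ((1 + y) / 2) ^ (-(5/2:ℝ)) :=
        Real.rpow_le_rpow_of_nonpos (by positivity) (by linarith) (by norm_num)
      have f4 : ((1 + y) / 2) ^ (-(5/2:ℝ)) = (1 + y) ^ (-(5/2:ℝ)) * 2 ^ (5/2:ℝ) := by
        rw [Real.div_rpow (by positivity) (by norm_num), Real.rpow_neg (by norm_num : (0:ℝ) ≤ 2), div_inv_eq_mul]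
      have f5 : (2:ℝ) ^ (5/2:ℝ) ≤ 6 := by
        have : ((2:ℝ) ^ (5/2:ℝ)) ^ 2 = 32 := by
          rw [← Real.rpow_natCast, ← Real.rpow_mul (by norm_num)]; norm_num
        nlinarith [Real.rpow_pos_of_pos (show (0:ℝ) < 2 by norm_num) (5/2)]
      have f6 : x ^ (-(3/2:ℝ)) * y⁻¹ ≤ y ^ (-(3/2:ℝ)) * y⁻¹ := by gcongr
      have f7 : (1 + y) ^ (-(5/2:ℝ)) * 2 ^ (5/2:ℝ) ≤ (1 + y) ^ (-(5/2:ℝ)) * 6 := by gcongr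
      linarith

lemma int_52 : Integrable (fun x : ℂ => (1 + ‖x‖) ^ (-(5/2:ℝ))) :=
  integrable_one_add_norm (by rw [Complex.finrank_real_complex]; norm_num)

/-- The kernel lemma. -/
lemma kern : ∃ K : ℝ, 0 ≤ K ∧ ∀ θ : ℝ, 0 ≤ θ → θ ≤ 1 → ∀ (f : ℂ → ℂ) (C : ℝ), Continuous f →
    (∀ x, ‖f x‖ ≤ C * (1 + ‖x‖) ^ (-(3/2 + θ))) → ∀ z : ℂ, Integrable (fun x => f x / (z - x)) ∧
      ‖∫ x, f x / (z - x)‖ ≤ K * C * (1 + ‖z‖) ^ (-θ) := by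
  set A : ℂ → ℝ := (Metric.ball (0:ℂ) 1).indicator (fun x : ℂ => ‖x‖⁻¹) with hA
  have iA : Integrable A := (integrable_indicator_iff measurableSet_ball).2 (integrableOn_inv_norm 1)
  set B : ℂ → ℝ := fun x => (1 + ‖x‖) ^ (-(5/2:ℝ)) with hB
  have iB : Integrable B := int_52
  have A0 : ∀ x, 0 ≤ A x := fun x => Set.indicator_nonneg (fun _ _ => by positivity) x
  have B0 : ∀ x, 0 ≤ B x := fun x => by rw [hB]; positivity
  refine ⟨2 * ((∫ x, A x) + (∫ x, B x) + 6 * ∫ x, B x), ?_, ?_⟩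
  · have := integral_nonneg (μ := volume) (f := A) (fun x => A0 x); have := integral_nonneg (μ := volume) (f := B) (fun x => B0 x); positivity
  intro θ h0 h1 f C hf hb z
  have hC : 0 ≤ C := by
    have := (norm_nonneg _).trans (hb 0); simpa using this
  have hz0 : 0 < 1 + ‖z‖ := by positivity
  have iM : Integrable (fun x => C * (1 + ‖z‖) ^ (-θ) * (2 * (A (z - x) + B x + 6 * B (z - x)))) :=
    ((((iA.comp_sub_left z).add iB).add ((iB.comp_sub_left z).const_mul 6)).const_mul 2).const_mul _
  have hpt : ∀ x, ‖f x / (z - x)‖ ≤ C * (1 + ‖z‖) ^ (-θ) * (2 * (A (z - x) + B x + 6 * B (z - x))) := by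
    intro x
    by_cases hx : z - x = 0
    · rw [hx]; simp only [div_zero, norm_zero]
      have := A0 0; have := B0 x; have := B0 0; positivity
    have hy : 0 < ‖z - x‖ := norm_pos_iff.2 hx
    have hk := kern_pt h0 h1 (x := 1 + ‖x‖) (y := ‖z - x‖) (X := 1 + ‖z‖) (by linarith [norm_nonneg x]) hy hz0.le
      (by have := norm_sub_norm_le z x; linarith)
    have eA : A (z - x) = if ‖z - x‖ < 1 then ‖z - x‖⁻¹ else 0 := by
      simp [hA, Set.indicator]
    rw [← eA] at hk
    change _ ≤ 2 * (A (z - x) + B x + 6 * B (z - x)) at hk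
    have e1 : (1 + ‖z‖) ^ (-θ) * (1 + ‖z‖) ^ θ = 1 := by
      rw [← Real.rpow_add hz0]; simp
    rw [norm_div, div_eq_mul_inv]
    calc ‖f x‖ * ‖z - x‖⁻¹ ≤ C * (1 + ‖x‖) ^ (-(3/2 + θ)) * ‖z - x‖⁻¹ := by gcongr; exact hb x
      _ = C * (1 + ‖z‖) ^ (-θ) * ((1 + ‖z‖) ^ θ * ((1 + ‖x‖) ^ (-(3/2 + θ)) * ‖z - x‖⁻¹)) := by
          linear_combination (-(C * (1 + ‖x‖) ^ (-(3/2 + θ)) * ‖z - x‖⁻¹)) * e1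
      _ ≤ _ := by gcongr
  refine ⟨iM.mono' (hf.measurable.div (by fun_prop)).aestronglyMeasurable (Filter.Eventually.of_forall hpt), ?_⟩
  refine (norm_integral_le_of_norm_le iM (Filter.Eventually.of_forall hpt)).trans ?_
  have i2 : Integrable (fun x => A (z - x) + B x) := (iA.comp_sub_left z).add iB
  rw [integral_const_mul, integral_const_mul,
    integral_add i2 ((iB.comp_sub_left z).const_mul 6),
    integral_add (iA.comp_sub_left z) iB, integral_const_mul, integral_sub_left_eq_self A, integral_sub_left_eq_self B]
  apply le_of_eq; ring

/-- `u_z` -/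
noncomputable def af (ρ : ℝ) (v : ℂ → ℝ) (z : ℂ) : ℂ := dz (cx v) z + 2 * ρ * sf z
noncomputable def uf (ρ : ℝ) (v : ℂ → ℝ) (z : ℂ) : ℝ := v z + 2 * ρ * lg z

lemma mu_eq_u (ρ : ℝ) (v : ℂ → ℝ) (z : ℂ) : mu ρ v z = ((1 + ‖z‖ ^ 2) ^ 2)⁻¹ * Real.exp (uf ρ v z) := by
  have : ((1 + ‖z‖ ^ 2) ^ 2)⁻¹ = Real.exp (-(2 * lg z)) := by
    rw [Real.exp_neg, mul_comm, Real.exp_mul, lg, Real.exp_log (N_pos z)]; norm_cast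
  rw [mu_eq_exp, this, ← Real.exp_add]; unfold uf; ring_nf

lemma uf_cd {n : WithTop ℕ∞} (ρ : ℝ) {v : ℂ → ℝ} (hv : ContDiff ℝ n v) : ContDiff ℝ n (uf ρ v) :=
  hv.add (contDiff_const.mul lg_cd)

lemma uf_hasW (ρ : ℝ) {v : ℂ → ℝ} (hv : ContDiff ℝ 1 v) (z : ℂ) :
    HasW (cx (uf ρ v)) (af ρ v z) (conj (af ρ v z)) z := by
  have := (cd_hasW (cx_cd hv) z).add ((hasW_lg z).const_mul (2 * ρ))
  rw [dzb_cx hv] at this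
  refine (this.congr rfl ?_).of_eq ?_
  · simp [af, Complex.conj_ofNat]
  · intro x; simp [cx, uf]

lemma uf_ray (ρ : ℝ) {v : ℂ → ℝ} (hv : ContDiff ℝ 1 v) (w : ℂ) (t : ℝ) :
    HasDerivAt (fun t : ℝ => uf ρ v (t * w)) (2 * (af ρ v (t * w) * w).re) t := by
  have h1 : HasDerivAt (fun t : ℝ => (t : ℂ) * w) w t := by
    have := ((Complex.ofRealCLM.hasDerivAt (x := t)).mul_const w)
    simpa using this
  have h2 := (((uf_cd ρ hv).differentiable (by norm_num) _).hasFDerivAt).comp_hasDerivAt t h1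
  rw [fderiv_real_eq (uf_cd ρ hv), (uf_hasW ρ hv _).dz] at h2
  exact h2

lemma Sol.cd1 {ρ : ℝ} {v : ℂ → ℝ} (h : Sol ρ v) : ContDiff ℝ 1 v := h.cd.of_le (by norm_num)

lemma z_sf (z : ℂ) : z * sf z = 1 - (Nc z)⁻¹ := by
  have := Nc_ne z
  unfold sf; field_simp; unfold Nc; ring

lemma ae_ne (z : ℂ) : ∀ᵐ x : ℂ, x ≠ z := by simp [ae_iff]

lemma Sol.mass_c {ρ : ℝ} {v : ℂ → ℝ} (h : Sol ρ v) : ∫ x, (mu ρ v x : ℂ) = 8 * π * ρ := by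
  rw [integral_complex_ofReal, h.mass]; push_cast; ring

lemma Sol.int_c {ρ : ℝ} {v : ℂ → ℝ} (h : Sol ρ v) : Integrable (fun x => (mu ρ v x : ℂ)) := h.int.ofReal

lemma Sol.mu_div {ρ : ℝ} {v : ℂ → ℝ} (h : Sol ρ v) (z : ℂ) :
    Integrable (fun x => (mu ρ v x : ℂ) / (z - x)) :=
  integrable_div_sub (Complex.continuous_ofReal.comp h.mu_cont) h.int.ofReal z

lemma Sol.za {ρ : ℝ} {v : ℂ → ℝ} (h : Sol ρ v) (z : ℂ) :
    Integrable (fun x => x * (mu ρ v x : ℂ) / (z - x)) ∧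
    z * af ρ v z = -(2 * ρ) * (Nc z)⁻¹ - (1 / (4 * π)) * ∫ x, x * (mu ρ v x : ℂ) / (z - x) := by
  have hi := (h.mu_div z).const_mul z
  have e : (fun x => x * (mu ρ v x : ℂ) / (z - x)) =ᵐ[volume] fun x => z * ((mu ρ v x : ℂ) / (z - x)) - mu ρ v x := by
    filter_upwards [ae_ne z] with x hx
    have : z - x ≠ 0 := sub_ne_zero.2 hx.symm
    field_simp; ring
  refine ⟨(hi.sub h.int_c).congr e.symm, ?_⟩
  rw [integral_congr_ae e, integral_sub hi h.int_c, integral_const_mul, h.mass_c]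
  unfold af
  rw [h.repr z, mul_add]
  have := z_sf z
  have hpi : (π : ℂ) ≠ 0 := by exact_mod_cast pi_ne_zero
  have e2 : z * (2 * ρ * sf z) = 2 * ρ * (1 - (Nc z)⁻¹) := by rw [← this]; ring
  rw [e2]; field_simp; ring

end RS

namespace RS
open Complex (I)
open scoped ComplexConjugate ContDiff

lemma Sol.za_small {ρ : ℝ} {v : ℂ → ℝ} (h : Sol ρ v) :
    ∃ R1 : ℝ, 1 ≤ R1 ∧ ∀ z : ℂ, R1 ≤ ‖z‖ → ‖z * af ρ v z‖ ≤ 1/4 := by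
  obtain ⟨R0, hR0, hdec⟩ := h.mu_decay2
  set far : ℂ → ℂ → ℝ := fun z x => if ‖z‖ / 64 ≤ ‖z - x‖ then ‖x‖ * mu ρ v x * ‖z - x‖⁻¹ else 0 with hfar
  have hmm := h.mu_cont.measurable
  have mfar : ∀ z, Measurable (far z) := by
    intro z
    refine Measurable.ite (measurableSet_le measurable_const (by fun_prop)) (by fun_prop) measurable_const
  have far0 : ∀ z x, 0 ≤ far z x := by
    intro z x; have := mu_pos ρ v x
    simp only [hfar]; split_ifs <;> positivity
  have far1 : ∀ z x, z ≠ 0 → far z x ≤ 65 * mu ρ v x := by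
    intro z x hz
    have hmp := mu_pos ρ v x
    have hz' : 0 < ‖z‖ := norm_pos_iff.2 hz
    simp only [hfar]; split_ifs with hc
    · have h0 : 0 < ‖z - x‖ := by linarith
      rw [← div_eq_mul_inv, div_le_iff₀ h0]
      have : ‖x‖ ≤ 65 * ‖z - x‖ := by
        have := norm_sub_norm_le x z
        rw [norm_sub_rev] at this; linarith
      nlinarith
    · positivity
  have far2 : ∀ z x, z ≠ 0 → far z x ≤ ‖x‖ * mu ρ v x * (64 * ‖z‖⁻¹) := by
    intro z x hz
    have hmp := mu_pos ρ v x
    have hz' : 0 < ‖z‖ := norm_pos_iff.2 hz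
    simp only [hfar]; split_ifs with hc
    · have : ‖z - x‖⁻¹ ≤ (‖z‖ / 64)⁻¹ := inv_anti₀ (by positivity) hc
      have e : (‖z‖ / 64)⁻¹ = 64 * ‖z‖⁻¹ := by field_simp
      rw [e] at this
      gcongr
    · positivity
  have hev : ∀ᶠ z in Filter.comap (norm : ℂ → ℝ) Filter.atTop, z ≠ 0 := by
    have := Filter.tendsto_comap.eventually (Filter.eventually_gt_atTop (0:ℝ)) (f := (norm : ℂ → ℝ))
    filter_upwards [this] with z hz using norm_pos_iff.1 hz
  have ifar : ∀ z, z ≠ 0 → Integrable (far z) := by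
    intro z hz
    refine (h.int.const_mul 65).mono' (mfar z).aestronglyMeasurable (Filter.Eventually.of_forall fun x => ?_)
    rw [Real.norm_of_nonneg (far0 z x)]; exact far1 z x hz
  have hlim : Filter.Tendsto (fun z => ∫ x, far z x) (Filter.comap (norm : ℂ → ℝ) Filter.atTop) (nhds 0) := by
    have := tendsto_integral_filter_of_dominated_convergence (μ := volume)
      (l := Filter.comap (norm : ℂ → ℝ) Filter.atTop) (F := far) (f := fun _ => 0) (fun x => 65 * mu ρ v x)
      (Filter.Eventually.of_forall fun z => (mfar z).aestronglyMeasurable)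
      (by filter_upwards [hev] with z hz
          refine Filter.Eventually.of_forall fun x => ?_
          rw [Real.norm_of_nonneg (far0 z x)]; exact far1 z x hz)
      (h.int.const_mul 65)
      (by refine Filter.Eventually.of_forall fun x => ?_
          have hl : Filter.Tendsto (fun z : ℂ => ‖x‖ * mu ρ v x * (64 * ‖z‖⁻¹)) (Filter.comap (norm : ℂ → ℝ) Filter.atTop) (nhds 0) := by
            have := ((tendsto_inv_atTop_zero (𝕜 := ℝ)).comp (Filter.tendsto_comap (f := (norm : ℂ → ℝ)))).const_mul 64
            have := this.const_mul (‖x‖ * mu ρ v x)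
            simpa using this
          refine squeeze_zero' (Filter.Eventually.of_forall fun z => far0 z x) ?_ hl
          filter_upwards [hev] with z hz using far2 z x hz)
    simpa using this
  have h3 := hlim.eventually (ge_mem_nhds (show (0:ℝ) < π / 4 by positivity))
  rw [Filter.eventually_comap] at h3
  obtain ⟨R2, hR2⟩ := Filter.eventually_atTop.1 h3
  refine ⟨max (max 1 R2) (max (2 * R0) 8), le_max_of_le_left (le_max_left _ _), ?_⟩
  intro z hz
  have z1 : 1 ≤ ‖z‖ := le_trans (le_max_of_le_left (le_max_left _ _)) hz
  have z2 : R2 ≤ ‖z‖ := le_trans (le_max_of_le_left (le_max_right _ _)) hz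
  have z3 : 2 * R0 ≤ ‖z‖ := le_trans (le_max_of_le_right (le_max_left _ _)) hz
  have z4 : 8 ≤ ‖z‖ := le_trans (le_max_of_le_right (le_max_right _ _)) hz
  have z0 : 0 < ‖z‖ := by linarith
  have hfz := hR2 ‖z‖ z2 z rfl
  have hzne : z ≠ 0 := norm_pos_iff.1 z0
  rw [(h.za z).2]
  set A : ℂ → ℝ := (Metric.ball (0:ℂ) (‖z‖/64)).indicator (fun x : ℂ => ‖x‖⁻¹) with hA
  have iA : Integrable A := (integrable_indicator_iff measurableSet_ball).2 (integrableOn_inv_norm _)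
  have hJ : ‖∫ x, x * (mu ρ v x : ℂ) / (z - x)‖ ≤ π / 4 + π / 4 := by
    have iM : Integrable (fun x => 8 / ‖z‖ * A (z - x) + far z x) :=
      ((iA.comp_sub_left z).const_mul _).add (ifar z hzne)
    refine (norm_integral_le_of_norm_le iM (Filter.Eventually.of_forall fun x => ?_)).trans ?_
    · have hmp := mu_pos ρ v x
      have e : ‖x * (mu ρ v x : ℂ) / (z - x)‖ = ‖x‖ * mu ρ v x * ‖z - x‖⁻¹ := by
        rw [norm_div, norm_mul, Complex.norm_real, Real.norm_of_nonneg hmp.le, div_eq_mul_inv]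
      rw [e]
      by_cases hc : ‖z‖ / 64 ≤ ‖z - x‖
      · have e1 : far z x = ‖x‖ * mu ρ v x * ‖z - x‖⁻¹ := by simp only [hfar, if_pos hc]
        have : 0 ≤ A (z - x) := Set.indicator_nonneg (fun _ _ => by positivity) _
        rw [e1]
        have : 0 ≤ 8 / ‖z‖ * A (z - x) := by positivity
        linarith
      · have e1 : A (z - x) = ‖z - x‖⁻¹ := by
          rw [hA, Set.indicator_of_mem]; simpa using hc
        rw [e1]
        have hx : ‖z‖ / 2 ≤ ‖x‖ := by
          have := norm_sub_norm_le z x; push Not at hc; linarith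
        have hx0 : 0 < ‖x‖ := by linarith
        have h5 := hdec x (by linarith)
        have h6 : ‖x‖ * mu ρ v x ≤ 8 / ‖z‖ := by
          rw [le_div_iff₀ z0]; nlinarith [mul_pos hx0 hmp]
        have : ‖x‖ * mu ρ v x * ‖z - x‖⁻¹ ≤ 8 / ‖z‖ * ‖z - x‖⁻¹ := by gcongr
        linarith [far0 z x]
    · rw [integral_add ((iA.comp_sub_left z).const_mul _) (ifar z hzne), integral_const_mul, integral_sub_left_eq_self A,
        hA, integral_indicator measurableSet_ball, integral_inv_norm (by positivity)]
      have : 8 / ‖z‖ * (2 * π * (‖z‖ / 64)) = π / 4 := by field_simp; norm_num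
      rw [this]; linarith
  have hN : ‖-(2 * (ρ : ℂ)) * (Nc z)⁻¹‖ ≤ 1/8 := by
    rw [norm_mul, norm_neg, norm_mul, Complex.norm_real, norm_inv, Nc_eq, Complex.norm_real,
      Real.norm_of_nonneg (N_pos z).le, Real.norm_of_nonneg (by linarith [h.h1]), Complex.norm_ofNat,
      ← div_eq_mul_inv, div_le_iff₀ (N_pos z)]
    nlinarith [h.h2]
  have h7 : ‖(1 / (4 * (π:ℂ))) * ∫ x, x * (mu ρ v x : ℂ) / (z - x)‖ ≤ 1/8 := by
    rw [norm_mul, norm_div, norm_mul, Complex.norm_real, Real.norm_of_nonneg pi_pos.le, Complex.norm_ofNat, norm_one]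
    have := mul_le_mul_of_nonneg_left hJ (show 0 ≤ 1 / (4 * π) by positivity)
    have e : 1 / (4 * π) * (π / 4 + π / 4) = 1/8 := by field_simp; norm_num
    linarith
  linarith [norm_sub_le (-(2 * (ρ : ℂ)) * (Nc z)⁻¹) ((1 / (4 * (π:ℂ))) * ∫ x, x * (mu ρ v x : ℂ) / (z - x))]

lemma polar (z : ℂ) : ∃ w : ℂ, ‖w‖ = 1 ∧ z = (‖z‖ : ℂ) * w := by
  by_cases hz : z = 0
  · exact ⟨1, by simp, by simp [hz]⟩
  · have : (‖z‖ : ℂ) ≠ 0 := by simpa using hz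
    refine ⟨z / ‖z‖, ?_, by field_simp⟩
    rw [norm_div, Complex.norm_real, norm_norm, div_self (by simpa using hz)]

lemma Sol.mu_decay72 {ρ : ℝ} {v : ℂ → ℝ} (h : Sol ρ v) :
    ∃ C : ℝ, ∀ z : ℂ, mu ρ v z ≤ C * (1 + ‖z‖) ^ (-(7/2:ℝ)) := by
  obtain ⟨R1, hR1, hza⟩ := h.za_small
  obtain ⟨C0, hC0⟩ := (isCompact_closedBall (0:ℂ) R1).exists_bound_of_continuousOn (uf_cd (n := 0) ρ (h.cd.of_le (by norm_num))).continuous.continuousOn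
  obtain ⟨C1, hC1⟩ := (isCompact_closedBall (0:ℂ) R1).exists_bound_of_continuousOn h.mu_cont.continuousOn
  have hC1' : 0 ≤ C1 := (norm_nonneg _).trans (hC1 0 (by simp; linarith))
  have hout : ∀ z : ℂ, R1 ≤ ‖z‖ → uf ρ v z ≤ C0 + 1/2 * Real.log ‖z‖ := by
    intro z hz
    obtain ⟨w, hw, hzw⟩ := polar z
    have hd2 : ∀ t : ℝ, R1 ≤ t → HasDerivAt (fun t : ℝ => uf ρ v (t * w) - 1/2 * Real.log t)
        (2 * (af ρ v (t * w) * w).re - 1/2 * t⁻¹) t := by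
      intro t ht
      exact (uf_ray ρ h.cd1 w t).sub ((Real.hasDerivAt_log (by linarith)).const_mul _)
    have hanti : AntitoneOn (fun t : ℝ => uf ρ v (t * w) - 1/2 * Real.log t) (Set.Ici R1) := by
      apply antitoneOn_of_deriv_nonpos (convex_Ici R1)
      · intro t ht; exact (hd2 t ht).continuousAt.continuousWithinAt
      · intro t ht; rw [interior_Ici] at ht
        exact (hd2 t (le_of_lt ht)).differentiableAt.differentiableWithinAt
      · intro t ht; rw [interior_Ici] at ht
        have ht1 : R1 < t := ht
        have ht0 : 0 < t := by linarith
        rw [(hd2 t ht1.le).deriv]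
        have hn : ‖(t:ℂ) * w‖ = t := by rw [norm_mul, hw, Complex.norm_real, Real.norm_of_nonneg ht0.le, mul_one]
        have h1 := hza (t * w) (by rw [hn]; exact ht1.le)
        have h2 : t * (af ρ v (t * w) * w).re ≤ 1/4 := by
          have e : t * (af ρ v (t * w) * w).re = ((t * w : ℂ) * af ρ v (t * w)).re := by
            rw [← Complex.re_ofReal_mul]; congr 1; ring
          rw [e]; exact (Complex.re_le_norm _).trans h1
        have h3 : (af ρ v (t * w) * w).re ≤ 1/4 * t⁻¹ := by
          rw [← div_eq_mul_inv, le_div_iff₀ ht0]; linarith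
        linarith
    have h4 := hanti (Set.mem_Ici.2 le_rfl) (Set.mem_Ici.2 hz) hz
    simp only [← hzw] at h4
    have h5 := hC0 (R1 * w) (by simp [hw]; rw [abs_of_nonneg (by linarith)])
    have h6 := (Real.le_norm_self _).trans h5
    have h7 := Real.log_nonneg hR1
    linarith
  refine ⟨C1 * (1 + R1) ^ (7/2:ℝ) + 4 * Real.exp C0, fun z => ?_⟩
  have hr : 0 < 1 + ‖z‖ := by positivity
  have hp : 0 < (1 + ‖z‖) ^ (-(7/2:ℝ)) := by positivity
  by_cases hz : ‖z‖ ≤ R1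
  · have h1 := (Real.le_norm_self _).trans (hC1 z (by simpa using hz))
    have h2 : 1 ≤ (1 + R1) ^ (7/2:ℝ) * (1 + ‖z‖) ^ (-(7/2:ℝ)) := by
      rw [Real.rpow_neg hr.le, ← div_eq_mul_inv, one_le_div (by positivity)]
      exact Real.rpow_le_rpow hr.le (by linarith) (by norm_num)
    have h3 : 0 ≤ 4 * Real.exp C0 * (1 + ‖z‖) ^ (-(7/2:ℝ)) := by positivity
    nlinarith
  · push Not at hz
    have z0 : 0 < ‖z‖ := by linarith
    have h1 := hout z hz.le
    have h2 : Real.exp (uf ρ v z) ≤ Real.exp C0 * (1 + ‖z‖) ^ (1/2:ℝ) := by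
      calc Real.exp (uf ρ v z) ≤ Real.exp (C0 + 1/2 * Real.log ‖z‖) := Real.exp_le_exp.2 h1
        _ = Real.exp C0 * ‖z‖ ^ (1/2:ℝ) := by rw [Real.exp_add, Real.rpow_def_of_pos z0, mul_comm (1/2)]
        _ ≤ _ := by gcongr; linarith
    have h3 : ((1 + ‖z‖ ^ 2) ^ 2)⁻¹ ≤ 4 * (1 + ‖z‖) ^ (-(4:ℝ)) := by
      rw [Real.rpow_neg hr.le, show (4:ℝ) = ((4:ℕ):ℝ) by norm_num, Real.rpow_natCast]
      rw [← div_eq_mul_inv, inv_le_comm₀ (by positivity) (by positivity), inv_div]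
      have : (1 + ‖z‖) ^ 2 ≤ 2 * (1 + ‖z‖ ^ 2) := by nlinarith [sq_nonneg (1 - ‖z‖)]
      have h4 : ((1 + ‖z‖) ^ 2) ^ 2 ≤ (2 * (1 + ‖z‖ ^ 2)) ^ 2 := by gcongr
      rw [div_le_iff₀ (by norm_num)]; norm_num; nlinarith
    rw [mu_eq_u]
    have e : (1 + ‖z‖) ^ (-(4:ℝ)) * (1 + ‖z‖) ^ (1/2:ℝ) = (1 + ‖z‖) ^ (-(7/2:ℝ)) := by
      rw [← Real.rpow_add hr]; norm_num
    calc _ ≤ (4 * (1 + ‖z‖) ^ (-(4:ℝ))) * (Real.exp C0 * (1 + ‖z‖) ^ (1/2:ℝ)) := by gcongr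
      _ = 4 * Real.exp C0 * (1 + ‖z‖) ^ (-(7/2:ℝ)) := by rw [← e]; ring
      _ ≤ _ := by
        have : 0 ≤ C1 * (1 + R1) ^ (7/2:ℝ) := by positivity
        gcongr; linarith

end RS

namespace RS
open Complex (I)
open scoped ComplexConjugate ContDiff

lemma strip {F : ℂ → ℂ} (hF : Continuous F) (k : ℕ) {s C : ℝ}
    (h : ∀ z, ‖z ^ k * F z‖ ≤ C * (1 + ‖z‖) ^ (-s)) :
    ∃ C' : ℝ, 0 ≤ C' ∧ ∀ z, ‖F z‖ ≤ C' * (1 + ‖z‖) ^ (-(s + k)) := by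
  have hc : Continuous (fun z => ‖F z‖ * (1 + ‖z‖) ^ (s + k)) :=
    hF.norm.mul ((by fun_prop : Continuous fun z : ℂ => 1 + ‖z‖).rpow_const
      (fun z => Or.inl (by positivity)))
  obtain ⟨C1, hC1⟩ := (isCompact_closedBall (0:ℂ) 1).exists_bound_of_continuousOn hc.continuousOn
  have hC : 0 ≤ C := by
    have := (norm_nonneg _).trans (h 0)
    simpa using this
  have hC1' : 0 ≤ C1 := (norm_nonneg _).trans (hC1 0 (by simp))
  refine ⟨C1 + C * 2 ^ k, by positivity, fun z => ?_⟩
  have hr : 0 < 1 + ‖z‖ := by positivity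
  have key : ‖F z‖ * (1 + ‖z‖) ^ (s + k) ≤ C1 + C * 2 ^ k := by
    by_cases hz : ‖z‖ ≤ 1
    · have h1 := (Real.le_norm_self _).trans (hC1 z (by simpa using hz))
      have : 0 ≤ C * 2 ^ k := by positivity
      linarith
    · push Not at hz
      have h1 := h z
      rw [norm_mul, norm_pow] at h1
      have h2 : (1 + ‖z‖) ^ k ≤ 2 ^ k * ‖z‖ ^ k := by
        rw [← mul_pow]; gcongr; linarith
      have e : (1 + ‖z‖) ^ (-s) * (1 + ‖z‖) ^ s = 1 := by
        rw [← Real.rpow_add hr]; simp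
      have hs : 0 < (1 + ‖z‖) ^ s := by positivity
      calc ‖F z‖ * (1 + ‖z‖) ^ (s + k) = ‖F z‖ * (1 + ‖z‖) ^ k * (1 + ‖z‖) ^ s := by
            rw [Real.rpow_add hr, Real.rpow_natCast]; ring
        _ ≤ ‖F z‖ * (2 ^ k * ‖z‖ ^ k) * (1 + ‖z‖) ^ s := by gcongr
        _ = 2 ^ k * (‖z‖ ^ k * ‖F z‖) * (1 + ‖z‖) ^ s := by ring
        _ ≤ 2 ^ k * (C * (1 + ‖z‖) ^ (-s)) * (1 + ‖z‖) ^ s := by gcongr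
        _ = C * 2 ^ k * ((1 + ‖z‖) ^ (-s) * (1 + ‖z‖) ^ s) := by ring
        _ ≤ _ := by rw [e]; linarith
  rw [Real.rpow_neg hr.le, ← div_eq_mul_inv, le_div_iff₀ (by positivity)]
  exact key

lemma Ninv_le (z : ℂ) : ‖(Nc z)⁻¹‖ ≤ 2 * (1 + ‖z‖) ^ (-(2:ℝ)) := by
  have hr : 0 < 1 + ‖z‖ := by positivity
  rw [norm_inv, Nc_eq, Complex.norm_real, Real.norm_of_nonneg (N_pos z).le, Real.rpow_neg hr.le,
    Real.rpow_two, ← div_eq_mul_inv, inv_le_comm₀ (N_pos z) (by positivity), inv_div,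
    div_le_iff₀ (by norm_num)]
  nlinarith [sq_nonneg (1 - ‖z‖)]

lemma rp_le (z : ℂ) {s t : ℝ} (h : s ≤ t) : (1 + ‖z‖) ^ s ≤ (1 + ‖z‖) ^ t :=
  Real.rpow_le_rpow_of_exponent_le (by linarith [norm_nonneg z]) h

lemma rp_mul (z : ℂ) (s t : ℝ) : (1 + ‖z‖) ^ s * (1 + ‖z‖) ^ t = (1 + ‖z‖) ^ (s + t) :=
  (Real.rpow_add (by positivity) _ _).symm

lemma rp_pow (z : ℂ) (k : ℕ) : ‖z‖ ^ k ≤ (1 + ‖z‖) ^ (k : ℝ) := by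
  rw [Real.rpow_natCast]; gcongr; linarith

lemma Sol.xmu_le {ρ : ℝ} {v : ℂ → ℝ} {C s : ℝ} (hm : ∀ z, mu ρ v z ≤ C * (1 + ‖z‖) ^ (-s)) (k : ℕ) (x : ℂ) :
    ‖x ^ k * (mu ρ v x : ℂ)‖ ≤ C * (1 + ‖x‖) ^ (-(s - k)) := by
  have hmp := mu_pos ρ v x
  rw [norm_mul, norm_pow, Complex.norm_real, Real.norm_of_nonneg hmp.le]
  calc _ ≤ (1 + ‖x‖) ^ (k:ℝ) * (C * (1 + ‖x‖) ^ (-s)) := mul_le_mul (rp_pow x k) (hm x) hmp.le (by positivity)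
    _ = C * ((1 + ‖x‖) ^ (k:ℝ) * (1 + ‖x‖) ^ (-s)) := by ring
    _ = _ := by rw [rp_mul]; congr 2; ring

lemma Sol.af_cont {ρ : ℝ} {v : ℂ → ℝ} (h : Sol ρ v) : Continuous (af ρ v) :=
  (h.dzv_cd.add (contDiff_const.mul sf_cd)).continuous

lemma Sol.af_bd {ρ : ℝ} {v : ℂ → ℝ} (h : Sol ρ v) :
    ∃ C : ℝ, 0 ≤ C ∧ ∀ z : ℂ, ‖af ρ v z‖ ≤ C * (1 + ‖z‖) ^ (-(2:ℝ)) := by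
  obtain ⟨C, hC⟩ := h.mu_decay72
  obtain ⟨K, hK, hker⟩ := kern
  have hc : Continuous (fun x => x * (mu ρ v x : ℂ)) := continuous_id.mul (Complex.continuous_ofReal.comp h.mu_cont)
  have h1 := hker 1 (by norm_num) le_rfl _ C hc (fun x => by
    have := Sol.xmu_le hC 1 x
    rw [pow_one] at this; convert this using 3; norm_num)
  obtain ⟨C', h0, hC'⟩ := strip (s := 1) (C := 6 + 1 / (4 * π) * (K * C)) h.af_cont 1 (fun z => by
    rw [pow_one, (h.za z).2]
    refine (norm_sub_le _ _).trans ?_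
    have h2 := (h1 z).2
    have h3 : ‖(1 / (4 * (π:ℂ))) * ∫ x, x * (mu ρ v x : ℂ) / (z - x)‖ ≤ 1 / (4 * π) * (K * C * (1 + ‖z‖) ^ (-(1:ℝ))) := by
      rw [norm_mul, norm_div, norm_mul, Complex.norm_real, Real.norm_of_nonneg pi_pos.le, Complex.norm_ofNat, norm_one]
      gcongr
    have h4 : ‖-(2 * (ρ : ℂ)) * (Nc z)⁻¹‖ ≤ 3 * (2 * (1 + ‖z‖) ^ (-(1:ℝ))) := by
      rw [norm_mul, norm_neg, norm_mul, Complex.norm_real, Real.norm_of_nonneg (by linarith [h.h1]), Complex.norm_ofNat]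
      have := (Ninv_le z).trans (mul_le_mul_of_nonneg_left (rp_le z (show -(2:ℝ) ≤ -1 by norm_num)) (by norm_num))
      exact mul_le_mul (by linarith [h.h2]) this (norm_nonneg _) (by norm_num)
    linarith)
  refine ⟨C', h0, fun z => ?_⟩
  convert hC' z using 3; norm_num

lemma Sol.uf_bd {ρ : ℝ} {v : ℂ → ℝ} (h : Sol ρ v) :
    ∃ B : ℝ, ∀ z : ℂ, |uf ρ v z| ≤ B := by
  obtain ⟨C, hC0, hC⟩ := h.af_bd
  refine ⟨|uf ρ v 0| + 2 * C, fun z => ?_⟩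
  obtain ⟨w, hw, hzw⟩ := polar z
  have hb : ∀ t : ℝ, 0 ≤ t → |2 * (af ρ v (t * w) * w).re| ≤ 2 * C * ((1 + t) ^ 2)⁻¹ := by
    intro t ht
    have hn : ‖(t:ℂ) * w‖ = t := by rw [norm_mul, hw, Complex.norm_real, Real.norm_of_nonneg ht, mul_one]
    have h1 := hC (t * w)
    rw [hn, Real.rpow_neg (by linarith), Real.rpow_two] at h1
    have h2 := Complex.abs_re_le_norm (af ρ v (t * w) * w)
    rw [norm_mul, hw, mul_one] at h2
    rw [abs_mul, abs_two]; linarith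
  have hi : ∀ t : ℝ, 0 ≤ t → HasDerivAt (fun t : ℝ => 2 * C * (1 + t)⁻¹) (-(2 * C * ((1 + t) ^ 2)⁻¹)) t := by
    intro t ht
    have := (((hasDerivAt_id t).const_add 1).fun_inv (by simp; linarith)).const_mul (2 * C)
    have e : -(2 * C * ((1 + t) ^ 2)⁻¹) = 2 * C * (-1 / (1 + id t) ^ 2) := by simp; ring
    rw [e]; exact this
  have hanti : AntitoneOn (fun t : ℝ => uf ρ v (t * w) + 2 * C * (1 + t)⁻¹) (Set.Ici 0) := by
    have hd := fun t (ht : (0:ℝ) ≤ t) => (uf_ray ρ h.cd1 w t).add (hi t ht)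
    apply antitoneOn_of_deriv_nonpos (convex_Ici 0)
    · intro t ht; exact (hd t ht).continuousAt.continuousWithinAt
    · intro t ht; rw [interior_Ici] at ht
      exact (hd t (le_of_lt ht)).differentiableAt.differentiableWithinAt
    · intro t ht; rw [interior_Ici] at ht
      have := (hd t (le_of_lt ht)).deriv
      simp only [Pi.add_def] at this
      rw [this]
      linarith [(abs_le.1 (hb t (le_of_lt ht))).2]
  have hmono : MonotoneOn (fun t : ℝ => uf ρ v (t * w) - 2 * C * (1 + t)⁻¹) (Set.Ici 0) := by
    have hd := fun t (ht : (0:ℝ) ≤ t) => (uf_ray ρ h.cd1 w t).sub (hi t ht)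
    apply monotoneOn_of_deriv_nonneg (convex_Ici 0)
    · intro t ht; exact (hd t ht).continuousAt.continuousWithinAt
    · intro t ht; rw [interior_Ici] at ht
      exact (hd t (le_of_lt ht)).differentiableAt.differentiableWithinAt
    · intro t ht; rw [interior_Ici] at ht
      have := (hd t (le_of_lt ht)).deriv
      simp only [Pi.sub_def] at this
      rw [this]
      linarith [(abs_le.1 (hb t (le_of_lt ht))).1]
  have h1 := hanti (Set.mem_Ici.2 le_rfl) (Set.mem_Ici.2 (norm_nonneg z)) (norm_nonneg z)
  have h2 := hmono (Set.mem_Ici.2 le_rfl) (Set.mem_Ici.2 (norm_nonneg z)) (norm_nonneg z)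
  simp only [← hzw, Complex.ofReal_zero, zero_mul, add_zero, inv_one, mul_one] at h1 h2
  have h3 : 0 ≤ 2 * C * (1 + ‖z‖)⁻¹ := by positivity
  rw [abs_le]
  constructor <;> linarith [neg_abs_le (uf ρ v 0), le_abs_self (uf ρ v 0)]

lemma Sol.mu_decay4 {ρ : ℝ} {v : ℂ → ℝ} (h : Sol ρ v) :
    ∃ C : ℝ, ∀ z : ℂ, mu ρ v z ≤ C * (1 + ‖z‖) ^ (-(4:ℝ)) := by
  obtain ⟨B, hB⟩ := h.uf_bd
  refine ⟨4 * Real.exp B, fun z => ?_⟩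
  have hr : 0 < 1 + ‖z‖ := by positivity
  have h3 : ((1 + ‖z‖ ^ 2) ^ 2)⁻¹ ≤ 4 * (1 + ‖z‖) ^ (-(4:ℝ)) := by
    have := Ninv_le z
    rw [norm_inv, Nc_eq, Complex.norm_real, Real.norm_of_nonneg (N_pos z).le] at this
    calc ((1 + ‖z‖ ^ 2) ^ 2)⁻¹ = ((1 + ‖z‖ ^ 2)⁻¹) ^ 2 := by rw [inv_pow]
      _ ≤ (2 * (1 + ‖z‖) ^ (-(2:ℝ))) ^ 2 := by gcongr
      _ = 4 * ((1 + ‖z‖) ^ (-(2:ℝ)) * (1 + ‖z‖) ^ (-(2:ℝ))) := by ring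
      _ = _ := by rw [rp_mul]; norm_num
  rw [mu_eq_u]
  have := Real.exp_le_exp.2 ((le_abs_self _).trans (hB z))
  calc _ ≤ (4 * (1 + ‖z‖) ^ (-(4:ℝ))) * Real.exp B := by gcongr
    _ = _ := by ring

lemma Sol.cd_step {ρ : ℝ} {v : ℂ → ℝ} (h : Sol ρ v) {n : ℕ∞} (hn : ContDiff ℝ n v) : ContDiff ℝ (n + 1) v := by
  have h1 : ContDiff ℝ n (dzb (dz (cx v))) := by
    have : dzb (dz (cx v)) = cx (fun z => -(1/4) * mu ρ v z) := by
      ext z; rw [h.pde z]; rfl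
    rw [this]; exact cx_cd (contDiff_const.mul (mu_cd ρ hn))
  have h2 := regularity h.dzv_cd h1
  rw [contDiff_succ_iff_fderiv_apply]
  refine ⟨h.cd.differentiable (by norm_num), by simp, fun y => ?_⟩
  have : (fun x => fderiv ℝ v x y) = fun x => 2 * Complex.reCLM (dz (cx v) x * y) := by
    ext x; exact fderiv_real_eq h.cd1 x y
  rw [this]
  exact contDiff_const.mul (Complex.reCLM.contDiff.comp (h2.mul contDiff_const))

lemma Sol.cd4 {ρ : ℝ} {v : ℂ → ℝ} (h : Sol ρ v) : ContDiff ℝ 4 v := by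
  have h3 := h.cd_step (n := 2) h.cd
  have h4 := h.cd_step (n := 3) (by convert h3 using 1; norm_num)
  convert h4 using 1; norm_num

lemma Sol.af_cd {ρ : ℝ} {v : ℂ → ℝ} (h : Sol ρ v) : ContDiff ℝ 3 (af ρ v) := by
  refine ContDiff.add ?_ (contDiff_const.mul sf_cd)
  exact contDiff_dz (n := 3) (by convert cx_cd h.cd4 using 1; norm_num)

end RS

namespace RS
open Complex (I)
open scoped ComplexConjugate ContDiff

lemma dz_dzb_comm {g : ℂ → ℂ} (hg : ContDiff ℝ 2 g) (z : ℂ) : dzb (dz g) z = dz (dzb g) z := by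
  have hf : Differentiable ℝ (fderiv ℝ g) :=
    (hg.fderiv_right (m := 1) (by norm_num)).differentiable (by norm_num)
  have hd : ∀ e w : ℂ, HasFDerivAt (fun x => fderiv ℝ g x e) ((fderiv ℝ (fderiv ℝ g) z).flip e) z := by
    intro e w
    have := (hf z).hasFDerivAt.clm_apply (hasFDerivAt_const e z)
    convert! this using 1
    ext x; simp
  have hs : fderiv ℝ (fderiv ℝ g) z I 1 = fderiv ℝ (fderiv ℝ g) z 1 I :=
    (hg.contDiffAt.isSymmSndFDerivAt (by simp)) I 1
  have h1 : HasFDerivAt (dz g) ((1/2 : ℂ) • ((fderiv ℝ (fderiv ℝ g) z).flip 1 - I • (fderiv ℝ (fderiv ℝ g) z).flip I)) z := by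
    have := ((hd 1 1).sub ((hd I 1).const_smul I)).const_smul (1/2 : ℂ)
    refine this.congr_of_eventuallyEq (Filter.Eventually.of_forall fun x => ?_)
    simp [dz]; ring
  have h2 : HasFDerivAt (dzb g) ((1/2 : ℂ) • ((fderiv ℝ (fderiv ℝ g) z).flip 1 + I • (fderiv ℝ (fderiv ℝ g) z).flip I)) z := by
    have := ((hd 1 1).add ((hd I 1).const_smul I)).const_smul (1/2 : ℂ)
    refine this.congr_of_eventuallyEq (Filter.Eventually.of_forall fun x => ?_)
    simp [dzb]; ring
  have e1 : dzb (dz g) z = (fderiv ℝ (dz g) z 1 + I * fderiv ℝ (dz g) z I) / 2 := rfl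
  have e2 : dz (dzb g) z = (fderiv ℝ (dzb g) z 1 - I * fderiv ℝ (dzb g) z I) / 2 := rfl
  rw [e1, e2, h1.fderiv, h2.fderiv]
  simp [hs]; ring

/-- `∂̄ a`. -/
noncomputable def mf (ρ : ℝ) (v : ℂ → ℝ) (z : ℂ) : ℂ := -(1/4) * (mu ρ v z : ℂ) + 2 * ρ * (Nc z)⁻¹ ^ 2

noncomputable def qf (ρ : ℝ) (v : ℂ → ℝ) (z : ℂ) : ℂ :=
  dz (af ρ v) z + 2 * sf z * af ρ v z - 1/2 * (af ρ v z * af ρ v z)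

lemma Sol.af_cd1 {ρ : ℝ} {v : ℂ → ℝ} (h : Sol ρ v) : ContDiff ℝ 1 (af ρ v) :=
  h.af_cd.of_le (by norm_num)

lemma Sol.af_dzb {ρ : ℝ} {v : ℂ → ℝ} (h : Sol ρ v) (z : ℂ) : dzb (af ρ v) z = mf ρ v z := by
  have := (cd_hasW h.dzv_cd z).add ((hasW_sf z).const_mul (2 * ρ))
  have e := this.dzb
  unfold af
  rw [e, h.pde]; unfold mf; push_cast; ring

lemma Sol.af_hasW {ρ : ℝ} {v : ℂ → ℝ} (h : Sol ρ v) (z : ℂ) :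
    HasW (af ρ v) (dz (af ρ v) z) (mf ρ v z) z :=
  (cd_hasW h.af_cd1 z).congr rfl (h.af_dzb z)

lemma Sol.mf_dz {ρ : ℝ} {v : ℂ → ℝ} (h : Sol ρ v) (z : ℂ) :
    dz (mf ρ v) z = -2 * sf z * mf ρ v z - 1/4 * (mu ρ v z : ℂ) * af ρ v z := by
  have h1 := (cx_mu_hasW ρ h.cd1 z).const_mul (-(1/4))
  have h2 := ((hasW_Nc z).inv (Nc_ne z))
  have h3 := (h2.mul h2).const_mul (2 * ρ)
  have h4 := ((h1.add h3).of_eq (g' := mf ρ v) (fun x => by unfold mf cx; ring)).dz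
  rw [h4]; unfold mf af sf
  have := Nc_ne z
  field_simp; ring

lemma Sol.qf_cd {ρ : ℝ} {v : ℂ → ℝ} (h : Sol ρ v) : ContDiff ℝ 2 (qf ρ v) := by
  have h2 : ContDiff ℝ 2 (af ρ v) := h.af_cd.of_le (by norm_num)
  have h1 : ContDiff ℝ 2 (dz (af ρ v)) := contDiff_dz (n := 2) (by convert h.af_cd using 1; norm_num)
  exact (h1.add ((contDiff_const.mul sf_cd).mul h2)).sub (contDiff_const.mul (h2.mul h2))

lemma Sol.qf_dzb {ρ : ℝ} {v : ℂ → ℝ} (h : Sol ρ v) (z : ℂ) :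
    dzb (qf ρ v) z = -(2 * (ρ - 1)) * ((Nc z)⁻¹ ^ 2 * af ρ v z) := by
  have h2 : ContDiff ℝ 2 (af ρ v) := h.af_cd.of_le (by norm_num)
  have h1 : ContDiff ℝ 1 (dz (af ρ v)) := contDiff_dz (n := 1) (by convert h2 using 1; norm_num)
  have ha := h.af_hasW z
  have hz := ((cd_hasW h1 z).add (((hasW_sf z).const_mul 2).mul ha)).sub ((ha.mul ha).const_mul (1/2))
  have e : dzb (dz (af ρ v)) z = dz (mf ρ v) z := by
    rw [dz_dzb_comm h2]; congr 1; ext x; exact h.af_dzb x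
  have := hz.dzb
  unfold qf
  rw [this, e, h.mf_dz]
  unfold mf; ring

lemma err1 {h : ℂ → ℂ} (hh : ContDiff ℝ 1 h) {C : ℝ} (hb : ∀ x, ‖h x‖ ≤ C * (1 + ‖x‖) ^ (1/2:ℝ)) (z : ℂ) :
    Filter.Tendsto (fun t : ℝ => ∫ y, kap y * dz h (z + t * y)) Filter.atTop (nhds 0) := by
  have hk1 : ContDiff ℝ 1 kap := kap_cd.of_le (by norm_num)
  have hC : 0 ≤ C := by
    have := (norm_nonneg _).trans (hb 0); simpa using this
  have hi : Integrable (fun y => ‖dz kap y‖) :=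
    ((continuous_dz hk1).integrable_of_hasCompactSupport (hcs_dz kap_hcs)).norm
  set M := ∫ y, ‖dz kap y‖ with hM
  have hlim : Filter.Tendsto (fun t : ℝ => M * (C * 2) * t ^ (-(1/2:ℝ))) Filter.atTop (nhds 0) := by
    simpa using (tendsto_rpow_neg_atTop (show (0:ℝ) < 1/2 by norm_num)).const_mul (M * (C * 2))
  refine squeeze_zero_norm' ?_ hlim
  filter_upwards [Filter.eventually_ge_atTop (1 + ‖z‖)] with t ht
  have ht0 : 0 < t := by linarith [norm_nonneg z]
  have e := err_ibp hh z t
  have h1 : ‖∫ y, dz kap y * h (z + t * y)‖ ≤ M * (C * 2 * t ^ (1/2:ℝ)) := by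
    rw [hM, ← integral_mul_const]
    refine norm_integral_le_of_norm_le (hi.mul_const _) (Filter.Eventually.of_forall fun y => ?_)
    rw [norm_mul]
    by_cases hy : 1 < ‖y‖
    · rw [dz_kap_zero_of hy]; simp
    · push Not at hy
      refine mul_le_mul_of_nonneg_left ?_ (norm_nonneg _)
      refine (hb _).trans ?_
      rw [mul_assoc]
      refine mul_le_mul_of_nonneg_left ?_ hC
      have h3 : 1 + ‖z + t * y‖ ≤ 4 * t := by
        have := norm_add_le z (t * y)
        rw [norm_mul, Complex.norm_real, Real.norm_of_nonneg ht0.le] at this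
        nlinarith
      calc (1 + ‖z + t * y‖) ^ (1/2:ℝ) ≤ (4 * t) ^ (1/2:ℝ) :=
            Real.rpow_le_rpow (by positivity) h3 (by norm_num)
        _ = _ := by
          rw [Real.mul_rpow (by norm_num) ht0.le, show (4:ℝ) = 2 ^ (2:ℝ) by norm_num, ← Real.rpow_mul (by norm_num)]
          norm_num
  have h2 : t * ‖∫ y, kap y * dz h (z + t * y)‖ ≤ M * (C * 2 * t ^ (1/2:ℝ)) := by
    have : t * ‖∫ y, kap y * dz h (z + t * y)‖ = ‖(t:ℂ) * ∫ y, kap y * dz h (z + t * y)‖ := by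
      rw [norm_mul, Complex.norm_real, Real.norm_of_nonneg ht0.le]
    rw [this, e, norm_neg]; exact h1
  have e2 : t ^ (1/2:ℝ) = t * t ^ (-(1/2:ℝ)) := by
    nth_rewrite 2 [← Real.rpow_one t]
    rw [← Real.rpow_add ht0]; norm_num
  rw [e2] at h2
  have : t * ‖∫ y, kap y * dz h (z + t * y)‖ ≤ t * (M * (C * 2) * t ^ (-(1/2:ℝ))) := by linarith
  exact le_of_mul_le_mul_left this ht0

lemma err2 {R : ℂ → ℂ} (hR : Continuous R) {C : ℝ} (hb : ∀ x, ‖R x‖ ≤ C * (1 + ‖x‖) ^ (-(1/2:ℝ))) (z : ℂ) :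
    Filter.Tendsto (fun t : ℝ => ∫ y, kap y * R (z + t * y)) Filter.atTop (nhds 0) := by
  have hC : 0 ≤ C := by
    have := (norm_nonneg _).trans (hb 0); simpa using this
  have hk := kap_cd.continuous
  have hi : Integrable (fun y => ‖kap y‖) := (hk.integrable_of_hasCompactSupport kap_hcs).norm
  have := tendsto_integral_filter_of_dominated_convergence (μ := volume) (l := Filter.atTop)
    (F := fun (t : ℝ) y => kap y * R (z + t * y)) (f := fun _ => 0) (fun y => ‖kap y‖ * C)
    (Filter.Eventually.of_forall fun t => (hk.mul (hR.comp (by fun_prop))).aestronglyMeasurable)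
    (Filter.Eventually.of_forall fun t => Filter.Eventually.of_forall fun y => by
      rw [norm_mul]
      refine mul_le_mul_of_nonneg_left ((hb _).trans ?_) (norm_nonneg _)
      have : (1 + ‖z + t * y‖) ^ (-(1/2:ℝ)) ≤ 1 := Real.rpow_le_one_of_one_le_of_nonpos (by linarith [norm_nonneg (z + t * y)]) (by norm_num)
      nlinarith)
    (hi.mul_const C)
    (by
      filter_upwards [ae_ne 0] with y hy
      have hy0 : 0 < ‖y‖ := norm_pos_iff.2 hy
      have hl : Filter.Tendsto (fun t : ℝ => ‖kap y‖ * (C * (t * ‖y‖ + -‖z‖) ^ (-(1/2:ℝ)))) Filter.atTop (nhds 0) := by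
        have h1 : Filter.Tendsto (fun t : ℝ => t * ‖y‖ + -‖z‖) Filter.atTop Filter.atTop :=
          Filter.tendsto_atTop_add_const_right _ _ (Filter.Tendsto.atTop_mul_const hy0 Filter.tendsto_id)
        have := (((tendsto_rpow_neg_atTop (show (0:ℝ) < 1/2 by norm_num)).comp h1).const_mul C).const_mul ‖kap y‖
        simpa using this
      refine squeeze_zero_norm' ?_ hl
      have : ∀ᶠ t : ℝ in Filter.atTop, 0 < t * ‖y‖ + -‖z‖ :=
        (Filter.tendsto_atTop_add_const_right _ _ (Filter.Tendsto.atTop_mul_const hy0 Filter.tendsto_id)).eventually (Filter.eventually_gt_atTop (0:ℝ))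
      filter_upwards [this, Filter.eventually_gt_atTop (0:ℝ)] with t ht ht0
      rw [norm_mul]
      refine mul_le_mul_of_nonneg_left ((hb _).trans (mul_le_mul_of_nonneg_left ?_ hC)) (norm_nonneg _)
      refine Real.rpow_le_rpow_of_nonpos ht ?_ (by norm_num)
      have h1 := norm_sub_norm_le ((t:ℂ) * y) (-z)
      rw [norm_mul, Complex.norm_real, Real.norm_of_nonneg ht0.le, norm_neg, sub_neg_eq_add, add_comm ((t:ℂ) * y)] at h1
      linarith)
  simpa using this

end RS

namespace RS
open Complex (I)
open scoped ComplexConjugate ContDiff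

lemma Sol.d_bd {ρ : ℝ} {v : ℂ → ℝ} (h : Sol ρ v) :
    ∃ (b : ℂ) (C : ℝ), ∀ z, ‖z ^ 2 * af ρ v z - b‖ ≤ C * (1 + ‖z‖) ^ (-(1/2:ℝ)) := by
  obtain ⟨C, hC⟩ := h.mu_decay4
  obtain ⟨C7, hC7⟩ := h.mu_decay72
  obtain ⟨K, hK, hker⟩ := kern
  have hmc : Continuous (fun x => (mu ρ v x : ℂ)) := Complex.continuous_ofReal.comp h.mu_cont
  have hc1 : Continuous (fun x => x * (mu ρ v x : ℂ)) := continuous_id.mul hmc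
  have hc2 : Continuous (fun x => x ^ 2 * (mu ρ v x : ℂ)) := (continuous_pow 2).mul hmc
  have i1 : Integrable (fun x => x * (mu ρ v x : ℂ)) := by
    refine (int_52.const_mul C7).mono' hc1.aestronglyMeasurable (Filter.Eventually.of_forall fun x => ?_)
    have := Sol.xmu_le hC7 1 x
    rw [pow_one] at this; convert this using 3; norm_num
  have h1 := hker (1/2) (by norm_num) (by norm_num) _ C hc2 (fun x => by
    have := Sol.xmu_le hC 2 x
    convert this using 3; norm_num)
  refine ⟨-(1 / (4 * π)) * ∫ x, x * (mu ρ v x : ℂ), 6 + 1 / (4 * π) * (K * C), fun z => ?_⟩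
  have i2 := (h1 z).1
  have e : (fun x => z * (x * (mu ρ v x : ℂ) / (z - x))) =ᵐ[volume]
      fun x => x * (mu ρ v x : ℂ) + x ^ 2 * (mu ρ v x : ℂ) / (z - x) := by
    filter_upwards [ae_ne z] with x hx
    have : z - x ≠ 0 := sub_ne_zero.2 hx.symm
    field_simp; ring
  have e2 : z * ∫ x, x * (mu ρ v x : ℂ) / (z - x) = (∫ x, x * (mu ρ v x : ℂ)) + ∫ x, x ^ 2 * (mu ρ v x : ℂ) / (z - x) := by
    rw [← integral_const_mul, integral_congr_ae e, integral_add i1 i2]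
  have e3 : z ^ 2 * af ρ v z - -(1 / (4 * π)) * ∫ x, x * (mu ρ v x : ℂ) =
      -(2 * ρ) * (z * (Nc z)⁻¹) - (1 / (4 * π)) * ∫ x, x ^ 2 * (mu ρ v x : ℂ) / (z - x) := by
    have : z ^ 2 * af ρ v z = z * (z * af ρ v z) := by ring
    rw [this, (h.za z).2]
    linear_combination (-(1 / (4 * π)) : ℂ) * e2
  rw [e3]
  refine (norm_sub_le _ _).trans ?_
  have h3 : ‖(1 / (4 * (π:ℂ))) * ∫ x, x ^ 2 * (mu ρ v x : ℂ) / (z - x)‖ ≤ 1 / (4 * π) * (K * C * (1 + ‖z‖) ^ (-(1/2:ℝ))) := by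
    rw [norm_mul, norm_div, norm_mul, Complex.norm_real, Real.norm_of_nonneg pi_pos.le, Complex.norm_ofNat, norm_one]
    have := (h1 z).2
    gcongr
  have h4 : ‖-(2 * (ρ : ℂ)) * (z * (Nc z)⁻¹)‖ ≤ 3 * (2 * (1 + ‖z‖) ^ (-(1/2:ℝ))) := by
    rw [norm_mul, norm_neg, norm_mul, Complex.norm_real, Real.norm_of_nonneg (by linarith [h.h1]), Complex.norm_ofNat]
    refine mul_le_mul (by linarith [h.h2]) ?_ (norm_nonneg _) (by norm_num)
    rw [norm_mul]
    calc ‖z‖ * ‖(Nc z)⁻¹‖ ≤ (1 + ‖z‖) ^ (1:ℝ) * (2 * (1 + ‖z‖) ^ (-(2:ℝ))) := by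
          refine mul_le_mul ?_ (Ninv_le z) (norm_nonneg _) (by positivity)
          rw [Real.rpow_one]; linarith
      _ = 2 * ((1 + ‖z‖) ^ (1:ℝ) * (1 + ‖z‖) ^ (-(2:ℝ))) := by ring
      _ ≤ _ := by
        rw [rp_mul]
        exact mul_le_mul_of_nonneg_left (rp_le z (by norm_num)) (by norm_num)
  linarith

lemma nb_mul {F G : ℂ} {A B s t : ℝ} {z : ℂ} (hF : ‖F‖ ≤ A * (1 + ‖z‖) ^ s) (hG : ‖G‖ ≤ B * (1 + ‖z‖) ^ t)
     : ‖F * G‖ ≤ A * B * (1 + ‖z‖) ^ (s + t) := by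
  rw [norm_mul, ← rp_mul]
  calc _ ≤ (A * (1 + ‖z‖) ^ s) * (B * (1 + ‖z‖) ^ t) := mul_le_mul hF hG (norm_nonneg _) ((norm_nonneg _).trans hF)
    _ = _ := by ring

lemma nb_pow (k : ℕ) (z : ℂ) : ‖z ^ k‖ ≤ 1 * (1 + ‖z‖) ^ (k:ℝ) := by
  rw [norm_pow, one_mul]; exact rp_pow z k

lemma nb_le {F : ℂ} {A s t : ℝ} {z : ℂ} (hF : ‖F‖ ≤ A * (1 + ‖z‖) ^ s) (h : s ≤ t) : ‖F‖ ≤ A * (1 + ‖z‖) ^ t := by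
  have : 0 ≤ A := by
    have := (norm_nonneg _).trans hF
    exact nonneg_of_mul_nonneg_left this (by positivity)
  exact hF.trans (mul_le_mul_of_nonneg_left (rp_le z h) this)

lemma Sol.qf_bd {ρ : ℝ} {v : ℂ → ℝ} (h : Sol ρ v) :
    ∃ C : ℝ, 0 ≤ C ∧ ∀ z : ℂ, ‖qf ρ v z‖ ≤ C * (1 + ‖z‖) ^ (-(4:ℝ)) := by
  obtain ⟨b, C, hd⟩ := h.d_bd
  obtain ⟨A, hA0, hA⟩ := h.af_bd
  obtain ⟨K, hK, hker⟩ := kern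
  set G : ℂ → ℂ := fun z => z * (z ^ 2 * af ρ v z - b) with hG
  set R : ℂ → ℂ := fun z => -(z ^ 2 * af ρ v z - b) - 2 * (z ^ 2 * af ρ v z * (Nc z)⁻¹) - 1/2 * (z ^ 3 * (af ρ v z * af ρ v z)) with hR
  set g : ℂ → ℂ := fun z => z ^ 3 * qf ρ v z with hg
  have hcd := h.af_cd1
  have Gcd : ContDiff ℝ 1 G := contDiff_id.mul (((contDiff_id.pow 2).mul hcd).sub contDiff_const)
  have Ncd : Continuous Nc := by unfold Nc; exact continuous_const.add (continuous_id.mul Complex.continuous_conj)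
  have Nic : Continuous (fun z => (Nc z)⁻¹) := Ncd.inv₀ Nc_ne
  have Rc : Continuous R := by
    have := hcd.continuous
    simp only [hR]; fun_prop
  have gcd : ContDiff ℝ 1 g := (contDiff_id.pow 3).mul (h.qf_cd.of_le (by norm_num))
  have hdec : ∀ z, g z = dz G z + R z := by
    intro z
    have ha := h.af_hasW z
    have hi := hasW_id z
    have h1 := (hi.mul (((hi.mul hi).mul ha).sub (hasW_const b z))).of_eq (g' := G) (fun x => by simp only [hG]; ring)
    rw [h1.dz]
    simp only [hg, hR, qf]
    have := z_sf z
    linear_combination 2 * z ^ 2 * af ρ v z * this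
  have Gb : ∀ z, ‖G z‖ ≤ C * (1 + ‖z‖) ^ (1/2:ℝ) := by
    intro z
    have := nb_mul (nb_pow 1 z) (hd z)
    simp only [pow_one] at this
    convert this using 2
    · ring
    · norm_num
  have Rb : ∀ z, ‖R z‖ ≤ (C + 2 * (A * 2) + 1/2 * (A * A)) * (1 + ‖z‖) ^ (-(1/2:ℝ)) := by
    intro z
    have h1 := hd z
    have h2 := nb_mul (nb_mul (nb_pow 2 z) (hA z)) (Ninv_le z)
    have h3 := nb_mul (nb_pow 3 z) (nb_mul (hA z) (hA z))
    have h2' := nb_le h2 (t := -(1/2)) (by norm_num)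
    have h3' := nb_le h3 (t := -(1/2)) (by norm_num)
    simp only [hR]
    refine (norm_sub_le _ _).trans ?_
    have h4 := norm_sub_le (-(z ^ 2 * af ρ v z - b)) (2 * (z ^ 2 * af ρ v z * (Nc z)⁻¹))
    rw [norm_neg, norm_mul 2, Complex.norm_ofNat] at h4
    rw [norm_mul (1/2), norm_div, norm_one, Complex.norm_ofNat]
    linarith
  have gdb : ∀ z, dzb g z = z ^ 3 * (-(2 * (ρ - 1)) * ((Nc z)⁻¹ ^ 2 * af ρ v z)) := by
    intro z
    have hi := hasW_id z
    have hq := cd_hasW (h.qf_cd.of_le (by norm_num)) z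
    have h1 := (((hi.mul hi).mul hi).mul hq).of_eq (g' := g) (fun x => by simp only [hg]; ring)
    rw [h1.dzb, h.qf_dzb]; ring
  have gdbb : ∀ z, ‖dzb g z‖ ≤ (4 * A) * (1 + ‖z‖) ^ (-(3/2 + (1:ℝ))) := by
    intro z
    have h1 := nb_mul (Ninv_le z) (Ninv_le z)
    have h2 := nb_mul h1 (hA z)
    have h3 := nb_mul (nb_pow 3 z) h2
    have h4 := nb_le h3 (t := -(3/2 + (1:ℝ))) (by norm_num)
    have e : dzb g z = -(2 * (ρ - 1)) * (z ^ 3 * ((Nc z)⁻¹ * (Nc z)⁻¹ * af ρ v z)) := by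
      rw [gdb]; ring
    have h5 : ‖(-(2 * (ρ - 1)) : ℂ)‖ ≤ 1 := by
      rw [norm_neg, show (2 * ((ρ:ℂ) - 1)) = ((2 * (ρ - 1) : ℝ) : ℂ) by push_cast; ring, Complex.norm_real, Real.norm_of_nonneg (by linarith [h.h1])]
      linarith [h.h2]
    rw [e, norm_mul]
    calc _ ≤ 1 * (1 * (2 * 2 * A) * (1 + ‖z‖) ^ (-(3/2 + (1:ℝ)))) := mul_le_mul h5 h4 (norm_nonneg _) (by norm_num)
      _ = _ := by ring
  have hk := hker 1 (by norm_num) le_rfl _ _ (continuous_dzb gcd) gdbb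
  have gb : ∀ z, ‖z ^ 3 * qf ρ v z‖ ≤ 1 / π * (K * (4 * A)) * (1 + ‖z‖) ^ (-(1:ℝ)) := by
    intro z
    have herr : Filter.Tendsto (fun t : ℝ => ∫ y, kap y * g (z + t * y)) Filter.atTop (nhds 0) := by
      have h1 := (err1 Gcd Gb z).add (err2 Rc Rb z)
      rw [add_zero] at h1
      refine h1.congr (fun t => ?_)
      have hkc := kap_cd.continuous
      have hGc := continuous_dz Gcd
      rw [← integral_add]
      · congr 1; ext y; rw [hdec]; ring
      · exact (hkc.mul (hGc.comp (by fun_prop))).integrable_of_hasCompactSupport kap_hcs.mul_right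
      · exact (hkc.mul (Rc.comp (by fun_prop))).integrable_of_hasCompactSupport kap_hcs.mul_right
    have h2 := px_lim gcd z (hk z).1 herr
    have h3 := (hk z).2
    rw [← h2, norm_mul, Complex.norm_real, Real.norm_of_nonneg pi_pos.le] at h3
    have e : 1 / π * (K * (4 * A)) * (1 + ‖z‖) ^ (-(1:ℝ)) = (K * (4 * A) * (1 + ‖z‖) ^ (-(1:ℝ))) / π := by ring
    rw [e, le_div_iff₀ pi_pos, mul_comm]
    exact h3
  obtain ⟨C', h0, hC'⟩ := strip h.qf_cd.continuous 3 gb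
  refine ⟨C', h0, fun z => ?_⟩
  convert hC' z using 3; norm_num

end RS

namespace RS
open Complex (I)
open scoped ComplexConjugate ContDiff

noncomputable def ff (ρ : ℝ) (v : ℂ → ℝ) (z : ℂ) : ℝ := Real.exp (-(1/2) * uf ρ v z)

lemma ff_pos (ρ : ℝ) (v : ℂ → ℝ) (z : ℂ) : 0 < ff ρ v z := Real.exp_pos _

lemma Sol.ff_cd {ρ : ℝ} {v : ℂ → ℝ} (h : Sol ρ v) : ContDiff ℝ 2 (ff ρ v) :=
  Real.contDiff_exp.comp (contDiff_const.mul (uf_cd ρ h.cd))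

lemma Sol.ff_hasW {ρ : ℝ} {v : ℂ → ℝ} (h : Sol ρ v) (z : ℂ) :
    HasW (cx (ff ρ v)) (-(1/2) * af ρ v z * ff ρ v z) (-(1/2) * conj (af ρ v z) * ff ρ v z) z := by
  have h1 := uf_hasW ρ h.cd1 z
  have h2 : HasDerivAt (fun s : ℝ => Real.exp (-(1/2) * s)) (ff ρ v z * (-(1/2))) (uf ρ v z) := by
    have := ((hasDerivAt_id (uf ρ v z)).const_mul (-(1/2))).exp
    simpa [ff] using this
  refine (HasW.comp_real h2 h1).congr ?_ ?_ <;> push_cast <;> ring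

lemma Nc_cd {n : WithTop ℕ∞} : ContDiff ℝ n Nc := by
  have hcj : ContDiff ℝ n (fun x : ℂ => conj x) := Complex.conjCLE.contDiff
  exact contDiff_const.add (contDiff_id.mul hcj)

lemma conj_cd {n : WithTop ℕ∞} {g : ℂ → ℂ} (hg : ContDiff ℝ n g) : ContDiff ℝ n (fun x => conj (g x)) :=
  Complex.conjCLE.contDiff.comp hg

lemma mul_conj_norm (q : ℂ) : conj q * q = ((‖q‖ ^ 2 : ℝ) : ℂ) := by
  rw [mul_comm]; exact normsq_eq q

/-- first identity, as an inequality -/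
lemma Sol.ident1 {ρ : ℝ} {v : ℂ → ℝ} (h : Sol ρ v) {η : ℂ → ℝ} (hη : ContDiff ℝ 2 η) (hc : HasCompactSupport η) :
    2 * (ρ - 1) * (∫ z, η z ^ 2 * ‖af ρ v z‖ ^ 2 * ff ρ v z) ≤
      (∫ z, η z ^ 2 * ‖qf ρ v z‖ ^ 2 * (1 + ‖z‖ ^ 2) ^ 2 * ff ρ v z)
      + ∫ z, 2 * |η z| * ‖dz (cx η) z‖ * ‖qf ρ v z‖ * (1 + ‖z‖ ^ 2) ^ 2 * ‖af ρ v z‖ * ff ρ v z := by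
  have hη1 : ContDiff ℝ 1 η := hη.of_le (by norm_num)
  have hq1 : ContDiff ℝ 1 (qf ρ v) := h.qf_cd.of_le (by norm_num)
  have hf1 : ContDiff ℝ 1 (ff ρ v) := h.ff_cd.of_le (by norm_num)
  have ha1 := h.af_cd1
  have ηc := hη.continuous
  have ac := ha1.continuous
  have qc := hq1.continuous
  have fc := hf1.continuous
  have ec := continuous_dz (cx_cd hη1)
  have hcc : HasCompactSupport (cx η) := hc.comp_left (g := fun x : ℝ => (x : ℂ)) Complex.ofReal_zero
  set Φ : ℂ → ℂ := fun z => (cx η z * cx η z) * (conj (qf ρ v z) * ((Nc z * Nc z) * (af ρ v z * cx (ff ρ v) z))) with hΦ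
  have Φcd : ContDiff ℝ 1 Φ := ((cx_cd hη1).mul (cx_cd hη1)).mul ((conj_cd hq1).mul ((Nc_cd.mul Nc_cd).mul (ha1.mul (cx_cd hf1))))
  have Φcs : HasCompactSupport Φ := hcc.mul_right.mul_right
  set T : ℂ → ℂ := fun z => 2 * cx η z * dz (cx η) z * conj (qf ρ v z) * ((Nc z * Nc z) * (af ρ v z * cx (ff ρ v) z)) with hT
  set x : ℂ → ℝ := fun z => η z ^ 2 * ‖qf ρ v z‖ ^ 2 * (1 + ‖z‖ ^ 2) ^ 2 * ff ρ v z with hx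
  set y : ℂ → ℝ := fun z => η z ^ 2 * ‖af ρ v z‖ ^ 2 * ff ρ v z with hy
  set e1 : ℂ → ℝ := fun z => 2 * |η z| * ‖dz (cx η) z‖ * ‖qf ρ v z‖ * (1 + ‖z‖ ^ 2) ^ 2 * ‖af ρ v z‖ * ff ρ v z with he1
  have supp : ∀ {F : ℂ → ℝ}, Continuous F → (∀ z, η z = 0 → F z = 0) → Integrable F := by
    intro F hF h0
    refine hF.integrable_of_hasCompactSupport (hc.mono ?_)
    intro z hz hz'; exact hz (h0 z hz')
  have ix : Integrable x := supp (by simp only [hx]; fun_prop) (fun z hz => by simp [hx, hz])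
  have iy : Integrable y := supp (by simp only [hy]; fun_prop) (fun z hz => by simp [hy, hz])
  have ie : Integrable e1 := supp (by simp only [he1]; fun_prop) (fun z hz => by simp [he1, hz])
  have key : ∀ z, dz Φ z = T z + ((x z - 2 * (ρ - 1) * y z : ℝ) : ℂ) := by
    intro z
    have H1 := cd_hasW (cx_cd hη1) z
    have H2 := (cd_hasW hq1 z).conj
    have H3 := hasW_Nc z
    have H4 := h.af_hasW z
    have H5 := h.ff_hasW z
    have H := ((H1.mul H1).mul (H2.mul ((H3.mul H3).mul (H4.mul H5)))).dz
    rw [hΦ, H, h.qf_dzb]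
    have hN := Nc_ne z
    have n1 : conj (Nc z)⁻¹ = (Nc z)⁻¹ := by rw [map_inv₀, conj_Nc]
    simp only [map_mul, map_neg, map_sub, map_pow, n1, Complex.conj_ofReal, map_one, map_ofNat]
    simp only [hx, hy, hT]
    have e1 : ((‖qf ρ v z‖ ^ 2 : ℝ) : ℂ) = conj (qf ρ v z) * qf ρ v z := (mul_conj_norm _).symm
    have e2 : ((‖af ρ v z‖ ^ 2 : ℝ) : ℂ) = conj (af ρ v z) * af ρ v z := (mul_conj_norm _).symm
    have e3 : ((1 + ‖z‖ ^ 2 : ℝ) : ℂ) = Nc z := (Nc_eq z).symm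
    rw [Complex.ofReal_sub, Complex.ofReal_mul (2 * (ρ - 1)), Complex.ofReal_mul _ (ff ρ v z), Complex.ofReal_mul _ (ff ρ v z),
      Complex.ofReal_mul _ ((1 + ‖z‖ ^ 2) ^ 2), Complex.ofReal_pow (1 + ‖z‖ ^ 2), e3, Complex.ofReal_mul _ (‖qf ρ v z‖ ^ 2),
      Complex.ofReal_mul _ (‖af ρ v z‖ ^ 2), e1, e2]
    have e4 : qf ρ v z = dz (af ρ v) z + 2 * sf z * af ρ v z - 1/2 * (af ρ v z * af ρ v z) := rfl
    have e5 : sf z = conj z * (Nc z)⁻¹ := rfl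
    set Q := conj (qf ρ v z)
    rw [e4, e5]
    simp only [cx]
    push_cast
    field_simp
    ring
  have Tb : ∀ z, ‖T z‖ ≤ e1 z := by
    intro z
    simp only [hT, he1, cx, Nc_eq, norm_mul, Complex.norm_real, Complex.norm_ofNat, RCLike.norm_conj, Real.norm_of_nonneg (N_pos z).le,
      Real.norm_of_nonneg (ff_pos ρ v z).le, Real.norm_eq_abs]
    apply le_of_eq; ring
  have iΦ : ∫ z, dz Φ z = 0 := integral_dz Φcd Φcs
  have iT : Integrable T := ie.mono' (by
      have : Continuous T := by
        have := (cx_cd hη1).continuous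
        have := (cx_cd hf1).continuous
        have := (Nc_cd (n := 0)).continuous
        simp only [hT]; fun_prop
      exact this.aestronglyMeasurable) (Filter.Eventually.of_forall Tb)
  have ixy : Integrable (fun z => x z - 2 * (ρ - 1) * y z) := ix.sub (iy.const_mul _)
  have ixyc : Integrable (fun z => ((x z - 2 * (ρ - 1) * y z : ℝ) : ℂ)) := ixy.ofReal
  have h5 : (∫ z, T z) + ((∫ z, (x z - 2 * (ρ - 1) * y z) : ℝ) : ℂ) = 0 := by
    rw [← iΦ, ← integral_complex_ofReal, ← integral_add iT ixyc]
    congr 1; ext z; exact (key z).symm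
  have h6 : |∫ z, (x z - 2 * (ρ - 1) * y z)| ≤ ∫ z, e1 z := by
    rw [← Real.norm_eq_abs, ← Complex.norm_real, eq_neg_of_add_eq_zero_right h5, norm_neg]
    exact norm_integral_le_of_norm_le ie (Filter.Eventually.of_forall Tb)
  rw [integral_sub ix (iy.const_mul _), integral_const_mul] at h6
  linarith [(abs_le.1 h6).1]

end RS

namespace RS
open Complex (I)
open scoped ComplexConjugate ContDiff

lemma Sol.hormander {ρ : ℝ} {v : ℂ → ℝ} (h : Sol ρ v) {g : ℂ → ℂ} (hg : ContDiff ℝ 2 g) (hc : HasCompactSupport g) :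
    (4 - ρ) * (∫ z, ‖g z‖ ^ 2 * (1 + ‖z‖ ^ 2) ^ 2 * ff ρ v z) ≤
      ∫ z, ‖dzb g z‖ ^ 2 * ((1 + ‖z‖ ^ 2) ^ 4 * ff ρ v z) := by
  have hg1 : ContDiff ℝ 1 g := hg.of_le (by norm_num)
  have hf1 : ContDiff ℝ 1 (ff ρ v) := h.ff_cd.of_le (by norm_num)
  have ha1 := h.af_cd1
  have hdz : ContDiff ℝ 1 (dz g) := contDiff_dz (n := 1) (by convert hg using 1; norm_num)
  have hdzb : ContDiff ℝ 1 (dzb g) := contDiff_dzb (n := 1) (by convert hg using 1; norm_num)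
  set W : ℂ → ℂ := fun z => (Nc z * Nc z) * (Nc z * Nc z) * cx (ff ρ v) z with hW
  set om : ℂ → ℂ := fun z => 4 * sf z - 1/2 * af ρ v z with hom
  set D : ℂ → ℂ := fun z => dz g z + om z * g z with hD
  have Wcd : ContDiff ℝ 1 W := ((Nc_cd.mul Nc_cd).mul (Nc_cd.mul Nc_cd)).mul (cx_cd hf1)
  have omcd : ContDiff ℝ 1 om := (contDiff_const.mul sf_cd).sub (contDiff_const.mul ha1)
  have Dcd : ContDiff ℝ 1 D := hdz.add (omcd.mul hg1)
  have cgcd := conj_cd hg1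
  have hcg : HasCompactSupport (fun z => conj (g z)) := hc.comp_left (g := fun x : ℂ => conj x) (map_zero _)
  set P1 : ℂ → ℂ := fun z => conj (g z) * (dzb g z * W z) with hP1
  set P2 : ℂ → ℂ := fun z => conj (g z) * (D z * W z) with hP2
  have P1cd : ContDiff ℝ 1 P1 := cgcd.mul (hdzb.mul Wcd)
  have P2cd : ContDiff ℝ 1 P2 := cgcd.mul (Dcd.mul Wcd)
  have i1 := integral_dz P1cd hcg.mul_right
  have i2 := integral_dzb P2cd hcg.mul_right
  set A : ℂ → ℝ := fun z => ‖dzb g z‖ ^ 2 * ((1 + ‖z‖ ^ 2) ^ 4 * ff ρ v z) with hA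
  set B : ℂ → ℝ := fun z => ‖D z‖ ^ 2 * ((1 + ‖z‖ ^ 2) ^ 4 * ff ρ v z) with hB
  set E : ℂ → ℝ := fun z => ‖g z‖ ^ 2 * (1 + ‖z‖ ^ 2) ^ 2 * ff ρ v z with hE
  set M : ℂ → ℝ := fun z => ‖g z‖ ^ 2 * (mu ρ v z / 8) * ((1 + ‖z‖ ^ 2) ^ 4 * ff ρ v z) with hM
  have hW' : ∀ z, HasW W (om z * W z) (conj (om z) * W z) z := by
    intro z
    have H3 := hasW_Nc z
    have H5 := h.ff_hasW z
    have hN := Nc_ne z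
    have n1 : conj (Nc z)⁻¹ = (Nc z)⁻¹ := by rw [map_inv₀, conj_Nc]
    have e5 : sf z = conj z * (Nc z)⁻¹ := rfl
    refine (((H3.mul H3).mul (H3.mul H3)).mul H5).congr ?_ ?_
    · simp only [hom, hW, e5, cx]; field_simp; ring
    · simp only [hom, hW, e5, cx, map_sub, map_mul, n1, Complex.conj_conj, map_div₀, map_one, map_ofNat]; field_simp; ring
  have key : ∀ z, dz P1 z - dzb P2 z = ((A z - B z - ((4 - ρ) * E z + M z) : ℝ) : ℂ) := by
    intro z
    have Hg := cd_hasW hg1 z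
    have Hcg := Hg.conj
    have Hom : HasW om (dz om z) ((4 - ρ) * (Nc z)⁻¹ ^ 2 + mu ρ v z / 8) z := by
      refine (cd_hasW omcd z).congr rfl ?_
      rw [(((hasW_sf z).const_mul 4).sub ((h.af_hasW z).const_mul (1/2))).dzb]
      unfold mf; ring
    have HD := (cd_hasW hdz z).add (Hom.mul Hg)
    have H1 := (Hcg.mul ((cd_hasW hdzb z).mul (hW' z))).dz
    have H2 := (Hcg.mul (HD.mul (hW' z))).dzb
    rw [hP1, hP2, H1, H2, dz_dzb_comm hg]
    have hN := Nc_ne z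
    have eA : ((‖dzb g z‖ ^ 2 : ℝ) : ℂ) = conj (dzb g z) * dzb g z := (mul_conj_norm _).symm
    have eB : ((‖D z‖ ^ 2 : ℝ) : ℂ) = conj (D z) * D z := (mul_conj_norm _).symm
    have eE : ((‖g z‖ ^ 2 : ℝ) : ℂ) = conj (g z) * g z := (mul_conj_norm _).symm
    have e3 : ((1 + ‖z‖ ^ 2 : ℝ) : ℂ) = Nc z := (Nc_eq z).symm
    have eW : W z = Nc z ^ 4 * (ff ρ v z : ℂ) := by simp only [hW, cx]; ring
    simp only [hA, hB, hE, hM]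
    simp only [Complex.ofReal_sub, Complex.ofReal_add, Complex.ofReal_mul, Complex.ofReal_div]
    simp only [Complex.ofReal_pow (1 + ‖z‖ ^ 2), e3, eA, eB, eE]
    rw [eW]
    simp only [hD, map_add, map_mul]
    push_cast
    field_simp
    ring
  have gc := hg.continuous
  have fc := hf1.continuous
  have mc := h.mu_cont
  have Dc := Dcd.continuous
  have dc := hdzb.continuous
  have hg0 : ∀ z, z ∉ tsupport g → dz g z = 0 ∧ dzb g z = 0 ∧ g z = 0 := by
    intro z hz
    have : g =ᶠ[nhds z] fun _ => 0 := notMem_tsupport_iff_eventuallyEq.1 hz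
    have hw : HasW g 0 0 z := HasFDerivAt.congr_of_eventuallyEq (hasW_const 0 z) this
    exact ⟨hw.dz, hw.dzb, this.eq_of_nhds⟩
  have supp : ∀ {F : ℂ → ℝ}, Continuous F → (∀ z, z ∉ tsupport g → F z = 0) → Integrable F := by
    intro F hF h0
    exact hF.integrable_of_hasCompactSupport (HasCompactSupport.intro hc h0)
  have iA : Integrable A := supp (by simp only [hA]; fun_prop) (fun z hz => by simp [hA, hg0 z hz])
  have iB : Integrable B := supp (by simp only [hB]; fun_prop) (fun z hz => by simp [hB, hD, hg0 z hz])
  have iE : Integrable E := supp (by simp only [hE]; fun_prop) (fun z hz => by simp [hE, hg0 z hz])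
  have iM : Integrable M := supp (by simp only [hM]; fun_prop) (fun z hz => by simp [hM, hg0 z hz])
  have j1 : Integrable (dz P1) := (continuous_dz P1cd).integrable_of_hasCompactSupport (hcs_dz hcg.mul_right)
  have j2 : Integrable (dzb P2) := (continuous_dzb P2cd).integrable_of_hasCompactSupport (hcs_dzb hcg.mul_right)
  have h5 : ∫ z, (A z - B z - ((4 - ρ) * E z + M z)) = 0 := by
    have : ((∫ z, (A z - B z - ((4 - ρ) * E z + M z)) : ℝ) : ℂ) = 0 := by
      rw [← integral_complex_ofReal]
      calc _ = ∫ z, (dz P1 z - dzb P2 z) := by congr 1; ext z; exact (key z).symm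
        _ = 0 := by rw [integral_sub j1 j2, i1, i2, sub_zero]
    exact_mod_cast this
  have iEM : Integrable (fun z => (4 - ρ) * E z + M z) := (iE.const_mul _).add iM
  have iAB : Integrable (fun z => A z - B z) := iA.sub iB
  rw [integral_sub iAB iEM, integral_sub iA iB, integral_add (iE.const_mul _) iM, integral_const_mul] at h5
  have hB0 : 0 ≤ ∫ z, B z := integral_nonneg fun z => by have := ff_pos ρ v z; simp only [hB]; positivity
  have hM0 : 0 ≤ ∫ z, M z := integral_nonneg fun z => by
    have := ff_pos ρ v z; have := mu_pos ρ v z; simp only [hM]; positivity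
  linarith

lemma Sol.ident2 {ρ : ℝ} {v : ℂ → ℝ} (h : Sol ρ v) {η : ℂ → ℝ} (hη : ContDiff ℝ 2 η) (hc : HasCompactSupport η) :
    (4 - ρ) * (∫ z, η z ^ 2 * ‖qf ρ v z‖ ^ 2 * (1 + ‖z‖ ^ 2) ^ 2 * ff ρ v z) ≤
     2 * (2 * (ρ - 1)) ^ 2 * (∫ z, η z ^ 2 * ‖af ρ v z‖ ^ 2 * ff ρ v z) +
      2 * ∫ z, ‖dz (cx η) z‖ ^ 2 * ‖qf ρ v z‖ ^ 2 * (1 + ‖z‖ ^ 2) ^ 4 * ff ρ v z := by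
  have hη1 : ContDiff ℝ 1 η := hη.of_le (by norm_num)
  have hq1 : ContDiff ℝ 1 (qf ρ v) := h.qf_cd.of_le (by norm_num)
  have hf1 : ContDiff ℝ 1 (ff ρ v) := h.ff_cd.of_le (by norm_num)
  have ηc := hη.continuous
  have ac := h.af_cd1.continuous
  have qc := hq1.continuous
  have fc := hf1.continuous
  have ec := continuous_dz (cx_cd hη1)
  have hcc : HasCompactSupport (cx η) := hc.comp_left (g := fun x : ℝ => (x : ℂ)) Complex.ofReal_zero
  have gcd : ContDiff ℝ 2 (fun z => cx η z * qf ρ v z) := (cx_cd hη).mul h.qf_cd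
  have H := h.hormander gcd hcc.mul_right
  have e1 : ∀ z, ‖cx η z * qf ρ v z‖ ^ 2 * (1 + ‖z‖ ^ 2) ^ 2 * ff ρ v z = η z ^ 2 * ‖qf ρ v z‖ ^ 2 * (1 + ‖z‖ ^ 2) ^ 2 * ff ρ v z := by
    intro z
    rw [norm_mul, mul_pow]; simp [cx]
  simp only [e1] at H
  refine H.trans ?_
  have iy : Integrable (fun z => η z ^ 2 * ‖af ρ v z‖ ^ 2 * ff ρ v z) := by
    refine Continuous.integrable_of_hasCompactSupport (by fun_prop) (hc.mono ?_)
    intro z hz hz'; exact hz (by simp [hz'])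
  have ie : Integrable (fun z => ‖dz (cx η) z‖ ^ 2 * ‖qf ρ v z‖ ^ 2 * (1 + ‖z‖ ^ 2) ^ 4 * ff ρ v z) := by
    refine Continuous.integrable_of_hasCompactSupport (by fun_prop) ((hcs_dz hcc).mono ?_)
    intro z hz hz'; exact hz (by simp [hz'])
  rw [← integral_const_mul, ← integral_const_mul, ← integral_add (iy.const_mul _) (ie.const_mul _)]
  refine integral_mono_of_nonneg (Filter.Eventually.of_forall fun z => ?_) ((iy.const_mul _).add (ie.const_mul _)) (Filter.Eventually.of_forall fun z => ?_)
  · have := ff_pos ρ v z; simp only [Pi.zero_apply]; positivity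
  · have e : dzb (fun z => cx η z * qf ρ v z) z = conj (dz (cx η) z) * qf ρ v z + η z * (-(2 * (ρ - 1)) * ((Nc z)⁻¹ ^ 2 * af ρ v z)) := by
      rw [((cd_hasW (cx_cd hη1) z).mul (cd_hasW hq1 z)).dzb, dzb_cx hη1, h.qf_dzb]; rfl
    have hN := N_pos z
    have hf := ff_pos ρ v z
    have hn : ‖dzb (fun z => cx η z * qf ρ v z) z‖ ≤ ‖dz (cx η) z‖ * ‖qf ρ v z‖ + |η z| * (2 * (ρ - 1) * ((1 + ‖z‖ ^ 2)⁻¹ ^ 2 * ‖af ρ v z‖)) := by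
      rw [e]
      refine (norm_add_le _ _).trans (le_of_eq ?_)
      have : ‖(-(2 * (ρ - 1)) : ℂ)‖ = 2 * (ρ - 1) := by
        rw [norm_neg, show (2 * ((ρ:ℂ) - 1)) = ((2 * (ρ - 1) : ℝ) : ℂ) by push_cast; ring, Complex.norm_real, Real.norm_of_nonneg (by linarith [h.h1])]
      rw [norm_mul, norm_mul, norm_mul, norm_mul, RCLike.norm_conj, this, Complex.norm_real, norm_pow, norm_inv, Nc_eq, Complex.norm_real,
        Real.norm_of_nonneg hN.le, Real.norm_eq_abs]
    have hsq : ‖dzb (fun z => cx η z * qf ρ v z) z‖ ^ 2 ≤ 2 * (‖dz (cx η) z‖ * ‖qf ρ v z‖) ^ 2 + 2 * (|η z| * (2 * (ρ - 1) * ((1 + ‖z‖ ^ 2)⁻¹ ^ 2 * ‖af ρ v z‖))) ^ 2 := by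
      refine (pow_le_pow_left₀ (norm_nonneg _) hn 2).trans ?_
      nlinarith [sq_nonneg (‖dz (cx η) z‖ * ‖qf ρ v z‖ - |η z| * (2 * (ρ - 1) * ((1 + ‖z‖ ^ 2)⁻¹ ^ 2 * ‖af ρ v z‖)))]
    refine (mul_le_mul_of_nonneg_right hsq (by positivity)).trans (le_of_eq ?_)
    simp only [mul_pow, sq_abs]
    field_simp
    ring

lemma Sol.main_ineq {ρ : ℝ} {v : ℂ → ℝ} (h : Sol ρ v) {η : ℂ → ℝ} (hη : ContDiff ℝ 2 η) (hc : HasCompactSupport η) :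
    2 * (ρ - 1) * (∫ z, η z ^ 2 * ‖af ρ v z‖ ^ 2 * ff ρ v z) ≤
      5 * ((∫ z, 2 * |η z| * ‖dz (cx η) z‖ * ‖qf ρ v z‖ * (1 + ‖z‖ ^ 2) ^ 2 * ‖af ρ v z‖ * ff ρ v z)
       + ∫ z, ‖dz (cx η) z‖ ^ 2 * ‖qf ρ v z‖ ^ 2 * (1 + ‖z‖ ^ 2) ^ 4 * ff ρ v z) := by
  have h1 := h.ident1 hη hc
  have h2 := h.ident2 hη hc
  have hX : 0 ≤ ∫ z, η z ^ 2 * ‖qf ρ v z‖ ^ 2 * (1 + ‖z‖ ^ 2) ^ 2 * ff ρ v z :=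
    integral_nonneg fun z => by have := ff_pos ρ v z; simp only [Pi.zero_apply]; positivity
  have hE1 : 0 ≤ ∫ z, 2 * |η z| * ‖dz (cx η) z‖ * ‖qf ρ v z‖ * (1 + ‖z‖ ^ 2) ^ 2 * ‖af ρ v z‖ * ff ρ v z :=
    integral_nonneg fun z => by have := ff_pos ρ v z; simp only [Pi.zero_apply]; positivity
  have hE2 : 0 ≤ ∫ z, ‖dz (cx η) z‖ ^ 2 * ‖qf ρ v z‖ ^ 2 * (1 + ‖z‖ ^ 2) ^ 4 * ff ρ v z :=
    integral_nonneg fun z => by have := ff_pos ρ v z; simp only [Pi.zero_apply]; positivity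
  set X := ∫ z, η z ^ 2 * ‖qf ρ v z‖ ^ 2 * (1 + ‖z‖ ^ 2) ^ 2 * ff ρ v z
  set Y := ∫ z, η z ^ 2 * ‖af ρ v z‖ ^ 2 * ff ρ v z
  set E1 := ∫ z, 2 * |η z| * ‖dz (cx η) z‖ * ‖qf ρ v z‖ * (1 + ‖z‖ ^ 2) ^ 2 * ‖af ρ v z‖ * ff ρ v z
  set E2 := ∫ z, ‖dz (cx η) z‖ ^ 2 * ‖qf ρ v z‖ ^ 2 * (1 + ‖z‖ ^ 2) ^ 4 * ff ρ v z
  have hl0 : 0 ≤ 2 * (ρ - 1) := by linarith [h.h1]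
  have hl1 : 2 * (ρ - 1) ≤ 1 := by linarith [h.h2]
  have h3 : 2 * (2 * (ρ - 1)) ^ 2 * Y ≤ 2 * (X + E1) := by nlinarith
  have h4 : 5/2 * X ≤ (4 - ρ) * X := mul_le_mul_of_nonneg_right (by linarith [h.h2]) hX
  linarith

end RS

namespace RS
open Complex (I)
open scoped ComplexConjugate ContDiff

lemma integral_japanese' {s : ℝ} (hs : 0 < s) : Integrable (fun x : ℂ => (1 + ‖x‖ ^ 2) ^ (-s - 1)) ∧
    ∫ x : ℂ, (1 + ‖x‖ ^ 2) ^ (-s - 1) = π / s := by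
  have hd : ∀ x ∈ Set.Ici (0 : ℝ), HasDerivAt (fun y : ℝ => -(2 * s)⁻¹ * (1 + y ^ 2) ^ (-s))
      (x * (1 + x ^ 2) ^ (-s - 1)) x := by
    intro x _
    have h1 : HasDerivAt (fun y : ℝ => 1 + y ^ 2) (2 * x) x := by
      have := (hasDerivAt_pow 2 x).const_add 1
      simpa using this
    have := (h1.rpow_const (p := -s) (Or.inl (by positivity))).const_mul (-(2 * s)⁻¹)
    refine this.congr_deriv ?_
    field_simp
  have hlim : Filter.Tendsto (fun y : ℝ => -(2 * s)⁻¹ * (1 + y ^ 2) ^ (-s)) Filter.atTop (nhds 0) := by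
    have : Filter.Tendsto (fun y : ℝ => (1 + y ^ 2)) Filter.atTop Filter.atTop := by
      apply Filter.tendsto_atTop_add_const_left
      exact Filter.tendsto_pow_atTop (by norm_num)
    simpa using ((tendsto_rpow_neg_atTop hs).comp this).const_mul (-(2 * s)⁻¹)
  have hpos : ∀ x ∈ Set.Ioi (0 : ℝ), 0 ≤ x * (1 + x ^ 2) ^ (-s - 1) := by
    intro x hx; have : 0 < x := hx; positivity
  have hi : IntegrableOn (fun x : ℝ => x * (1 + x ^ 2) ^ (-s - 1)) (Set.Ioi 0) :=
    integrableOn_Ioi_deriv_of_nonneg' hd hpos hlim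
  have hv := integral_Ioi_of_hasDerivAt_of_nonneg' hd hpos hlim
  constructor
  · rw [integrable_fun_norm_addHaar volume (f := fun y => (1 + y ^ 2) ^ (-s - 1))]
    simpa using hi
  · rw [integral_fun_norm_addHaar volume (fun y => (1 + y ^ 2) ^ (-s - 1))]
    simp only [Complex.finrank_real_complex, Nat.add_one_sub_one, pow_one, smul_eq_mul]
    rw [hv]
    simp [Measure.real]
    field_simp

lemma st_deriv_bd : ∃ C : ℝ, 0 ≤ C ∧ ∀ x, |deriv Real.smoothTransition x| ≤ C := by
  have hc : Continuous (deriv Real.smoothTransition) :=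
    (Real.smoothTransition.contDiff (n := 1)).continuous_deriv (by norm_num)
  obtain ⟨C, hC⟩ := (isCompact_Icc (a := (0:ℝ)) (b := 1)).exists_bound_of_continuousOn hc.continuousOn
  have hC0 : 0 ≤ C := (norm_nonneg _).trans (hC 0 (by simp))
  refine ⟨C, hC0, fun x => ?_⟩
  by_cases h0 : x < 0
  · have : Real.smoothTransition =ᶠ[nhds x] fun _ => 0 := by
      filter_upwards [eventually_lt_nhds h0] with y hy using Real.smoothTransition.zero_of_nonpos hy.le
    rw [this.deriv_eq]; simpa using hC0
  by_cases h1 : 1 < x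
  · have : Real.smoothTransition =ᶠ[nhds x] fun _ => 1 := by
      filter_upwards [eventually_gt_nhds h1] with y hy using Real.smoothTransition.one_of_one_le hy.le
    rw [this.deriv_eq]; simpa using hC0
  · exact hC x ⟨not_lt.1 h0, not_lt.1 h1⟩

/-- logarithmic cutoff -/
noncomputable def cut (L : ℝ) (z : ℂ) : ℝ := Real.smoothTransition (2 - L⁻¹ * lg z)

lemma cut_cd (L : ℝ) : ContDiff ℝ 2 (cut L) :=
  (Real.smoothTransition.contDiff (n := 2)).comp (contDiff_const.sub (contDiff_const.mul lg_cd))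

lemma cut_one {L : ℝ} (hL : 0 < L) {z : ℂ} (h : lg z ≤ L) : cut L z = 1 := by
  apply Real.smoothTransition.one_of_one_le
  have : L⁻¹ * lg z ≤ 1 := by rw [inv_mul_le_iff₀ hL]; linarith
  linarith

lemma cut_zero {L : ℝ} (hL : 0 < L) {z : ℂ} (h : 2 * L ≤ lg z) : cut L z = 0 := by
  apply Real.smoothTransition.zero_of_nonpos
  have : 2 ≤ L⁻¹ * lg z := by rw [le_inv_mul_iff₀ hL]; linarith
  linarith

lemma cut_hcs {L : ℝ} (hL : 0 < L) : HasCompactSupport (cut L) := by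
  refine HasCompactSupport.intro (isCompact_closedBall (0:ℂ) (Real.exp L)) fun z hz => ?_
  apply cut_zero hL
  have hz' : Real.exp L < ‖z‖ := by simpa using hz
  unfold lg
  rw [Real.le_log_iff_exp_le (N_pos z), two_mul, Real.exp_add]
  nlinarith [Real.exp_pos L]

lemma lg_cont : Continuous lg := (lg_cd (n := 0)).continuous

lemma cut_dz (L : ℝ) (z : ℂ) :
    dz (cx (cut L)) z = ((deriv Real.smoothTransition (2 - L⁻¹ * lg z) * (-L⁻¹) : ℝ) : ℂ) * sf z := by
  have h1 : HasDerivAt (fun s : ℝ => Real.smoothTransition (2 - L⁻¹ * s))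
      (deriv Real.smoothTransition (2 - L⁻¹ * lg z) * (-L⁻¹)) (lg z) := by
    have h2 : HasDerivAt (fun s : ℝ => 2 - L⁻¹ * s) (-L⁻¹) (lg z) := by
      have := ((hasDerivAt_id (lg z)).const_mul L⁻¹).const_sub 2
      simpa using this
    have h3 : HasDerivAt Real.smoothTransition (deriv Real.smoothTransition (2 - L⁻¹ * lg z)) (2 - L⁻¹ * lg z) :=
      ((Real.smoothTransition.contDiff (n := 1)).differentiable (by norm_num) _).hasDerivAt
    exact h3.comp (lg z) h2
  exact (HasW.comp_real h1 (hasW_lg z)).dz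

lemma sf_bd (z : ℂ) : ‖sf z‖ ≤ 2 * (1 + ‖z‖) ^ (-(1:ℝ)) := by
  have h1 := nb_mul (nb_pow 1 z) (Ninv_le z)
  have e : ‖sf z‖ = ‖z ^ 1 * (Nc z)⁻¹‖ := by
    unfold sf; rw [norm_mul, norm_mul, RCLike.norm_conj, pow_one]
  rw [e]; convert h1 using 2
  · norm_num
  · norm_num

lemma N_le (z : ℂ) : 1 + ‖z‖ ^ 2 ≤ (1 + ‖z‖) ^ (2:ℝ) := by
  rw [Real.rpow_two]; nlinarith [norm_nonneg z]

lemma Sol.ff_bd {ρ : ℝ} {v : ℂ → ℝ} (h : Sol ρ v) : ∃ F : ℝ, 0 ≤ F ∧ ∀ z, ff ρ v z ≤ F := by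
  obtain ⟨B, hB⟩ := h.uf_bd
  refine ⟨Real.exp (1/2 * B), (Real.exp_pos _).le, fun z => Real.exp_le_exp.2 ?_⟩
  linarith [(abs_le.1 (hB z)).1]

lemma Sol.Y_bd {ρ : ℝ} {v : ℂ → ℝ} (h : Sol ρ v) :
    ∃ K : ℝ, 0 ≤ K ∧ ∀ L : ℝ, 0 < L → 2 * (ρ - 1) * (∫ z, cut L z ^ 2 * ‖af ρ v z‖ ^ 2 * ff ρ v z) ≤ K / L := by
  obtain ⟨c, hc0, hc⟩ := st_deriv_bd
  obtain ⟨A, hA0, hA⟩ := h.af_bd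
  obtain ⟨Q, hQ0, hQ⟩ := h.qf_bd
  obtain ⟨F, hF0, hF⟩ := h.ff_bd
  set J := ∫ x : ℂ, (1 + ‖x‖) ^ (-(5/2:ℝ)) with hJ
  have hJ0 : 0 ≤ J := integral_nonneg fun x => by simp only [Pi.zero_apply]; positivity
  refine ⟨5 * (4 * c * Q * A * F * J + 4 * c ^ 2 * Q ^ 2 * F * Real.exp 2 * π), by positivity, fun L hL => ?_⟩
  have hLi : 0 < L⁻¹ := inv_pos.2 hL
  have eb : ∀ z, ‖dz (cx (cut L)) z‖ ≤ c * L⁻¹ * (2 * (1 + ‖z‖) ^ (-(1:ℝ))) := by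
    intro z
    rw [cut_dz, norm_mul, Complex.norm_real, norm_mul, norm_neg, Real.norm_of_nonneg hLi.le, Real.norm_eq_abs]
    have h1 := hc (2 - L⁻¹ * lg z)
    have h2 := sf_bd z
    gcongr
  have e0 : ∀ z, 2 * L < lg z → dz (cx (cut L)) z = 0 := by
    intro z hz
    have hn : (2 - L⁻¹ * lg z) < 0 := by
      have : 2 < L⁻¹ * lg z := by rw [lt_inv_mul_iff₀ hL]; linarith
      linarith
    have : Real.smoothTransition =ᶠ[nhds (2 - L⁻¹ * lg z)] fun _ => 0 := by
      filter_upwards [eventually_lt_nhds hn] with y hy using Real.smoothTransition.zero_of_nonpos hy.le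
    rw [cut_dz, this.deriv_eq]; simp
  have hmain := h.main_ineq (cut_cd L) (cut_hcs hL)
  refine hmain.trans ?_
  have hc01 : ∀ z, |cut L z| ≤ 1 := by
    intro z; unfold cut; rw [abs_of_nonneg (Real.smoothTransition.nonneg _)]; exact Real.smoothTransition.le_one _
  have hE1 : (∫ z, 2 * |cut L z| * ‖dz (cx (cut L)) z‖ * ‖qf ρ v z‖ * (1 + ‖z‖ ^ 2) ^ 2 * ‖af ρ v z‖ * ff ρ v z)
      ≤ 4 * c * Q * A * F * L⁻¹ * J := by
    rw [hJ, ← integral_const_mul]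
    refine integral_mono_of_nonneg (Filter.Eventually.of_forall fun z => ?_) (int_52.const_mul _) (Filter.Eventually.of_forall fun z => ?_)
    · have := ff_pos ρ v z; simp only [Pi.zero_apply]; positivity
    · have hf := ff_pos ρ v z
      have hr : 0 < 1 + ‖z‖ := by positivity
      have k1 := hc01 z; have k2 := eb z; have k3 := hQ z; have k4 := N_le z; have k5 := hA z; have k6 := hF z
      calc 2 * |cut L z| * ‖dz (cx (cut L)) z‖ * ‖qf ρ v z‖ * (1 + ‖z‖ ^ 2) ^ 2 * ‖af ρ v z‖ * ff ρ v z
          ≤ 2 * 1 * (c * L⁻¹ * (2 * (1 + ‖z‖) ^ (-(1:ℝ)))) * (Q * (1 + ‖z‖) ^ (-(4:ℝ))) * ((1 + ‖z‖) ^ (2:ℝ)) ^ 2 * (A * (1 + ‖z‖) ^ (-(2:ℝ))) * F := by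
            gcongr
        _ = 4 * c * Q * A * F * L⁻¹ * ((1 + ‖z‖) ^ (-(1:ℝ)) * (1 + ‖z‖) ^ (-(4:ℝ)) * ((1 + ‖z‖) ^ (2:ℝ) * (1 + ‖z‖) ^ (2:ℝ)) * (1 + ‖z‖) ^ (-(2:ℝ))) := by ring
        _ ≤ _ := by
          refine mul_le_mul_of_nonneg_left ?_ (by positivity)
          rw [rp_mul, rp_mul, rp_mul, rp_mul]
          exact rp_le z (by norm_num)
  have hj := integral_japanese' hLi
  have hE2 : (∫ z, ‖dz (cx (cut L)) z‖ ^ 2 * ‖qf ρ v z‖ ^ 2 * (1 + ‖z‖ ^ 2) ^ 4 * ff ρ v z)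
      ≤ 4 * c ^ 2 * Q ^ 2 * F * L⁻¹ ^ 2 * Real.exp 2 * (π / L⁻¹) := by
    rw [← hj.2, ← integral_const_mul]
    refine integral_mono_of_nonneg (Filter.Eventually.of_forall fun z => ?_) (hj.1.const_mul _) (Filter.Eventually.of_forall fun z => ?_)
    · have := ff_pos ρ v z; simp only [Pi.zero_apply]; positivity
    · have hf := ff_pos ρ v z
      have hN := N_pos z
      have hr : 0 < 1 + ‖z‖ := by positivity
      by_cases hz : 2 * L < lg z
      · beta_reduce; rw [e0 z hz, norm_zero, zero_pow two_ne_zero, zero_mul, zero_mul, zero_mul]; positivity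
      · push Not at hz
        have k2 := eb z; have k3 := hQ z; have k4 := N_le z; have k6 := hF z
        have k7 : (1 + ‖z‖ ^ 2) ^ (-1:ℝ) ≤ Real.exp 2 * (1 + ‖z‖ ^ 2) ^ (-L⁻¹ - 1) := by
          rw [Real.rpow_sub_one hN.ne', Real.rpow_neg_one, div_eq_mul_inv, ← mul_assoc]
          refine le_mul_of_one_le_left (by positivity) ?_
          rw [Real.rpow_def_of_pos hN, ← Real.exp_add]
          apply Real.one_le_exp
          have : lg z * L⁻¹ ≤ 2 := by rw [← div_eq_mul_inv, div_le_iff₀ hL]; exact hz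
          unfold lg at this; linarith
        have k8 : (1 + ‖z‖) ^ (-(2:ℝ)) ≤ (1 + ‖z‖ ^ 2) ^ (-1:ℝ) := by
          rw [Real.rpow_neg_one, Real.rpow_neg hr.le]
          exact inv_anti₀ hN (N_le z)
        calc ‖dz (cx (cut L)) z‖ ^ 2 * ‖qf ρ v z‖ ^ 2 * (1 + ‖z‖ ^ 2) ^ 4 * ff ρ v z
            ≤ (c * L⁻¹ * (2 * (1 + ‖z‖) ^ (-(1:ℝ)))) ^ 2 * (Q * (1 + ‖z‖) ^ (-(4:ℝ))) ^ 2 * ((1 + ‖z‖) ^ (2:ℝ)) ^ 4 * F := by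
              gcongr
          _ = 4 * c ^ 2 * Q ^ 2 * F * L⁻¹ ^ 2 * (((1 + ‖z‖) ^ (-(1:ℝ)) * (1 + ‖z‖) ^ (-(1:ℝ))) * ((1 + ‖z‖) ^ (-(4:ℝ)) * (1 + ‖z‖) ^ (-(4:ℝ))) * (((1 + ‖z‖) ^ (2:ℝ) * (1 + ‖z‖) ^ (2:ℝ)) * ((1 + ‖z‖) ^ (2:ℝ) * (1 + ‖z‖) ^ (2:ℝ)))) := by ring
          _ = 4 * c ^ 2 * Q ^ 2 * F * L⁻¹ ^ 2 * (1 + ‖z‖) ^ (-(2:ℝ)) := by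
            simp only [rp_mul]; norm_num
          _ ≤ 4 * c ^ 2 * Q ^ 2 * F * L⁻¹ ^ 2 * (Real.exp 2 * (1 + ‖z‖ ^ 2) ^ (-L⁻¹ - 1)) :=
            mul_le_mul_of_nonneg_left (k8.trans k7) (by positivity)
          _ = _ := by ring
  have e1 : 4 * c ^ 2 * Q ^ 2 * F * L⁻¹ ^ 2 * Real.exp 2 * (π / L⁻¹) = 4 * c ^ 2 * Q ^ 2 * F * Real.exp 2 * π * L⁻¹ := by
    field_simp
  rw [e1] at hE2
  rw [div_eq_mul_inv]
  linarith

lemma Sol.af_zero {ρ : ℝ} {v : ℂ → ℝ} (h : Sol ρ v) (z : ℂ) : af ρ v z = 0 := by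
  obtain ⟨K, hK0, hK⟩ := h.Y_bd
  have ac := h.af_cd1.continuous
  have fc := h.ff_cd.continuous
  set L0 : ℝ := 1 + |lg z| with hL0
  have hL0p : 0 < L0 := by positivity
  have hcont : ∀ L, Continuous (fun z => cut L z ^ 2 * ‖af ρ v z‖ ^ 2 * ff ρ v z) := by
    intro L; have := (cut_cd L).continuous; fun_prop
  have hcs : ∀ L, 0 < L → HasCompactSupport (fun z => cut L z ^ 2 * ‖af ρ v z‖ ^ 2 * ff ρ v z) := by
    intro L hL; refine (cut_hcs hL).mono ?_
    intro z hz hz'; exact hz (by simp [hz'])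
  have hle : ∀ L, 2 * L0 ≤ L → (∫ z, cut L0 z ^ 2 * ‖af ρ v z‖ ^ 2 * ff ρ v z) ≤ ∫ z, cut L z ^ 2 * ‖af ρ v z‖ ^ 2 * ff ρ v z := by
    intro L hL
    have hLp : 0 < L := by linarith
    refine integral_mono ((hcont L0).integrable_of_hasCompactSupport (hcs L0 hL0p)) ((hcont L).integrable_of_hasCompactSupport (hcs L hLp)) fun w => ?_
    have hf := ff_pos ρ v w
    by_cases hw : 2 * L0 ≤ lg w
    · simp only [cut_zero hL0p hw]; simp; positivity
    · have h1 : cut L w = 1 := cut_one hLp (by linarith)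
      have h2 : cut L0 w ^ 2 ≤ 1 := pow_le_one₀ (Real.smoothTransition.nonneg _) (Real.smoothTransition.le_one _)
      simp only [h1]
      exact mul_le_mul_of_nonneg_right (mul_le_mul_of_nonneg_right (by simpa only [one_pow] using h2) (by positivity)) hf.le
  have hl : 0 < 2 * (ρ - 1) := by linarith [h.h1]
  have hY : (∫ z, cut L0 z ^ 2 * ‖af ρ v z‖ ^ 2 * ff ρ v z) ≤ 0 := by
    have : Filter.Tendsto (fun L : ℝ => K / L) Filter.atTop (nhds 0) := tendsto_const_nhds.div_atTop Filter.tendsto_id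
    have h2 : 2 * (ρ - 1) * (∫ z, cut L0 z ^ 2 * ‖af ρ v z‖ ^ 2 * ff ρ v z) ≤ 0 := by
      refine ge_of_tendsto this ?_
      filter_upwards [Filter.eventually_ge_atTop (2 * L0)] with L hL
      exact (mul_le_mul_of_nonneg_left (hle L hL) hl.le).trans (hK L (by linarith))
    by_contra hcon
    push Not at hcon
    have := mul_pos hl hcon
    linarith
  by_contra hne
  have hpos := (hcont L0).integral_pos_of_hasCompactSupport_nonneg_nonzero (μ := volume) (x := z) (hcs L0 hL0p)
    (fun w => by have := ff_pos ρ v w; simp only [Pi.zero_apply]; positivity)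
    (by
      have h1 : cut L0 z = 1 := cut_one hL0p (by rw [hL0]; linarith [le_abs_self (lg z)])
      have := (ff_pos ρ v z).ne'
      have h3 : ‖af ρ v z‖ ≠ 0 := norm_ne_zero_iff.2 hne
      rw [h1]; simp [hne, this])
  linarith

lemma Sol.uf_const {ρ : ℝ} {v : ℂ → ℝ} (h : Sol ρ v) (z : ℂ) : uf ρ v z = uf ρ v 0 := by
  have hd : ∀ t : ℝ, HasDerivAt (fun t : ℝ => uf ρ v (t * z)) 0 t := by
    intro t
    have := uf_ray ρ h.cd1 z t
    rw [h.af_zero] at this; simpa using this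
  have := is_const_of_deriv_eq_zero (fun t => (hd t).differentiableAt) (fun t => (hd t).deriv) 1 0
  simpa using this

lemma Sol.radial {ρ : ℝ} {v : ℂ → ℝ} (h : Sol ρ v) (y z : ℂ) (hyz : ‖y‖ = ‖z‖) : v y = v z := by
  have h1 := h.uf_const y
  have h2 := h.uf_const z
  unfold uf lg at h1 h2
  rw [hyz] at h1
  linarith

end RS

namespace RS
open Complex (I)
open scoped ComplexConjugate ContDiff

lemma lap_cx {V : ℂ → ℝ} (hV : ContDiff ℝ 2 V) (z : ℂ) :
    dzb (dz (cx V)) z = (((fderiv ℝ (fderiv ℝ V) z 1 1 + fderiv ℝ (fderiv ℝ V) z I I) / 4 : ℝ) : ℂ) := by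
  have hd : Differentiable ℝ V := hV.differentiable (by norm_num)
  have hF : DifferentiableAt ℝ (fderiv ℝ V) z :=
    ((hV.fderiv_right (m := 1) (by norm_num)).differentiable (by norm_num)).differentiableAt
  have hs : fderiv ℝ (fderiv ℝ V) z 1 I = fderiv ℝ (fderiv ℝ V) z I 1 :=
    (hV.contDiffAt (x := z)).isSymmSndFDerivAt (by simp) 1 I
  have e1 : dz (cx V) = fun w => ((fderiv ℝ V w 1 : ℂ) - I * (fderiv ℝ V w I : ℂ)) / 2 := by
    funext w
    have : HasFDerivAt (cx V) (Complex.ofRealCLM.comp (fderiv ℝ V w)) w :=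
      Complex.ofRealCLM.hasFDerivAt.comp w (hd w).hasFDerivAt
    simp [dz, this.fderiv]
  have e2 : ∀ e : ℂ, HasFDerivAt (fun w => ((fderiv ℝ V w e : ℝ) : ℂ))
      (Complex.ofRealCLM.comp ((fderiv ℝ (fderiv ℝ V) z).flip e)) z := by
    intro e
    have h1 : HasFDerivAt (fun w => fderiv ℝ V w e) ((fderiv ℝ (fderiv ℝ V) z).flip e) z := by
      have := hF.hasFDerivAt.clm_apply (hasFDerivAt_const e z)
      rwa [ContinuousLinearMap.comp_zero, zero_add] at this
    exact Complex.ofRealCLM.hasFDerivAt.comp z h1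
  have e3 := ((e2 1).sub ((e2 I).const_mul I)).mul_const (2⁻¹ : ℂ)
  have e4 : dz (cx V) = fun w => ((fderiv ℝ V w 1 : ℂ) - I * (fderiv ℝ V w I : ℂ)) * 2⁻¹ := by
    rw [e1]; funext w; rw [div_eq_mul_inv]
  rw [e4, dzb]
  have e5 := e3.fderiv
  simp only [Pi.sub_def] at e5
  rw [e5]
  simp [hs]
  linear_combination (-(fderiv ℝ (fderiv ℝ V) z I I : ℂ) / 4) * Complex.I_sq

lemma lap_transfer (T : ℂ ≃ₗᵢ[ℝ] EuclideanSpace ℝ (Fin 2))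
    (T1 : T 1 = EuclideanSpace.single 0 1) (TI : T I = EuclideanSpace.single 1 1)
    {v : EuclideanSpace ℝ (Fin 2) → ℝ} (hv : ContDiff ℝ 2 v) (z : ℂ) :
    fderiv ℝ (fderiv ℝ (fun w => v (T w))) z 1 1 + fderiv ℝ (fderiv ℝ (fun w => v (T w))) z I I
      = planeLaplacian v (T z) := by
  have hd : Differentiable ℝ v := hv.differentiable (by norm_num)
  have hV : ContDiff ℝ 2 (fun w => v (T w)) := hv.comp T.contDiff
  have hF : DifferentiableAt ℝ (fderiv ℝ (fun w => v (T w))) z :=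
    ((hV.fderiv_right (m := 1) (by norm_num)).differentiable (by norm_num)).differentiableAt
  have hG : DifferentiableAt ℝ (fderiv ℝ v) (T z) :=
    ((hv.fderiv_right (m := 1) (by norm_num)).differentiable (by norm_num)).differentiableAt
  have hT : ∀ w, HasFDerivAt (fun w => T w) (T.toContinuousLinearEquiv : ℂ →L[ℝ] EuclideanSpace ℝ (Fin 2)) w :=
    fun w => T.toContinuousLinearEquiv.hasFDerivAt
  have key : ∀ e : ℂ, fderiv ℝ (fderiv ℝ (fun w => v (T w))) z e e
      = fderiv ℝ (fun y => fderiv ℝ v y (T e)) (T z) (T e) := by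
    intro e
    have h1 : HasFDerivAt (fun w => fderiv ℝ (fun w => v (T w)) w e) ((fderiv ℝ (fderiv ℝ (fun w => v (T w))) z).flip e) z := by
      have := hF.hasFDerivAt.clm_apply (hasFDerivAt_const e z)
      rwa [ContinuousLinearMap.comp_zero, zero_add] at this
    have h2 : (fun w => fderiv ℝ (fun w => v (T w)) w e) = fun w => fderiv ℝ v (T w) (T e) := by
      funext w
      have := ((hd (T w)).hasFDerivAt.comp w (hT w)).fderiv
      simp only [Function.comp_def] at this
      rw [this]; simp
    have h3 : DifferentiableAt ℝ (fun y => fderiv ℝ v y (T e)) (T z) :=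
      hG.clm_apply (differentiableAt_const _)
    have h4 := h3.hasFDerivAt.comp z (hT z)
    rw [h2] at h1
    have h5 := congrArg (fun A => A e) (h1.unique h4)
    simpa using h5
  rw [key, key, T1, TI, planeLaplacian, Fin.sum_univ_two]

end RS

/-- If `1 < ρ ≤ 3/2`, `l = 2(ρ-1)`, and `v` is a `C²` solution of
`Δv + (1+|y|²)^l e^v = 0` on `ℝ²` with total mass `∫ (1+|y|²)^l e^v = 8πρ`
and `∇v(0) = 0`, then `v` is radially symmetric about the origin. -/
theorem radial_symmetry_critical_at_origin (ρ l : ℝ) (hρ1 : 1 < ρ) (hρ2 : ρ ≤ 3 / 2)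
    (hl : l = 2 * (ρ - 1))
    (v : EuclideanSpace ℝ (Fin 2) → ℝ) (hv : ContDiff ℝ 2 v)
    (hpde : ∀ y : EuclideanSpace ℝ (Fin 2),
      planeLaplacian v y + (1 + ‖y‖ ^ 2) ^ l * Real.exp (v y) = 0)
    (hint : Integrable (fun y : EuclideanSpace ℝ (Fin 2) =>
      (1 + ‖y‖ ^ 2) ^ l * Real.exp (v y)))
    (hmass : ∫ y : EuclideanSpace ℝ (Fin 2),
      (1 + ‖y‖ ^ 2) ^ l * Real.exp (v y) = 8 * Real.pi * ρ)
    (hgrad : fderiv ℝ v 0 = 0) :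
    ∀ y z : EuclideanSpace ℝ (Fin 2), ‖y‖ = ‖z‖ → v y = v z := by
  let T : ℂ ≃ₗᵢ[ℝ] EuclideanSpace ℝ (Fin 2) := Complex.orthonormalBasisOneI.repr
  have T1 : T 1 = EuclideanSpace.single 0 1 := by
    have := Complex.orthonormalBasisOneI.repr_self 0
    simpa using this
  have TI : T Complex.I = EuclideanSpace.single 1 1 := by
    have := Complex.orthonormalBasisOneI.repr_self 1
    simpa using this
  subst hl
  have hmu : ∀ z, RS.mu ρ (fun w => v (T w)) z = (1 + ‖T z‖ ^ 2) ^ (2 * (ρ - 1)) * Real.exp (v (T z)) := by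
    intro z; rw [RS.mu, T.norm_map]
  have hV : ContDiff ℝ 2 (fun w => v (T w)) := hv.comp T.contDiff
  have hmp := T.measurePreserving
  have hme : MeasurableEmbedding T := T.toHomeomorph.measurableEmbedding
  have hS : RS.Sol ρ (fun w => v (T w)) :=
    { h1 := hρ1
      h2 := hρ2
      cd := hV
      pde := by
        intro z
        rw [RS.lap_cx hV, RS.lap_transfer T T1 TI hv, hmu]
        congr 1
        linarith [hpde (T z)]
      int := by
        rw [funext hmu]
        exact (hmp.integrable_comp_emb hme).2 hint
      mass := by
        rw [funext hmu, ← hmass]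
        exact hmp.integral_comp hme (fun y => (1 + ‖y‖ ^ 2) ^ (2 * (ρ - 1)) * Real.exp (v y)) }
  intro y z hyz
  have := hS.radial (T.symm y) (T.symm z) (by simpa using hyz)
  simpa using this
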